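/- Let K ⊂ ℝ² be a compact strictly convex set with nonempty interior, C¹ boundary Γ = ∂K, C² support function p, and radius of curvature ρ = p + p'' of class C^r for some integer r > 5, with ρ(θ) > 0 for all θ. Then for every ε > 0, the union of all homotopically nontrivial Φ-invariant circles Ω with Hausdorff distance d_H(Ω, Γ) < ε has positive two-dimensional Lebesgue measure. -/

import Mathlib

open Real MeasureTheory

noncomputable def suppFn (K : Set (ℝ × ℝ)) (θ : ℝ) : ℝ :=
  sSup ((fun z : ℝ × ℝ => z.1 * Real.cos θ + z.2 * Real.sin θ) '' K)

def DBInvCircle (K : Set (ℝ × ℝ)) (Φ : ℝ × ℝ → ℝ × ℝ) (Ω : Set (ℝ × ℝ)) : Prop :=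
  Ω ⊆ Kᶜ ∧ IsCompact Ω ∧ Φ '' Ω = Ω ∧
    ∃ ℓ : C(AddCircle (2 * Real.pi), (Kᶜ : Set (ℝ × ℝ))),
      Function.Injective ℓ ∧ ¬ ContinuousMap.Nullhomotopic ℓ ∧
      Ω = Subtype.val '' Set.range ℓ

namespace DualBilliard

open Complex in
def strip (R : ℝ) : Set ℂ := {z | |z.im| < R}

structure SF (R : ℝ) (f : ℂ → ℂ) : Prop where
  diff : DifferentiableOn ℂ f (strip R)
  per : ∀ z, f (z + 2 * π) = f z
  real : ∀ x : ℝ, (f x).im = 0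

lemma isOpen_strip (R : ℝ) : IsOpen (strip R) :=
  isOpen_lt (continuous_abs.comp Complex.continuous_im) continuous_const

lemma convex_strip (R : ℝ) : Convex ℝ (strip R) := by
  have : strip R = Complex.imLm ⁻¹' (Set.Ioo (-R) R) := by
    ext z; simp [strip, abs_lt]
  rw [this]
  exact (convex_Ioo _ _).linear_preimage _

lemma strip_mono {R R' : ℝ} (h : R' ≤ R) : strip R' ⊆ strip R := fun _ hz => lt_of_lt_of_le hz h

lemma ofReal_mem_strip {R : ℝ} (hR : 0 < R) (x : ℝ) : (x : ℂ) ∈ strip R := by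
  simpa [strip] using hR

lemma add_ofReal_mem_strip {R : ℝ} {z : ℂ} (hz : z ∈ strip R) (x : ℝ) : z + x ∈ strip R := by
  simpa [strip] using hz

lemma sub_ofReal_mem_strip {R : ℝ} {z : ℂ} (hz : z ∈ strip R) (x : ℝ) : z - x ∈ strip R := by
  simpa [strip] using hz

lemma mem_strip_of_norm_sub_le {R r s : ℝ} {z w : ℂ} (hz : z ∈ strip r) (h : ‖w - z‖ ≤ s)
    (hR : r + s ≤ R) : w ∈ strip R := by
  have h1 : |w.im - z.im| ≤ s := by
    have := Complex.abs_im_le_norm (w - z); rw [Complex.sub_im] at this; linarith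
  have h2 : |w.im| ≤ |w.im - z.im| + |z.im| := by simpa using abs_add_le (w.im - z.im) z.im
  have h3 : |z.im| < r := hz
  show |w.im| < R
  linarith

namespace SF
variable {R R' : ℝ} {f g : ℂ → ℂ}

lemma mono (hf : SF R f) (h : R' ≤ R) : SF R' f := ⟨hf.diff.mono (strip_mono h), hf.per, hf.real⟩

lemma add (hf : SF R f) (hg : SF R g) : SF R (fun z => f z + g z) :=
  ⟨hf.diff.add hg.diff, fun z => by simp [hf.per, hg.per], fun x => by simp [hf.real, hg.real]⟩

lemma sub (hf : SF R f) (hg : SF R g) : SF R (fun z => f z - g z) :=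
  ⟨hf.diff.sub hg.diff, fun z => by simp [hf.per, hg.per], fun x => by simp [hf.real, hg.real]⟩

lemma mul (hf : SF R f) (hg : SF R g) : SF R (fun z => f z * g z) :=
  ⟨hf.diff.mul hg.diff, fun z => by simp [hf.per, hg.per], fun x => by simp [hf.real, hg.real]⟩

lemma const (R c : ℝ) : SF R (fun _ => (c : ℂ)) :=
  ⟨differentiableOn_const _, fun z => rfl, fun x => by simp⟩

lemma neg (hf : SF R f) : SF R (fun z => - f z) :=
  ⟨hf.diff.neg, fun z => by simp [hf.per], fun x => by simp [hf.real]⟩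

lemma div (hf : SF R f) (hg : SF R g) (h : ∀ z ∈ strip R, g z ≠ 0) : SF R (fun z => f z / g z) :=
  ⟨hf.diff.div hg.diff h, fun z => by simp [hf.per, hg.per], fun x => by
    simp [Complex.div_im, hf.real, hg.real]⟩

lemma shift (hf : SF R f) (ω : ℝ) : SF R (fun z => f (z + ω)) := by
  refine ⟨hf.diff.comp (by fun_prop) fun z hz => add_ofReal_mem_strip hz ω, fun z => ?_, fun x => ?_⟩
  · rw [add_right_comm, hf.per]
  · have := hf.real (x + ω); push_cast at this; exact this

lemma differentiableAt (hf : SF R f) {z : ℂ} (hz : z ∈ strip R) : DifferentiableAt ℂ f z :=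
  (hf.diff z hz).differentiableAt ((isOpen_strip R).mem_nhds hz)

lemma ofReal_re (hf : SF R f) (x : ℝ) : (((f x).re : ℝ) : ℂ) = f x := by
  apply Complex.ext <;> simp [hf.real]

lemma deriv (hf : SF R f) (hR : 0 < R) : SF R (_root_.deriv f) := by
  refine ⟨hf.diff.deriv (isOpen_strip R), fun z => ?_, fun x => ?_⟩
  · have : (fun z => f (z + 2 * π)) = f := funext hf.per
    rw [← deriv_comp_add_const, this]
  · have h1 := ((hf.differentiableAt (ofReal_mem_strip hR x)).hasDerivAt).comp_ofReal
    have h2 : HasDerivAt (fun y : ℝ => (f y).im) (_root_.deriv f x).im x :=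
      (Complex.imCLM.hasFDerivAt.comp_hasDerivAt x h1)
    have h3 : (fun y : ℝ => (f y).im) = fun _ => 0 := funext hf.real
    rw [h3] at h2
    exact h2.unique (hasDerivAt_const x (0:ℝ))

lemma norm_deriv_le (hf : SF R f) {M r s : ℝ} (hM : ∀ z ∈ strip R, ‖f z‖ ≤ M) (hs : 0 < s)
    (hr : r + s ≤ R) {z : ℂ} (hz : z ∈ strip r) : ‖_root_.deriv f z‖ ≤ M / s := by
  have hsub : Metric.closedBall z s ⊆ strip R := fun w hw =>
    mem_strip_of_norm_sub_le hz (by simpa [dist_eq_norm] using hw) hr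
  refine Complex.norm_deriv_le_of_forall_mem_sphere_norm_le hs ?_ fun w hw =>
    hM w (hsub (Metric.sphere_subset_closedBall hw))
  exact (hf.diff.mono hsub).diffContOnCl_ball subset_rfl

lemma continuous_ofReal (hf : SF R f) (hR : 0 < R) : Continuous fun x : ℝ => f x :=
  continuous_iff_continuousAt.2 fun x =>
    (hf.differentiableAt (ofReal_mem_strip hR x)).continuousAt.comp
      Complex.continuous_ofReal.continuousAt

end SF

noncomputable def fc (f : ℂ → ℂ) (k : ℤ) : ℂ :=
  (1 / (2 * π)) * ∫ x in (0:ℝ)..(2 * π), f x * Complex.exp (-(k * x * Complex.I))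

lemma integral_shift {R : ℝ} {h : ℂ → ℂ} (hd : DifferentiableOn ℂ h (strip R))
    (hp : ∀ z, h (z + 2 * π) = h z) {y : ℝ} (hy : |y| < R) :
    ∫ x in (0:ℝ)..(2 * π), h (x + y * Complex.I) = ∫ x in (0:ℝ)..(2 * π), h x := by
  have hR : 0 < R := (abs_nonneg y).trans_lt hy
  have := Complex.integral_boundary_rect_eq_zero_of_differentiableOn h 0 (2 * π + y * Complex.I)
    (hd.mono ?_)
  · have e : ∀ t : ℝ, h (((2 * π + y * Complex.I : ℂ).re : ℂ) + t * Complex.I) =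
        h (((0:ℂ).re : ℂ) + t * Complex.I) := by
      intro t
      rw [← hp (((0:ℂ).re : ℂ) + t * Complex.I)]
      congr 1
      simp
      ring
    simp only [e] at this
    simp at this
    linear_combination -this
  · intro z hz
    have h2 := hz.2
    simp at h2
    show |z.im| < R
    have := Set.abs_sub_left_of_mem_uIcc h2
    simp at this
    linarith

lemma exp_per (k : ℤ) (z : ℂ) : Complex.exp (-(k * (z + 2 * π) * Complex.I)) =
    Complex.exp (-(k * z * Complex.I)) := by
  rw [Complex.exp_eq_exp_iff_exists_int]
  exact ⟨-k, by push_cast; ring⟩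

lemma fc_shift {R : ℝ} {f : ℂ → ℂ} (hf : SF R f) {y : ℝ} (hy : |y| < R) (k : ℤ) :
    fc (fun z => f (z + y * Complex.I)) k = Complex.exp (-(k * y)) * fc f k := by
  have := integral_shift (R := R) (h := fun z => f z * Complex.exp (-(k * z * Complex.I)))
    (hf.diff.mul (by fun_prop)) (fun z => by rw [hf.per, exp_per]) hy
  unfold fc
  rw [← this, mul_left_comm, ← intervalIntegral.integral_const_mul (Complex.exp _)]
  refine congrArg (fun w : ℂ => 1 / (2 * π) * w)
    (intervalIntegral.integral_congr fun x _ => ?_)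
  simp only
  rw [mul_left_comm, ← Complex.exp_add]
  congr 2
  linear_combination k * y * Complex.I_sq

lemma norm_fc_le {f : ℂ → ℂ} {M : ℝ} (hM : ∀ x : ℝ, ‖f x‖ ≤ M) (k : ℤ) : ‖fc f k‖ ≤ M := by
  have h1 : ‖∫ x in (0:ℝ)..(2 * π), f x * Complex.exp (-(k * x * Complex.I))‖ ≤
      M * |2 * π - 0| := by
    refine intervalIntegral.norm_integral_le_of_norm_le_const fun x _ => ?_
    rw [norm_mul]
    have : ‖Complex.exp (-(k * x * Complex.I))‖ = 1 := by
      rw [Complex.norm_exp]; simp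
    rw [this, mul_one]; exact hM x
  have hpi := Real.pi_pos
  unfold fc
  rw [norm_mul]
  have : ‖(1 / (2 * π) : ℂ)‖ = 1 / (2 * π) := by
    rw [norm_div, norm_mul]; simp [abs_of_pos hpi]
  rw [this]
  rw [sub_zero, abs_of_pos (by positivity)] at h1
  calc _ ≤ 1 / (2 * π) * (M * (2 * π)) := by gcongr
    _ = M := by field_simp

lemma SF.norm_fc_le {R M : ℝ} {f : ℂ → ℂ} (hf : SF R f) (hR : 0 < R)
    (hM : ∀ z ∈ strip R, ‖f z‖ ≤ M) (k : ℤ) : ‖fc f k‖ ≤ M * rexp (-(R * |(k : ℝ)|)) := by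
  have key : ∀ y : ℝ, |y| < R → ‖fc f k‖ ≤ M * rexp (k * y) := by
    intro y hy
    have h1 : ‖fc (fun z => f (z + y * Complex.I)) k‖ ≤ M := by
      refine DualBilliard.norm_fc_le (f := fun z => f (z + y * Complex.I)) (fun x => hM _ ?_) k
      simpa [strip] using hy
    rw [fc_shift hf hy, norm_mul, Complex.norm_exp] at h1
    have e : ((-(k * y) : ℂ)).re = -(k * y) := by
      have : ((-(k * y) : ℂ)) = ((-(k * y) : ℝ) : ℂ) := by push_cast; rfl
      rw [this, Complex.ofReal_re]
    rw [e, Real.exp_neg] at h1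
    rwa [inv_mul_le_iff₀ (Real.exp_pos _), mul_comm] at h1
  have hc : ∀ s : ℝ, Continuous fun y : ℝ => M * rexp (k * (s * y)) := fun s => by fun_prop
  have lim : ∀ s : ℝ, |s| = 1 → ‖fc f k‖ ≤ M * rexp (k * (s * R)) := by
    intro s hs
    have ht := ((hc s).tendsto R).mono_left (nhdsWithin_le_nhds (s := Set.Iio R))
    refine ge_of_tendsto ht ?_
    filter_upwards [Ioo_mem_nhdsLT hR] with y hy
    refine key _ ?_
    rw [abs_mul, hs, one_mul, abs_of_pos hy.1]; exact hy.2
  rcases le_total 0 (k : ℝ) with h | h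
  · have := lim (-1) (by simp)
    rw [abs_of_nonneg h]; convert this using 3; ring
  · have := lim 1 (by simp)
    rw [abs_of_nonpos h]; convert this using 3; ring

lemma summable_exp_neg_abs {s : ℝ} (hs : 0 < s) : Summable fun k : ℤ => rexp (-(s * |(k : ℝ)|)) := by
  have h : Summable fun n : ℕ => rexp (-(s * n)) := by
    have := summable_geometric_of_lt_one (Real.exp_pos (-s)).le (Real.exp_lt_one_iff.2 (by linarith))
    refine this.congr fun n => ?_
    rw [← Real.exp_nat_mul]; congr 1; ring
  refine Summable.of_nat_of_neg (h.congr fun n => by simp) (h.congr fun n => by simp)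

lemma hasSum_fourier_of_continuous {f : ℂ → ℂ} (hc : Continuous fun x : ℝ => f x)
    (hp : ∀ z, f (z + 2 * π) = f z) (hs : Summable (fc f)) (x : ℝ) :
    HasSum (fun k : ℤ => fc f k * Complex.exp (k * x * Complex.I)) (f x) := by
  have : Fact (0 < 2 * π) := ⟨by positivity⟩
  have hper : Function.Periodic (fun x : ℝ => f x) (2 * π) := fun x => by
    have := hp x; push_cast; exact this
  let F : C(AddCircle (2 * π), ℂ) := ⟨hper.lift, by
    apply continuous_coinduced_dom.2; exact hc⟩
  have hF : ∀ x : ℝ, F (x : AddCircle (2 * π)) = f x := fun x => rfl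
  have hco : ∀ k, fourierCoeff F k = fc f k := by
    intro k
    rw [fourierCoeff_eq_intervalIntegral _ k 0, zero_add]
    unfold fc
    rw [Complex.real_smul]
    congr 1
    · push_cast; rfl
    · refine intervalIntegral.integral_congr fun t _ => ?_
      simp only [hF, smul_eq_mul]
      rw [fourier_coe_apply, mul_comm]
      congr 2
      push_cast
      have : (π : ℂ) ≠ 0 := by exact_mod_cast Real.pi_ne_zero
      field_simp
  have h2 := has_pointwise_sum_fourier_series_of_summable (f := F)
    (by rw [funext hco]; exact hs) (x : AddCircle (2 * π))
  rw [hF] at h2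
  convert h2 using 2 with k
  rw [hco, smul_eq_mul, fourier_coe_apply]
  congr 2
  push_cast
  have : (π : ℂ) ≠ 0 := by exact_mod_cast Real.pi_ne_zero
  field_simp

lemma SF.hasSum_fourier {R M : ℝ} {f : ℂ → ℂ} (hf : SF R f)
    (hM : ∀ z ∈ strip R, ‖f z‖ ≤ M) {z : ℂ} (hz : z ∈ strip R) :
    HasSum (fun k : ℤ => fc f k * Complex.exp (k * z * Complex.I)) (f z) := by
  have hz' : |z.im| < R := hz
  have hR : 0 < R := (abs_nonneg _).trans_lt hz'
  set y := z.im with hy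
  have hs : Summable (fc fun z => f (z + y * Complex.I)) := by
    refine Summable.of_norm_bounded ((summable_exp_neg_abs (sub_pos.2 hz')).mul_left M) fun k => ?_
    rw [fc_shift hf hz', norm_mul, Complex.norm_exp]
    have e : ((-(k * y) : ℂ)).re = -(k * y) := by
      have : ((-(k * y) : ℂ)) = ((-(k * y) : ℝ) : ℂ) := by push_cast; rfl
      rw [this, Complex.ofReal_re]
    rw [e]
    have h1 := hf.norm_fc_le hR hM k
    have hM0 : 0 ≤ M := (norm_nonneg _).trans (hM 0 (by simpa using ofReal_mem_strip hR 0))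
    calc _ ≤ rexp (|y| * |(k:ℝ)|) * (M * rexp (-(R * |(k : ℝ)|))) := by
            gcongr
            rw [← abs_mul, mul_comm]; exact neg_le_abs _
      _ = _ := by rw [mul_left_comm, ← Real.exp_add]; congr 2; ring
  have := hasSum_fourier_of_continuous (f := fun z => f (z + y * Complex.I)) ?_ ?_ hs z.re
  · have e : ((z.re : ℂ) + y * Complex.I) = z := Complex.re_add_im z
    simp only [e] at this
    convert this using 2 with k
    rw [fc_shift hf hz', mul_comm (Complex.exp _), mul_assoc (fc f k), ← Complex.exp_add]
    congr 2
    nth_rewrite 1 [← Complex.re_add_im z]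
    linear_combination k * y * Complex.I_sq
  · refine continuous_iff_continuousAt.2 fun x => ?_
    have hm : (x + y * Complex.I : ℂ) ∈ strip R := by simpa [strip] using hz'
    exact ContinuousAt.comp (f := fun x : ℝ => (x + y * Complex.I : ℂ))
      (hf.differentiableAt hm).continuousAt (by fun_prop)
  · intro w
    rw [add_right_comm, hf.per]

end DualBilliard

namespace DualBilliard

noncomputable def sdiv (σ ω : ℝ) (k : ℤ) : ℝ :=
  rexp (-(σ * |(k : ℝ)|)) / ‖Complex.exp (k * ω * Complex.I) - 1‖

structure Dio (σ ω T : ℝ) : Prop where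
  ne : ∀ k : ℤ, k ≠ 0 → Complex.exp (k * ω * Complex.I) ≠ 1
  sum : Summable (sdiv σ ω)
  le : ∑' k, sdiv σ ω k ≤ T

lemma sdiv_nonneg (σ ω : ℝ) (k : ℤ) : 0 ≤ sdiv σ ω k := div_nonneg (Real.exp_pos _).le (norm_nonneg _)

lemma SF.conj_fc {R : ℝ} {f : ℂ → ℂ} (hf : SF R f) (k : ℤ) :
    starRingEnd ℂ (fc f k) = fc f (-k) := by
  unfold fc
  rw [map_mul, ← intervalIntegral.intervalIntegral_conj]
  congr 1
  · simpa using Complex.conj_ofReal 2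
  · refine intervalIntegral.integral_congr fun x _ => ?_
    simp only [map_mul, ← Complex.exp_conj]
    congr 2
    · rw [Complex.conj_eq_iff_im]; exact hf.real x
    · simp

theorem SF.exists_coboundary {R R' ω M T : ℝ} {f : ℂ → ℂ} (hf : SF R f)
    (hM : ∀ z ∈ strip R, ‖f z‖ ≤ M) (h0 : fc f 0 = 0) (hR' : 0 < R') (hRR : R' < R)
    (hD : Dio (R - R') ω T) :
    ∃ g, SF R' g ∧ (∀ z ∈ strip R', g (z + ω) - g z = f z) ∧ ∀ z ∈ strip R', ‖g z‖ ≤ M * T := by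
  have hM0 : 0 ≤ M := (norm_nonneg _).trans (hM 0 (by simpa using ofReal_mem_strip (hR'.trans hRR) 0))
  set t : ℤ → ℂ → ℂ := fun k z =>
    fc f k / (Complex.exp (k * ω * Complex.I) - 1) * Complex.exp (k * z * Complex.I) with ht
  have hb : ∀ k, ∀ z ∈ strip R', ‖t k z‖ ≤ M * sdiv (R - R') ω k := by
    intro k z hz
    have hz' : |z.im| < R' := hz
    rw [ht]
    simp only [norm_mul, norm_div, sdiv]
    rw [div_mul_eq_mul_div, ← mul_div_assoc]
    refine div_le_div_of_nonneg_right ?_ (norm_nonneg _)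
    rw [Complex.norm_exp]
    have e : (k * z * Complex.I).re = -(k * z.im) := by
      simp [Complex.mul_re, Complex.mul_im]
    rw [e]
    have h2 : -(k * z.im) ≤ R' * |(k:ℝ)| := by
      calc -(k * z.im) ≤ |k * z.im| := neg_le_abs _
        _ = |z.im| * |(k:ℝ)| := by rw [abs_mul, mul_comm]
        _ ≤ _ := by gcongr
    calc _ ≤ M * rexp (-(R * |(k : ℝ)|)) * rexp (R' * |(k:ℝ)|) := by
            gcongr; exact hf.norm_fc_le (hR'.trans hRR) hM k
      _ = _ := by rw [mul_assoc, ← Real.exp_add]; congr 2; ring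
  have hsum : ∀ z ∈ strip R', Summable fun k => t k z := fun z hz =>
    Summable.of_norm_bounded (hD.sum.mul_left M) fun k => hb k z hz
  refine ⟨fun z => ∑' k, t k z, ⟨?_, ?_, ?_⟩, ?_, ?_⟩
  · refine Complex.differentiableOn_tsum_of_summable_norm (hD.sum.mul_left M) (fun k => ?_)
      (isOpen_strip R') (fun k z hz => hb k z hz)
    exact Differentiable.differentiableOn (by simp only [ht]; fun_prop)
  · intro z
    refine tsum_congr fun k => ?_
    simp only [ht]
    congr 1
    rw [Complex.exp_eq_exp_iff_exists_int]
    exact ⟨k, by ring⟩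
  · intro x
    rw [← Complex.conj_eq_iff_im, Complex.conj_tsum, ← (Equiv.neg ℤ).tsum_eq]
    refine tsum_congr fun k => ?_
    simp only [ht, map_mul, map_div₀, hf.conj_fc, map_sub, ← Complex.exp_conj, map_one]
    simp
  · intro z hz
    have h1 := (hsum _ (add_ofReal_mem_strip hz ω)).hasSum.sub (hsum z hz).hasSum
    refine h1.unique ?_
    rw [show (fun k => t k (z + ω) - t k z) =
      fun k : ℤ => fc f k * Complex.exp (k * z * Complex.I) from funext fun k => ?_]
    · exact hf.hasSum_fourier hM (strip_mono hRR.le hz)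
    simp only [ht]
    have e : Complex.exp (k * (z + ω) * Complex.I) =
        Complex.exp (k * ω * Complex.I) * Complex.exp (k * z * Complex.I) := by
      rw [← Complex.exp_add]; congr 1; ring
    rw [e]
    by_cases hk : k = 0
    · subst hk; simp [h0]
    · have := sub_ne_zero.2 (hD.ne k hk)
      field_simp
  · intro z hz
    refine (tsum_of_norm_bounded (hD.sum.mul_left M).hasSum fun k => hb k z hz).trans ?_
    rw [tsum_mul_left]
    exact mul_le_mul_of_nonneg_left hD.le hM0

lemma norm_sub_taylor_le {s : Set ℂ} (hs : Convex ℝ s) {M : ℝ} {n : ℕ} {X : ℕ → ℂ → ℂ}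
    (hX : ∀ m < n, ∀ z ∈ s, HasDerivAt (X m) (X (m + 1) z) z) (hM : ∀ z ∈ s, ‖X n z‖ ≤ M)
    {z w : ℂ} (hz : z ∈ s) (hw : w ∈ s) :
    ‖X 0 w - ∑ m ∈ Finset.range n, X m z * (w - z) ^ m / m.factorial‖ ≤ M * ‖w - z‖ ^ n := by
  have hM0 : 0 ≤ M := (norm_nonneg _).trans (hM z hz)
  induction n generalizing X w with
  | zero => simpa using hM w hw
  | succ n ih =>
    have hseg : segment ℝ z w ⊆ s := hs.segment_subset hz hw
    have hder : ∀ v ∈ segment ℝ z w, HasDerivWithinAt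
        (fun v => X 0 v - ∑ m ∈ Finset.range (n + 1), X m z * (v - z) ^ m / m.factorial)
        (X 1 v - ∑ m ∈ Finset.range n, X (m + 1) z * (v - z) ^ m / m.factorial)
        (segment ℝ z w) v := by
      intro v hv
      refine (HasDerivAt.sub (hX 0 (by omega) v (hseg hv)) ?_).hasDerivWithinAt
      rw [show (fun v => ∑ m ∈ Finset.range (n + 1), X m z * (v - z) ^ m / m.factorial) =
        fun v => ∑ m ∈ Finset.range n, X (m + 1) z * (v - z) ^ (m + 1) / (m + 1).factorial + X 0 z
        from by ext v; rw [Finset.sum_range_succ']; simp]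
      refine HasDerivAt.add_const _ ?_
      refine HasDerivAt.fun_sum fun m _ => ?_
      have h1 : HasDerivAt (fun v : ℂ => (v - z) ^ (m + 1)) (((m + 1 : ℕ) : ℂ) * (v - z) ^ m * 1) v := by
        simpa using ((hasDerivAt_id v).sub_const z).fun_pow (m + 1)
      refine ((h1.const_mul (X (m + 1) z)).div_const ((m + 1).factorial : ℂ)).congr_deriv ?_
      rw [Nat.factorial_succ]
      have : (m.factorial : ℂ) ≠ 0 := by exact_mod_cast m.factorial_ne_zero
      have h2 : ((m : ℂ) + 1) ≠ 0 := by exact_mod_cast m.succ_ne_zero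
      push_cast
      field_simp
    have hbd : ∀ v ∈ segment ℝ z w,
        ‖X 1 v - ∑ m ∈ Finset.range n, X (m + 1) z * (v - z) ^ m / m.factorial‖ ≤
        M * ‖w - z‖ ^ n := by
      intro v hv
      refine (ih (X := fun m => X (m + 1)) (fun m hm => hX (m + 1) (by omega)) hM (hseg hv)).trans ?_
      gcongr
      have := norm_sub_le_of_mem_segment hv
      simpa [norm_sub_rev] using this
    have := (convex_segment z w).norm_image_sub_le_of_norm_hasDerivWithin_le hder hbd
      (left_mem_segment ℝ z w) (right_mem_segment ℝ z w)
    rw [Finset.sum_range_succ' (fun m => X m z * (z - z) ^ m / m.factorial)] at this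
    simp only [sub_self, ne_eq, Nat.add_eq_zero_iff, one_ne_zero, and_false, not_false_eq_true,
      zero_pow, mul_zero, zero_div, Finset.sum_const_zero, zero_add, pow_zero, mul_one,
      Nat.factorial_zero, Nat.cast_one, div_one, sub_zero] at this
    rw [pow_succ, ← mul_assoc]
    exact this

end DualBilliard

namespace DualBilliard

noncomputable def hsin (s : ℝ) : ℝ := |2 * Real.sin (s / 2)| ^ (-(15 / 16) : ℝ)

lemma hsin_nonneg (s : ℝ) : 0 ≤ hsin s := Real.rpow_nonneg (abs_nonneg _) _

lemma measurable_hsin : Measurable hsin := by unfold hsin; fun_prop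

lemma hsin_periodic : Function.Periodic hsin (2 * π) := fun s => by
  unfold hsin
  rw [show (s + 2 * π) / 2 = s / 2 + π by ring, Real.sin_add_pi, mul_neg, abs_neg]

lemma hsin_neg (s : ℝ) : hsin (-s) = hsin s := by
  unfold hsin
  rw [neg_div, Real.sin_neg, mul_neg, abs_neg]

lemma hsin_intervalIntegrable (a b : ℝ) : IntervalIntegrable hsin volume a b := by
  have hpi := Real.pi_pos
  have h1 : IntervalIntegrable hsin volume 0 π := by
    have hi : IntervalIntegrable (fun x : ℝ => x ^ (-(15 / 16) : ℝ)) volume 0 π :=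
      intervalIntegral.intervalIntegrable_rpow' (by norm_num)
    refine (hi.const_mul ((2 / π) ^ (-(15 / 16) : ℝ))).mono_fun
      measurable_hsin.aestronglyMeasurable ?_
    rw [Set.uIoc_of_le hpi.le]
    refine (ae_restrict_iff' measurableSet_Ioc).2 (Filter.Eventually.of_forall fun s hs => ?_)
    have hs0 : 0 < s := hs.1
    simp only
    rw [Real.norm_of_nonneg (hsin_nonneg s), Real.norm_of_nonneg (by positivity),
      ← Real.mul_rpow (by positivity) hs0.le]
    have h2 := Real.mul_le_sin (x := s / 2) (by positivity) (by linarith [hs.2])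
    have h3 : 2 / π * s ≤ |2 * Real.sin (s / 2)| := by
      refine le_trans ?_ (le_abs_self _)
      linarith
    exact Real.rpow_le_rpow_of_nonpos (by positivity) h3 (by norm_num)
  have h2 : IntervalIntegrable hsin volume π (2 * π) := by
    have := h1.comp_sub_left (2 * π)
    have e : (fun x => hsin (2 * π - x)) = hsin := by
      ext x
      rw [← hsin_neg, neg_sub, ← hsin_periodic, sub_add_cancel]
    rw [e] at this
    convert this.symm using 1 <;> ring
  exact hsin_periodic.intervalIntegrable₀ (by positivity) (h1.trans h2) a b

lemma exists_integral_hsin_le : ∃ I : ℝ, 0 < I ∧ ∀ (k : ℤ) (δ : ℝ), k ≠ 0 → 0 < δ →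
    ∫ x in δ..(2 * δ), hsin (k * x) ≤ I * (δ + 1 / |(k : ℝ)|) := by
  have hpi := Real.pi_pos
  set J := ∫ x in (0:ℝ)..(2 * π), hsin x
  have hJ : 0 ≤ J := intervalIntegral.integral_nonneg (by positivity) fun x _ => hsin_nonneg x
  refine ⟨J + 1, by positivity, fun k δ hk hδ => ?_⟩
  have hk' : 0 < |(k : ℝ)| := by positivity
  have e : ∀ x, hsin (k * x) = hsin (|(k:ℝ)| * x) := by
    intro x
    rcases abs_choice (k : ℝ) with h | h
    · rw [h]
    · rw [h, neg_mul, hsin_neg]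
  simp only [e]
  set a := |(k:ℝ)|
  rw [intervalIntegral.integral_comp_mul_left _ hk'.ne']
  set n := ⌈a * δ / (2 * π)⌉ with hn
  have hn0 : 0 ≤ n := Int.ceil_nonneg (by positivity)
  have h1 : ∫ x in (a * δ)..(a * (2 * δ)), hsin x ≤ n * J := by
    have h2 := hsin_periodic.intervalIntegral_add_zsmul_eq n (a * δ) hsin_intervalIntegrable
    rw [hsin_periodic.intervalIntegral_add_eq (a * δ) 0, zero_add] at h2
    rw [zsmul_eq_mul, zsmul_eq_mul] at h2
    rw [← h2]
    refine intervalIntegral.integral_mono_interval le_rfl (by nlinarith) ?_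
      (Filter.Eventually.of_forall hsin_nonneg) (hsin_intervalIntegrable _ _)
    have := Int.le_ceil (a * δ / (2 * π))
    rw [div_le_iff₀ (by positivity)] at this
    linarith
  have h3 : (n : ℝ) ≤ a * δ + 1 := by
    have h4 := (Int.ceil_lt_add_one (a * δ / (2 * π))).le
    have h5 : a * δ / (2 * π) ≤ a * δ := div_le_self (by positivity) (by linarith [Real.pi_gt_three])
    linarith
  rw [smul_eq_mul]
  have hn0' : (0:ℝ) ≤ n := by exact_mod_cast hn0
  calc a⁻¹ * ∫ x in (a * δ)..(a * (2 * δ)), hsin x ≤ a⁻¹ * ((a * δ + 1) * (J + 1)) := by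
        gcongr
        exact h1.trans (by gcongr; linarith)
    _ = _ := by field_simp

lemma exp_neg_le_rpow {x s : ℝ} (hx : 0 < x) (hs : 0 < s) (hs2 : s ≤ 2) :
    rexp (-x) ≤ 4 * x ^ (-s) := by
  have h1 : x ^ s ≤ 4 * rexp x := by
    have h2 : x / 2 ≤ rexp (x / 2) := by linarith [Real.add_one_le_exp (x / 2)]
    have h3 : (x / 2) ^ s ≤ rexp x := by
      calc (x / 2) ^ s ≤ rexp (x / 2) ^ s := Real.rpow_le_rpow (by positivity) h2 hs.le
        _ = rexp (x / 2 * s) := (Real.exp_mul _ _).symm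
        _ ≤ _ := Real.exp_le_exp.2 (by nlinarith)
    have h4 : (2:ℝ) ^ s ≤ 4 := by
      calc (2:ℝ) ^ s ≤ 2 ^ (2:ℝ) := Real.rpow_le_rpow_of_exponent_le (by norm_num) hs2
        _ = 4 := by norm_num
    calc x ^ s = 2 ^ s * (x / 2) ^ s := by
          rw [← Real.mul_rpow (by norm_num) (by positivity)]; congr 1; ring
      _ ≤ _ := by gcongr
  rw [Real.rpow_neg hx.le, Real.exp_neg]
  rw [← div_eq_mul_inv, le_div_iff₀ (by positivity), inv_mul_le_iff₀ (Real.exp_pos _)]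
  linarith

noncomputable def wdiv (σ ω : ℝ) (k : ℤ) : ℝ := rexp (-(15 / 16 * (σ * |(k : ℝ)|))) * hsin (k * ω)

lemma wdiv_nonneg (σ ω : ℝ) (k : ℤ) : 0 ≤ wdiv σ ω k :=
  mul_nonneg (Real.exp_pos _).le (hsin_nonneg _)

lemma wdiv_eq (σ ω : ℝ) (k : ℤ) :
    wdiv σ ω k = sdiv σ ω k ^ (15 / 16 : ℝ) := by
  have h1 : ‖Complex.exp (k * ω * Complex.I) - 1‖ = |2 * Real.sin (k * ω / 2)| := by
    rw [← Real.norm_eq_abs, ← Complex.norm_exp_I_mul_ofReal_sub_one]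
    push_cast; rw [mul_comm]
  unfold wdiv sdiv hsin
  rw [Real.div_rpow (Real.exp_pos _).le (norm_nonneg _), ← Real.exp_mul, h1,
    Real.rpow_neg (abs_nonneg _), div_eq_mul_inv]
  congr 2; ring

lemma summable_zeta : Summable fun k : ℤ => |(k : ℝ)| ^ (-(17 / 16) : ℝ) := by
  have h : Summable fun n : ℕ => (n : ℝ) ^ (-(17 / 16) : ℝ) :=
    Real.summable_nat_rpow.2 (by norm_num)
  exact Summable.of_nat_of_neg (h.congr fun n => by simp) (h.congr fun n => by simp)

lemma exists_lintegral_wdiv_le : ∃ C : ℝ, 0 < C ∧ ∀ σ δ : ℝ, 0 < σ → 0 < δ →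
    ∫⁻ ω in Set.Ioc δ (2 * δ), ∑' k : ℤ, ENNReal.ofReal (wdiv σ ω k) ≤
      ENNReal.ofReal (C * (δ * σ ^ (-(17 / 16) : ℝ) + σ ^ (-(1 / 16) : ℝ))) := by
  obtain ⟨I, hI, hk⟩ := exists_integral_hsin_le
  set Z := ∑' k : ℤ, |(k : ℝ)| ^ (-(17 / 16) : ℝ) with hZ
  have hZ0 : 0 ≤ Z := tsum_nonneg fun k => by positivity
  refine ⟨16 * I * (Z + 1), by positivity, fun σ δ hσ hδ => ?_⟩
  rw [lintegral_tsum fun k => ?_]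
  swap
  · exact (by unfold wdiv; exact (measurable_hsin.comp (by fun_prop)).const_mul _ :
      Measurable fun ω => wdiv σ ω k).ennreal_ofReal.aemeasurable
  have hterm : ∀ k : ℤ, ∫⁻ ω in Set.Ioc δ (2 * δ), ENNReal.ofReal (wdiv σ ω k) ≤
      ENNReal.ofReal (16 * I * (δ * σ ^ (-(17 / 16) : ℝ) + σ ^ (-(1 / 16) : ℝ)) *
        |(k : ℝ)| ^ (-(17 / 16) : ℝ)) := by
    intro k
    rcases eq_or_ne k 0 with rfl | hk0
    · simp [wdiv, hsin, Real.zero_rpow]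
    have hle : δ ≤ 2 * δ := by linarith
    have hint : IntervalIntegrable (fun ω => wdiv σ ω k) volume δ (2 * δ) := by
      have : IntervalIntegrable (fun ω => hsin (k * ω)) volume δ (2 * δ) := by
        have := (hsin_intervalIntegrable (k * δ) (k * (2 * δ))).comp_mul_left (c := (k:ℝ))
        have hk1 : (k:ℝ) ≠ 0 := by exact_mod_cast hk0
        simpa [hk1] using this
      exact this.const_mul _
    rw [← ofReal_integral_eq_lintegral_ofReal
      ((intervalIntegrable_iff_integrableOn_Ioc_of_le hle).1 hint)
      (Filter.Eventually.of_forall fun ω => wdiv_nonneg σ ω k),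
      ← intervalIntegral.integral_of_le hle]
    refine ENNReal.ofReal_le_ofReal ?_
    unfold wdiv
    rw [intervalIntegral.integral_const_mul]
    have ha : 0 < |(k : ℝ)| := by positivity
    have hk2 := hk k δ hk0 hδ
    set a := |(k : ℝ)|
    set b := 15 / 16 * (σ * a) with hb
    have hb0 : 0 < b := by positivity
    have hbs : ∀ s : ℝ, 0 ≤ s → s ≤ 2 → b ^ (-s) ≤ 4 * (σ ^ (-s) * a ^ (-s)) := by
      intro s hs0 hs
      rw [hb, Real.mul_rpow (by norm_num) (by positivity), Real.mul_rpow hσ.le ha.le]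
      have : (15 / 16 : ℝ) ^ (-s) ≤ 4 := by
        calc (15 / 16 : ℝ) ^ (-s) ≤ (15 / 16 : ℝ) ^ (-2 : ℝ) :=
              Real.rpow_le_rpow_of_exponent_ge (by norm_num) (by norm_num) (by linarith)
          _ ≤ 4 := by
              rw [show (-2 : ℝ) = ((-2 : ℤ) : ℝ) by norm_num, Real.rpow_intCast]; norm_num
      gcongr
    have h1 : rexp (-b) ≤ 16 * (σ ^ (-(17 / 16) : ℝ) * a ^ (-(17 / 16) : ℝ)) := by
      have h4 := exp_neg_le_rpow hb0 (s := 17 / 16) (by norm_num) (by norm_num)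
      have h5 := hbs (17 / 16) (by norm_num) (by norm_num)
      linarith
    have h2 : rexp (-b) ≤ 16 * (σ ^ (-(1 / 16) : ℝ) * a ^ (-(1 / 16) : ℝ)) := by
      have h4 := exp_neg_le_rpow hb0 (s := 1 / 16) (by norm_num) (by norm_num)
      have h5 := hbs (1 / 16) (by norm_num) (by norm_num)
      linarith
    have h3 : a ^ (-(1 / 16) : ℝ) * (1 / a) = a ^ (-(17 / 16) : ℝ) := by
      rw [one_div a, ← Real.rpow_neg_one, ← Real.rpow_add ha]; norm_num
    calc rexp (-b) * ∫ x in δ..(2 * δ), hsin (k * x)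
        ≤ rexp (-b) * (I * (δ + 1 / a)) := by gcongr
      _ = I * (rexp (-b) * δ + rexp (-b) * (1 / a)) := by ring
      _ ≤ I * (16 * (σ ^ (-(17 / 16) : ℝ) * a ^ (-(17 / 16) : ℝ)) * δ +
          16 * (σ ^ (-(1 / 16) : ℝ) * a ^ (-(1 / 16) : ℝ)) * (1 / a)) := by gcongr
      _ = _ := by rw [← h3]; ring
  refine (ENNReal.tsum_le_tsum hterm).trans ?_
  rw [← ENNReal.ofReal_tsum_of_nonneg (fun k => by positivity) (summable_zeta.mul_left _),
    tsum_mul_left]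
  refine ENNReal.ofReal_le_ofReal ?_
  have : 0 ≤ δ * σ ^ (-(17 / 16) : ℝ) + σ ^ (-(1 / 16) : ℝ) := by positivity
  rw [← hZ]
  nlinarith [mul_nonneg hI.le this]

lemma countable_resonances : {ω : ℝ | ∃ k : ℤ, k ≠ 0 ∧ Complex.exp (k * ω * Complex.I) = 1}.Countable := by
  refine (Set.countable_range fun p : ℤ × ℤ => (p.2 * (2 * π) / p.1 : ℝ)).mono ?_
  rintro ω ⟨k, hk, h⟩
  obtain ⟨n, hn⟩ := Complex.exp_eq_one_iff.1 h
  refine ⟨(k, n), ?_⟩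
  have hk' : (k : ℝ) ≠ 0 := by exact_mod_cast hk
  have h2 : ((k * ω : ℝ) : ℂ) = ((n * (2 * π) : ℝ) : ℂ) := by
    push_cast
    refine mul_right_cancel₀ Complex.I_ne_zero ?_
    rw [hn]; ring
  have h3 : k * ω = n * (2 * π) := by exact_mod_cast h2
  simp only
  rw [← h3]
  field_simp

lemma dio_of_tsum_wdiv_le {σ ω Λ : ℝ} (hne : ∀ k : ℤ, k ≠ 0 → Complex.exp (k * ω * Complex.I) ≠ 1)
    (hΛ : 0 ≤ Λ) (h : ∑' k : ℤ, ENNReal.ofReal (wdiv σ ω k) ≤ ENNReal.ofReal Λ) :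
    Dio σ ω (Λ ^ (16 / 15 : ℝ)) := by
  have hs : Summable (wdiv σ ω) := by
    have := ENNReal.summable_toReal (h.trans_lt ENNReal.ofReal_lt_top).ne
    simpa [ENNReal.toReal_ofReal (wdiv_nonneg σ ω _)] using this
  have hle : ∑' k, wdiv σ ω k ≤ Λ := by
    rw [← ENNReal.ofReal_tsum_of_nonneg (wdiv_nonneg σ ω) hs] at h
    exact (ENNReal.ofReal_le_ofReal_iff hΛ).1 h
  have hk : ∀ k, sdiv σ ω k ≤ wdiv σ ω k * Λ ^ (1 / 15 : ℝ) := by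
    intro k
    have h1 : wdiv σ ω k ≤ Λ := (hs.le_tsum k fun j _ => wdiv_nonneg σ ω j).trans hle
    have h2 : sdiv σ ω k = wdiv σ ω k * wdiv σ ω k ^ (1 / 15 : ℝ) := by
      rcases (wdiv_nonneg σ ω k).eq_or_lt with h0 | h0
      · rw [← h0]
        have := wdiv_eq σ ω k
        rw [← h0, eq_comm, Real.rpow_eq_zero (sdiv_nonneg _ _ _) (by norm_num)] at this
        rw [this]; simp
      · conv_rhs => rw [← Real.rpow_one_add' h0.le (by norm_num)]
        rw [wdiv_eq, ← Real.rpow_mul (sdiv_nonneg _ _ _)]; norm_num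
    rw [h2]
    have := wdiv_nonneg σ ω k
    gcongr
  refine ⟨hne, Summable.of_nonneg_of_le (sdiv_nonneg σ ω) hk (hs.mul_right _), ?_⟩
  refine (Summable.tsum_le_tsum hk (Summable.of_nonneg_of_le (sdiv_nonneg σ ω) hk (hs.mul_right _))
    (hs.mul_right _)).trans ?_
  rw [tsum_mul_right]
  calc _ ≤ Λ * Λ ^ (1 / 15 : ℝ) := by gcongr
    _ = _ := by rw [← Real.rpow_one_add' hΛ (by norm_num)]; norm_num

theorem exists_dio : ∃ K : ℝ, 1 ≤ K ∧ ∀ δ : ℝ, 0 < δ → δ ≤ 1 → ∃ D : Set ℝ, IsCompact D ∧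
    D ⊆ Set.Icc δ (2 * δ) ∧ 0 < volume D ∧ ∀ ω ∈ D, ∀ j : ℕ,
      Dio (δ * (1 / 32) ^ j / 8) ω (K * (δ * (1 / 32) ^ j / 8) ^ (-(6 / 5) : ℝ)) := by
  obtain ⟨C, hC, hmom⟩ := exists_lintegral_wdiv_le
  set q : ℝ := (1 / 32 : ℝ) ^ (1 / 16 : ℝ) with hq
  have hq0 : 0 < q := by positivity
  have hq1 : q < 1 := Real.rpow_lt_one (by norm_num) (by norm_num) (by norm_num)
  set L : ℝ := 4 * C / (1 - q) + 1 with hL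
  have hq1' : 0 < 1 - q := by linarith
  have hL1 : 1 ≤ L := by rw [hL]; have : 0 < 4 * C / (1 - q) := by positivity
                         linarith
  refine ⟨L ^ (16 / 15 : ℝ), Real.one_le_rpow hL1 (by norm_num), fun δ hδ hδ1 => ?_⟩
  set σ : ℕ → ℝ := fun j => δ * (1 / 32) ^ j / 8 with hσ
  have hσ0 : ∀ j, 0 < σ j := fun j => by simp only [hσ]; positivity
  have hσδ : ∀ j, σ j ≤ δ := fun j => by
    simp only [hσ]
    have : ((1:ℝ) / 32) ^ j ≤ 1 := pow_le_one₀ (by norm_num) (by norm_num)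
    nlinarith
  set Λ : ℕ → ℝ := fun j => L * σ j ^ (-(9 / 8) : ℝ) with hΛ
  have hΛ0 : ∀ j, 0 < Λ j := fun j => by have := hσ0 j; simp only [hΛ]; positivity
  set S : ℕ → ℝ → ENNReal := fun j ω => ∑' k : ℤ, ENNReal.ofReal (wdiv (σ j) ω k) with hS
  have hSm : ∀ j, Measurable (S j) := fun j => by
    refine Measurable.tsum fun k => ?_
    exact (by unfold wdiv; exact (measurable_hsin.comp (by fun_prop)).const_mul _ :
      Measurable fun ω => wdiv (σ j) ω k).ennreal_ofReal
  set μ := volume.restrict (Set.Ioc δ (2 * δ)) with hμ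
  set B : ℕ → Set ℝ := fun j => {ω | ENNReal.ofReal (Λ j) ≤ S j ω} with hB
  have hBm : ∀ j, MeasurableSet (B j) := fun j => measurableSet_le measurable_const (hSm j)
  have hBle : ∀ j, μ (B j) ≤ ENNReal.ofReal (2 * C / L * δ * q ^ j) := by
    intro j
    have h0 := hΛ0 j
    have hs := hσ0 j
    refine (meas_ge_le_lintegral_div (hSm j).aemeasurable
      (by simpa using h0) ENNReal.ofReal_ne_top).trans ?_
    refine (ENNReal.div_le_div_right (hmom (σ j) δ hs hδ) _).trans ?_
    rw [← ENNReal.ofReal_div_of_pos h0]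
    refine ENNReal.ofReal_le_ofReal ?_
    rw [div_le_iff₀ h0]
    have e1 : σ j ^ (-(17 / 16) : ℝ) = σ j ^ (1 / 16 : ℝ) * σ j ^ (-(9 / 8) : ℝ) := by
      rw [← Real.rpow_add hs]; norm_num
    have e2 : σ j ^ (-(1 / 16) : ℝ) = σ j * σ j ^ (1 / 16 : ℝ) * σ j ^ (-(9 / 8) : ℝ) := by
      rw [← Real.rpow_one_add' hs.le (by norm_num), ← Real.rpow_add hs]; norm_num
    have e3 : σ j ^ (1 / 16 : ℝ) ≤ q ^ j := by
      have : σ j ≤ (1 / 32) ^ j := by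
        simp only [hσ]
        have : (0:ℝ) < (1 / 32) ^ j := by positivity
        nlinarith
      calc σ j ^ (1 / 16 : ℝ) ≤ ((1 / 32 : ℝ) ^ j) ^ (1 / 16 : ℝ) :=
            Real.rpow_le_rpow hs.le this (by norm_num)
        _ = q ^ j := by
            rw [hq, ← Real.rpow_natCast, ← Real.rpow_natCast, ← Real.rpow_mul (by norm_num),
              ← Real.rpow_mul (by norm_num), mul_comm]
    rw [e1, e2]
    simp only [hΛ]
    have h5 : 0 ≤ σ j ^ (-(9 / 8) : ℝ) := by positivity
    have h6 : 0 ≤ σ j ^ (1 / 16 : ℝ) := by positivity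
    have hLne : L ≠ 0 := by positivity
    calc _ = C * (δ + σ j) * σ j ^ (1 / 16 : ℝ) * σ j ^ (-(9 / 8) : ℝ) := by ring
      _ ≤ C * (δ + δ) * q ^ j * σ j ^ (-(9 / 8) : ℝ) := by gcongr; exact hσδ j
      _ = _ := by field_simp; ring
  set N := {ω : ℝ | ∃ k : ℤ, k ≠ 0 ∧ Complex.exp (k * ω * Complex.I) = 1} with hN
  have hNc : N.Countable := countable_resonances
  have hbad : μ (N ∪ ⋃ j, B j) < ENNReal.ofReal δ := by
    calc μ (N ∪ ⋃ j, B j) ≤ μ N + μ (⋃ j, B j) := measure_union_le _ _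
      _ ≤ 0 + ∑' j, ENNReal.ofReal (2 * C / L * δ * q ^ j) := by
          gcongr
          · exact (Measure.absolutelyContinuous_of_le Measure.restrict_le_self
              (hNc.measure_zero volume)).le
          · exact (measure_iUnion_le _).trans (ENNReal.tsum_le_tsum hBle)
      _ = ENNReal.ofReal (2 * C / L * δ * (1 - q)⁻¹) := by
          rw [zero_add, ← ENNReal.ofReal_tsum_of_nonneg (fun j => by positivity)
            ((summable_geometric_of_lt_one hq0.le hq1).mul_left _), tsum_mul_left,
            tsum_geometric_of_lt_one hq0.le hq1]
      _ < _ := by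
          refine (ENNReal.ofReal_lt_ofReal_iff hδ).2 ?_
          have h7 : 4 * C < L * (1 - q) := by
            rw [hL, add_mul, div_mul_cancel₀ _ hq1'.ne']; linarith
          rw [← div_eq_mul_inv, div_lt_iff₀ hq1', div_mul_eq_mul_div, div_lt_iff₀ (by linarith)]
          nlinarith
  have hbm : MeasurableSet (N ∪ ⋃ j, B j) := hNc.measurableSet.union (MeasurableSet.iUnion hBm)
  have hpos : 0 < volume (Set.Ioc δ (2 * δ) \ (N ∪ ⋃ j, B j)) := by
    have h1 : volume (Set.Ioc δ (2 * δ)) ≤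
        volume (Set.Ioc δ (2 * δ) \ (N ∪ ⋃ j, B j)) + μ (N ∪ ⋃ j, B j) := by
      rw [hμ, Measure.restrict_apply hbm]
      calc _ ≤ volume ((Set.Ioc δ (2 * δ) \ (N ∪ ⋃ j, B j)) ∪
            ((N ∪ ⋃ j, B j) ∩ Set.Ioc δ (2 * δ))) := by
            refine measure_mono fun x hx => ?_
            by_cases h : x ∈ N ∪ ⋃ j, B j
            · exact Or.inr ⟨h, hx⟩
            · exact Or.inl ⟨hx, h⟩
        _ ≤ _ := measure_union_le _ _
    rw [Real.volume_Ioc, show 2 * δ - δ = δ by ring] at h1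
    by_contra h0
    rw [not_lt, nonpos_iff_eq_zero] at h0
    rw [h0, zero_add] at h1
    exact absurd hbad (not_lt.2 h1)
  obtain ⟨D, hDs, hDc, hD⟩ := (measurableSet_Ioc.diff hbm).exists_lt_isCompact hpos
  refine ⟨D, hDc, fun ω hω => Set.Ioc_subset_Icc_self (hDs hω).1, hD, fun ω hω j => ?_⟩
  have hω2 := (hDs hω).2
  rw [Set.mem_union, not_or, Set.mem_iUnion, not_exists] at hω2
  have h1 := dio_of_tsum_wdiv_le (σ := σ j) (ω := ω) (Λ := Λ j)
    (fun k hk h => hω2.1 ⟨k, hk, h⟩) (hΛ0 j).le (not_le.1 (hω2.2 j)).le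
  convert h1 using 1
  simp only [hΛ]
  have hs := hσ0 j
  rw [Real.mul_rpow (by linarith) (by positivity), ← Real.rpow_mul hs.le]
  norm_num [hσ]

end DualBilliard

namespace DualBilliard

def Od {P : Type*} (d : P → ℝ) (k : ℤ) (f : P → ℂ) : Prop :=
  ∃ C δ₀ : ℝ, 0 < δ₀ ∧ ∀ p, d p ≤ δ₀ → ‖f p‖ ≤ C * d p ^ k

def Lo {P : Type*} (d : P → ℝ) (k : ℤ) (f : P → ℂ) : Prop :=
  ∃ C δ₀ : ℝ, 0 < C ∧ 0 < δ₀ ∧ ∀ p, d p ≤ δ₀ → C * d p ^ k ≤ ‖f p‖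

class PosFun {P : Type*} (d : P → ℝ) : Prop where
  pos : ∀ p, 0 < d p

section
variable {P : Type*} {d : P → ℝ} [hd : PosFun d] {k m n : ℤ} {f g : P → ℂ}

omit hd in
lemma Od.of_le (C : ℝ) (h : ∀ p, ‖f p‖ ≤ C * d p ^ k) : Od d k f := ⟨C, 1, one_pos, fun p _ => h p⟩

omit hd in
lemma Od.congr (hf : Od d k f) (h : ∀ p, g p = f p) : Od d k g := by
  rwa [show g = f from funext h]

omit hd in
lemma Od.const (c : ℂ) : Od d 0 fun _ => c := ⟨‖c‖, 1, one_pos, fun p _ => by simp⟩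

lemma Od.mul (hf : Od d m f) (hg : Od d n g) (h : k = m + n := by norm_num) :
    Od d k fun p => f p * g p := by
  obtain ⟨A, a, ha, hf⟩ := hf
  obtain ⟨B, b, hb, hg⟩ := hg
  refine ⟨A * B, min a b, lt_min ha hb, fun p hp => ?_⟩
  have h0 := hd.pos p
  rw [norm_mul, h, zpow_add₀ h0.ne', mul_mul_mul_comm]
  have h1 := hf p (hp.trans (min_le_left _ _))
  exact mul_le_mul h1 (hg p (hp.trans (min_le_right _ _))) (norm_nonneg _) ((norm_nonneg _).trans h1)

lemma Od.mono (hf : Od d k f) (h : m ≤ k := by norm_num) : Od d m f := by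
  obtain ⟨A, a, ha, hf⟩ := hf
  refine ⟨|A|, min a 1, lt_min ha one_pos, fun p hp => ?_⟩
  have h0 := hd.pos p
  refine (hf p (hp.trans (min_le_left _ _))).trans ?_
  have h1 : d p ^ k ≤ d p ^ m := zpow_le_zpow_right_of_le_one₀ h0 (hp.trans (min_le_right _ _)) h
  calc A * d p ^ k ≤ |A| * d p ^ k := by gcongr; exact le_abs_self A
    _ ≤ _ := by gcongr

omit hd in
lemma Od.add (hf : Od d k f) (hg : Od d k g) : Od d k fun p => f p + g p := by
  obtain ⟨A, a, ha, hf⟩ := hf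
  obtain ⟨B, b, hb, hg⟩ := hg
  refine ⟨A + B, min a b, lt_min ha hb, fun p hp => (norm_add_le _ _).trans ?_⟩
  rw [add_mul]
  exact add_le_add (hf p (hp.trans (min_le_left _ _))) (hg p (hp.trans (min_le_right _ _)))

omit hd in
lemma Od.neg (hf : Od d k f) : Od d k fun p => - f p := by simpa [Od] using hf

omit hd in
lemma Od.sub (hf : Od d k f) (hg : Od d k g) : Od d k fun p => f p - g p := by
  simpa [sub_eq_add_neg] using hf.add hg.neg

omit hd in
lemma Od.comp {Q : Type*} {e : Q → ℝ} (s : Q → P) (hs : ∀ q, d (s q) = e q) (hf : Od d k f) :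
    Od e k fun q => f (s q) := by
  obtain ⟨A, a, ha, hf⟩ := hf
  exact ⟨A, a, ha, fun q hq => by rw [← hs]; exact hf _ (by rwa [hs])⟩

lemma Od.div (hf : Od d m f) (hg : Lo d n g) (h : k = m - n := by norm_num) :
    Od d k fun p => f p / g p := by
  obtain ⟨A, a, ha, hf⟩ := hf
  obtain ⟨B, b, hB, hb, hg⟩ := hg
  refine ⟨A / B, min a b, lt_min ha hb, fun p hp => ?_⟩
  have h0 := hd.pos p
  have h1 := hf p (hp.trans (min_le_left _ _))
  have h2 := hg p (hp.trans (min_le_right _ _))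
  rw [norm_div, h, zpow_sub₀ h0.ne', div_mul_div_comm]
  exact div_le_div₀ ((norm_nonneg _).trans h1) h1 (by positivity) h2

lemma Lo.ne_zero (hf : Lo d k f) : ∃ δ₀ : ℝ, 0 < δ₀ ∧ ∀ p, d p ≤ δ₀ → f p ≠ 0 := by
  obtain ⟨A, a, hA, ha, hf⟩ := hf
  refine ⟨a, ha, fun p hp => ?_⟩
  have h0 := hd.pos p
  exact norm_pos_iff.1 ((by positivity : 0 < A * d p ^ k).trans_le (hf p hp))

lemma Lo.of_sub (hf : Lo d k f) (hfg : Od d m fun p => g p - f p) (h : k + 1 = m := by norm_num) :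
    Lo d k g := by
  obtain ⟨A, a, hA, ha, hf⟩ := hf
  obtain ⟨B, b, hb, hfg⟩ := hfg
  refine ⟨A / 2, min (min a b) (A / (2 * (|B| + 1))), by positivity,
    lt_min (lt_min ha hb) (by positivity), fun p hp => ?_⟩
  have h0 := hd.pos p
  have h1 := hf p (hp.trans ((min_le_left _ _).trans (min_le_left _ _)))
  have h2 := hfg p (hp.trans ((min_le_left _ _).trans (min_le_right _ _)))
  have h3 : d p ≤ A / (2 * (|B| + 1)) := hp.trans (min_le_right _ _)
  rw [le_div_iff₀ (by positivity)] at h3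
  have h4 : ‖f p‖ ≤ ‖g p‖ + ‖g p - f p‖ := by
    rw [norm_sub_rev]; simpa [add_comm] using norm_add_le (g p) (f p - g p)
  rw [← h, zpow_add₀ h0.ne', zpow_one] at h2
  have h5 : 0 < d p ^ k := by positivity
  have h6 : B * (d p ^ k * d p) ≤ A / 2 * d p ^ k := by
    have : B * d p ≤ A / 2 := by nlinarith [le_abs_self B]
    nlinarith
  linarith

lemma Lo.mul (hf : Lo d m f) (hg : Lo d n g) (h : k = m + n := by norm_num) :
    Lo d k fun p => f p * g p := by
  obtain ⟨A, a, hA, ha, hf⟩ := hf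
  obtain ⟨B, b, hB, hb, hg⟩ := hg
  refine ⟨A * B, min a b, by positivity, lt_min ha hb, fun p hp => ?_⟩
  have h0 := hd.pos p
  rw [norm_mul, h, zpow_add₀ h0.ne', mul_mul_mul_comm]
  exact mul_le_mul (hf p (hp.trans (min_le_left _ _))) (hg p (hp.trans (min_le_right _ _)))
    (by positivity) (norm_nonneg _)

end

section
variable (X Y : ℕ → ℂ → ℂ) (x y : ℂ)

def crD : ℂ := X 1 x * Y 1 y - Y 1 x * X 1 y
def crN : ℂ := (X 0 y - X 0 x) * Y 1 y - (Y 0 y - Y 0 x) * X 1 y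
noncomputable def crG : ℂ := crN X Y x y / crD X Y x y
def kap : ℂ := X 1 x * Y 2 x - Y 1 x * X 2 x
def kap' : ℂ := X 1 x * Y 3 x - Y 1 x * X 3 x
def crDx : ℂ := X 2 x * Y 1 y - Y 2 x * X 1 y
def crDxx : ℂ := X 3 x * Y 1 y - Y 3 x * X 1 y
noncomputable def crGx : ℂ := -1 - crG X Y x y * crDx X Y x y / crD X Y x y
noncomputable def crGy : ℂ := -(kap X Y y * crG X Y y x / crD X Y x y)
noncomputable def crGxx : ℂ := crDx X Y x y / crD X Y x y *
  (1 + 2 * crG X Y x y * crDx X Y x y / crD X Y x y) - crG X Y x y * crDxx X Y x y / crD X Y x y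
noncomputable def crGxy : ℂ := -(kap X Y y / crD X Y x y ^ 2 *
  (crG X Y x y * kap X Y x - crG X Y y x * crDx X Y x y))
noncomputable def crGyy : ℂ := kap X Y y / crD X Y x y *
  (1 - 2 * crG X Y y x * crDx X Y y x / crD X Y x y) - crG X Y y x * kap' X Y y / crD X Y x y
end

structure Crv (M c δ R : ℝ) (X Y : ℕ → ℂ → ℂ) : Prop where
  sX : ∀ m, SF R (X m)
  sY : ∀ m, SF R (Y m)
  dX : ∀ m, ∀ z ∈ strip R, HasDerivAt (X m) (X (m + 1) z) z
  dY : ∀ m, ∀ z ∈ strip R, HasDerivAt (Y m) (Y (m + 1) z) z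
  bX : ∀ m ≤ 5, ∀ z ∈ strip R, ‖X m z‖ ≤ M
  bY : ∀ m ≤ 5, ∀ z ∈ strip R, ‖Y m z‖ ≤ M
  near : ∀ z ∈ strip R, ‖kap X Y z - c‖ ≤ c / 20
  small : ∀ z ∈ strip R, ‖kap' X Y z‖ ≤ M * δ

structure Pt (M c : ℝ) where
  δ : ℝ
  R : ℝ
  X : ℕ → ℂ → ℂ
  Y : ℕ → ℂ → ℂ
  x : ℂ
  y : ℂ
  hδ : 0 < δ
  crv : Crv M c δ R X Y
  hx : x ∈ strip R
  hy : y ∈ strip R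
  low : δ / 2 ≤ ‖y - x‖
  upp : ‖y - x‖ ≤ 4 * δ

namespace Pt
variable {M c : ℝ}

instance : PosFun (Pt.δ (M := M) (c := c)) := ⟨Pt.hδ⟩

def swap (p : Pt M c) : Pt M c where
  __ := p
  x := p.y
  y := p.x
  hx := p.hy
  hy := p.hx
  low := by rw [norm_sub_rev]; exact p.low
  upp := by rw [norm_sub_rev]; exact p.upp

local notation "𝒪" => Od (Pt.δ (M := M) (c := c))
local notation "ℒ" => Lo (Pt.δ (M := M) (c := c))

lemma od_swap {k : ℤ} {f : Pt M c → ℂ} (hf : 𝒪 k f) : 𝒪 k fun p => f p.swap :=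
  hf.comp swap fun _ => rfl

lemma od_h : 𝒪 1 fun p => p.y - p.x := Od.of_le 4 fun p => by simpa using p.upp

lemma od_h_pow (n : ℕ) : 𝒪 n fun p => (p.y - p.x) ^ n := by
  induction n with
  | zero => simpa using Od.const 1
  | succ n ih => exact (ih.mul od_h (by push_cast; ring)).congr fun p => pow_succ _ _

lemma od_X {i : ℕ} (hi : i ≤ 5 := by norm_num) : 𝒪 0 fun p => p.X i p.x :=
  Od.of_le M fun p => by simpa using p.crv.bX i hi _ p.hx

lemma od_Y {i : ℕ} (hi : i ≤ 5 := by norm_num) : 𝒪 0 fun p => p.Y i p.x :=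
  Od.of_le M fun p => by simpa using p.crv.bY i hi _ p.hx

lemma od_X' {i : ℕ} (hi : i ≤ 5 := by norm_num) : 𝒪 0 fun p => p.X i p.y := od_swap (od_X hi)
lemma od_Y' {i : ℕ} (hi : i ≤ 5 := by norm_num) : 𝒪 0 fun p => p.Y i p.y := od_swap (od_Y hi)

lemma norm_h_pow_le (hM : 0 ≤ M) (p : Pt M c) (n : ℕ) : M * ‖p.y - p.x‖ ^ n ≤ M * 4 ^ n * p.δ ^ (n : ℤ) := by
  rw [mul_assoc, zpow_natCast, ← mul_pow]
  have := p.upp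
  gcongr

lemma od_taylor_X (hM : 0 ≤ M) (i n : ℕ) (hi : i + n ≤ 5) : 𝒪 n fun p =>
    p.X i p.y - ∑ m ∈ Finset.range n, p.X (i + m) p.x * (p.y - p.x) ^ m / m.factorial :=
  Od.of_le (M * 4 ^ n) fun p => (norm_sub_taylor_le (X := fun m => p.X (i + m)) (convex_strip p.R)
    (fun m _ z hz => p.crv.dX (i + m) z hz) (fun z hz => p.crv.bX _ hi z hz) p.hx p.hy).trans
    (norm_h_pow_le hM p n)

lemma od_taylor_Y (hM : 0 ≤ M) (i n : ℕ) (hi : i + n ≤ 5) : 𝒪 n fun p =>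
    p.Y i p.y - ∑ m ∈ Finset.range n, p.Y (i + m) p.x * (p.y - p.x) ^ m / m.factorial :=
  Od.of_le (M * 4 ^ n) fun p => (norm_sub_taylor_le (X := fun m => p.Y (i + m)) (convex_strip p.R)
    (fun m _ z hz => p.crv.dY (i + m) z hz) (fun z hz => p.crv.bY _ hi z hz) p.hx p.hy).trans
    (norm_h_pow_le hM p n)

lemma od_kap' : 𝒪 1 fun p => kap' p.X p.Y p.x :=
  Od.of_le M fun p => by simpa using p.crv.small _ p.hx

lemma od_kap : 𝒪 0 fun p => kap p.X p.Y p.x :=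
  ((Od.mul od_X od_Y).sub (Od.mul od_Y od_X)).congr fun p => rfl

lemma lo_kap (hc : 0 < c) : ℒ 0 fun p => kap p.X p.Y p.x := by
  refine ⟨c / 2, 1, by positivity, one_pos, fun p _ => ?_⟩
  have h1 := p.crv.near _ p.hx
  have h2 := norm_sub_norm_le (c : ℂ) (kap p.X p.Y p.x)
  rw [norm_sub_rev, Complex.norm_of_nonneg hc.le] at h2
  rw [zpow_zero, mul_one]; linarith

lemma lo_h : ℒ 1 fun p => p.y - p.x :=
  ⟨1 / 2, 1, by norm_num, one_pos, fun p _ => by simpa [div_eq_inv_mul] using p.low⟩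

end Pt
end DualBilliard

namespace DualBilliard
lemma crD_swap (X Y : ℕ → ℂ → ℂ) (x y : ℂ) : crD X Y x y = - crD X Y y x := by
  unfold crD; ring

namespace Pt
variable {M c : ℝ}
local notation "𝒪" => Od (Pt.δ (M := M) (c := c))
local notation "ℒ" => Lo (Pt.δ (M := M) (c := c))

lemma od_D_sub (hM : 0 ≤ M) : 𝒪 3 fun p => crD p.X p.Y p.x p.y - kap p.X p.Y p.x * (p.y - p.x) := by
  have hX := od_taylor_X (c := c) hM 1 3 (by norm_num)
  have hY := od_taylor_Y (c := c) hM 1 3 (by norm_num)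
  have h1 : 𝒪 3 _ := Od.mul (od_X (i := 1)) hY
  have h2 : 𝒪 3 _ := Od.mul (od_Y (i := 1)) hX
  have h3 : 𝒪 3 _ := Od.mul od_kap' ((od_h_pow 2).mul (Od.const (1 / 2)) (k := 2))
  refine ((h1.sub h2).add h3).congr fun p => ?_
  simp only [Finset.sum_range_succ, Finset.sum_range_zero, crD, kap, kap', Nat.factorial]
  push_cast
  ring

lemma od_N_sub (hM : 0 ≤ M) :
    𝒪 4 fun p => crN p.X p.Y p.x p.y - kap p.X p.Y p.x * (p.y - p.x) ^ 2 / 2 := by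
  have hX := od_taylor_X (c := c) hM 1 3 (by norm_num)
  have hY := od_taylor_Y (c := c) hM 1 3 (by norm_num)
  have hX0 := od_taylor_X (c := c) hM 0 4 (by norm_num)
  have hY0 := od_taylor_Y (c := c) hM 0 4 (by norm_num)
  have h1 : 𝒪 4 _ := Od.mul hX0 (od_Y' (i := 1))
  have h2 : 𝒪 4 _ := Od.mul hY0 (od_X' (i := 1))
  have hX1 := od_taylor_X (c := c) hM 0 1 (by norm_num)
  have hY1 := od_taylor_Y (c := c) hM 0 1 (by norm_num)
  have h3 : 𝒪 4 _ := Od.mul ((hX1.sub ((hX0.mono (m := 1))))) hY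
  have h4 : 𝒪 4 _ := Od.mul ((hY1.sub ((hY0.mono (m := 1))))) hX
  have h5 : 𝒪 4 _ := Od.mul od_kap' ((od_h_pow 3).mul (Od.const (1 / 3)) (k := 3))
  have h6 : 𝒪 4 _ := Od.mul (k := 4) (Od.mul (k := 0) (od_X (i := 2)) (od_Y (i := 3)))
    ((od_h_pow 4).mul (Od.const (1 / 12)) (k := 4))
  have h7 : 𝒪 4 _ := Od.mul (k := 4) (Od.mul (k := 0) (od_Y (i := 2)) (od_X (i := 3)))
    ((od_h_pow 4).mul (Od.const (1 / 12)) (k := 4))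
  refine ((((h1.sub h2).add (h3.sub h4)).add h5).add (h6.sub h7)).congr fun p => ?_
  simp only [Finset.sum_range_succ, Finset.sum_range_zero, crN, kap, kap', Nat.factorial]
  push_cast
  ring

lemma od_Dx_add (hM : 0 ≤ M) : 𝒪 2 fun p => crDx p.X p.Y p.x p.y + kap p.X p.Y p.x := by
  have hX := od_taylor_X (c := c) hM 1 2 (by norm_num)
  have hY := od_taylor_Y (c := c) hM 1 2 (by norm_num)
  have h1 : 𝒪 2 _ := Od.mul (od_X (i := 2)) hY
  have h2 : 𝒪 2 _ := Od.mul (od_Y (i := 2)) hX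
  refine (h1.sub h2).congr fun p => ?_
  simp only [Finset.sum_range_succ, Finset.sum_range_zero, crDx, kap, Nat.factorial]
  push_cast
  ring

lemma od_Dxx (hM : 0 ≤ M) : 𝒪 1 fun p => crDxx p.X p.Y p.x p.y := by
  have hX := od_taylor_X (c := c) hM 1 1 (by norm_num)
  have hY := od_taylor_Y (c := c) hM 1 1 (by norm_num)
  have h1 : 𝒪 1 _ := Od.mul (od_X (i := 3)) hY
  have h2 : 𝒪 1 _ := Od.mul (od_Y (i := 3)) hX
  refine ((h1.sub h2).sub od_kap').congr fun p => ?_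
  simp only [Finset.sum_range_succ, Finset.sum_range_zero, crDxx, kap', Nat.factorial]
  push_cast
  ring

variable (hM : 0 ≤ M) (hc : 0 < c)
include hM hc

lemma lo_D : ℒ 1 fun p => crD p.X p.Y p.x p.y :=
  (Lo.mul (k := 1) (lo_kap hc) lo_h).of_sub ((od_D_sub hM).mono (m := 2))

lemma od_G_sub : 𝒪 3 fun p => crG p.X p.Y p.x p.y - (p.y - p.x) / 2 := by
  obtain ⟨δ₀, h0, hne⟩ := (lo_D hM hc).ne_zero
  have h1 : 𝒪 4 _ := Od.mul (od_D_sub (c := c) hM) ((Od.const (1 / 2)).mul od_h (k := 1))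
  obtain ⟨C, δ₁, h2, h3⟩ := ((od_N_sub hM).sub h1).div (k := 3) (lo_D hM hc)
  refine ⟨C, min δ₀ δ₁, lt_min h0 h2, fun p hp => ?_⟩
  refine le_of_eq_of_le (congrArg _ ?_) (h3 p (hp.trans (min_le_right _ _)))
  have := hne p (hp.trans (min_le_left _ _))
  simp only [crG]
  field_simp
  ring

lemma od_G : 𝒪 1 fun p => crG p.X p.Y p.x p.y :=
  (((od_G_sub hM hc).mono (m := 1)).add ((Od.const (1 / 2)).mul od_h (k := 1))).congr
    fun p => by ring

omit hc in
lemma od_Dx : 𝒪 0 fun p => crDx p.X p.Y p.x p.y :=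
  (((od_Dx_add hM).mono (m := 0)).sub od_kap).congr fun p => by ring

/-- `crG / crD` is `1 / (2 κ)` up to second order. -/
lemma od_GDiv : 𝒪 2 fun p =>
    crG p.X p.Y p.x p.y / crD p.X p.Y p.x p.y * kap p.X p.Y p.x - 1 / 2 := by
  obtain ⟨δ₀, h0, hne⟩ := (lo_D hM hc).ne_zero
  have h1 : 𝒪 3 _ := Od.mul (od_G_sub hM hc) od_kap
  have h2 : 𝒪 3 _ := Od.mul (od_D_sub (c := c) hM) (Od.const (1 / 2))
  obtain ⟨C, δ₁, h2, h3⟩ := (h1.sub h2).div (k := 2) (lo_D hM hc)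
  refine ⟨C, min δ₀ δ₁, lt_min h0 h2, fun p hp => ?_⟩
  refine le_of_eq_of_le (congrArg _ ?_) (h3 p (hp.trans (min_le_right _ _)))
  have := hne p (hp.trans (min_le_left _ _))
  field_simp
  ring

lemma od_GDivDx : 𝒪 2 fun p =>
    crG p.X p.Y p.x p.y * crDx p.X p.Y p.x p.y / crD p.X p.Y p.x p.y + 1 / 2 := by
  have h1 : 𝒪 2 _ := Od.mul ((od_G hM hc).div (lo_D hM hc) (k := 0)) (od_Dx_add hM)
  exact (h1.sub (od_GDiv hM hc)).congr fun p => by ring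

lemma od_Gy_sub : 𝒪 2 fun p => crGy p.X p.Y p.x p.y - 1 / 2 :=
  (od_swap (od_GDiv hM hc)).congr fun p => by
    simp only [crGy, swap]
    rw [crD_swap p.X p.Y p.x p.y]
    ring

lemma od_Gx_add : 𝒪 2 fun p => crGx p.X p.Y p.x p.y + 1 / 2 :=
  (od_GDivDx hM hc).neg.congr fun p => by simp only [crGx]; ring

lemma od_Gxx : 𝒪 1 fun p => crGxx p.X p.Y p.x p.y := by
  have h1 : 𝒪 1 _ := Od.mul ((od_Dx hM).div (lo_D hM hc) (k := -1))
    ((Od.const 2).mul (od_GDivDx hM hc) (k := 2))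
  have h2 : 𝒪 1 _ := Od.mul (od_Dxx hM) ((od_G hM hc).div (lo_D hM hc) (k := 0))
  exact (h1.sub h2).congr fun p => by simp only [crGxx]; ring

lemma od_Gyy : 𝒪 1 fun p => crGyy p.X p.Y p.x p.y := by
  have h1 : 𝒪 1 _ := Od.mul (od_kap.div (lo_D hM hc) (k := -1))
    ((Od.const 2).mul (od_GDivDx hM hc) (k := 2))
  have h2 : 𝒪 1 _ := Od.mul od_kap' ((od_G hM hc).div (lo_D hM hc) (k := 0))
  refine (od_swap (h2.sub h1)).congr fun p => ?_
  simp only [crGyy, swap]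
  rw [crD_swap p.X p.Y p.x p.y]
  ring

lemma od_Gxy : 𝒪 1 fun p => crGxy p.X p.Y p.x p.y := by
  have h1 : 𝒪 3 _ := Od.mul (od_G_sub hM hc) od_kap
  have h2 : 𝒪 3 _ := Od.mul (od_swap (od_G_sub hM hc)) (od_Dx hM)
  have h3 : 𝒪 3 _ := Od.mul (od_Dx_add (c := c) hM) ((od_h).mul (Od.const (1 / 2)) (k := 1))
  have h4 : ℒ 2 _ := Lo.mul (lo_D hM hc) (lo_D hM hc)
  have h5 : 𝒪 1 _ := Od.mul (od_swap od_kap) (((h1.sub h2).add h3).div h4 (k := 1))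
  exact h5.neg.congr fun p => by simp only [crGxy, swap]; ring

end Pt
end DualBilliard

namespace DualBilliard

section
variable {X Y : ℕ → ℂ → ℂ} {f g : ℂ → ℂ} {f' g' t : ℂ}
  (hf : HasDerivAt f f' t) (hg : HasDerivAt g g' t)
  (hXf : ∀ m, HasDerivAt (X m) (X (m + 1) (f t)) (f t))
  (hYf : ∀ m, HasDerivAt (Y m) (Y (m + 1) (f t)) (f t))
  (hXg : ∀ m, HasDerivAt (X m) (X (m + 1) (g t)) (g t))
  (hYg : ∀ m, HasDerivAt (Y m) (Y (m + 1) (g t)) (g t))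
include hf hg hXf hYf hXg hYg

lemma hasDerivAt_crD : HasDerivAt (fun t => crD X Y (f t) (g t))
    (crDx X Y (f t) (g t) * f' - crDx X Y (g t) (f t) * g') t := by
  refine ((((hXf 1).comp t hf).mul ((hYg 1).comp t hg)).sub
    (((hYf 1).comp t hf).mul ((hXg 1).comp t hg))).congr_deriv ?_
  simp only [crDx, Function.comp]; ring

lemma hasDerivAt_crDx : HasDerivAt (fun t => crDx X Y (f t) (g t))
    (crDxx X Y (f t) (g t) * f' + (X 2 (f t) * Y 2 (g t) - Y 2 (f t) * X 2 (g t)) * g') t := by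
  refine ((((hXf 2).comp t hf).mul ((hYg 1).comp t hg)).sub
    (((hYf 2).comp t hf).mul ((hXg 1).comp t hg))).congr_deriv ?_
  simp only [crDxx, Function.comp]; ring

lemma hasDerivAt_crG (hD : crD X Y (f t) (g t) ≠ 0) : HasDerivAt (fun t => crG X Y (f t) (g t))
    (crGx X Y (f t) (g t) * f' + crGy X Y (f t) (g t) * g') t := by
  have hN : HasDerivAt (fun t => crN X Y (f t) (g t)) _ t :=
    ((((hXg 0).comp t hg).sub ((hXf 0).comp t hf)).mul ((hYg 1).comp t hg)).sub
      ((((hYg 0).comp t hg).sub ((hYf 0).comp t hf)).mul ((hXg 1).comp t hg))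
  refine (hN.div (hasDerivAt_crD hf hg hXf hYf hXg hYg) hD).congr_deriv ?_
  simp only [crGx, crGy, crG, crD_swap X Y (g t) (f t), Function.comp, Pi.sub_apply]
  field_simp
  simp only [crDx, crD, crN, kap]
  ring

omit hXf hYf hf in
lemma hasDerivAt_kap : HasDerivAt (fun t => kap X Y (g t)) (kap' X Y (g t) * g') t := by
  refine ((((hXg 1).comp t hg).mul ((hYg 2).comp t hg)).sub
    (((hYg 1).comp t hg).mul ((hXg 2).comp t hg))).congr_deriv ?_
  simp only [kap', Function.comp]; ring

lemma hasDerivAt_crGx (hD : crD X Y (f t) (g t) ≠ 0) : HasDerivAt (fun t => crGx X Y (f t) (g t))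
    (crGxx X Y (f t) (g t) * f' + crGxy X Y (f t) (g t) * g') t := by
  refine ((((hasDerivAt_crG hf hg hXf hYf hXg hYg hD).mul
    (hasDerivAt_crDx hf hg hXf hYf hXg hYg)).div
    (hasDerivAt_crD hf hg hXf hYf hXg hYg) hD).const_sub (-1)).congr_deriv ?_
  have hE : (X 2 (f t) * Y 2 (g t) - Y 2 (f t) * X 2 (g t)) * crD X Y (f t) (g t) =
      kap X Y (f t) * kap X Y (g t) - crDx X Y (f t) (g t) * crDx X Y (g t) (f t) := by
    simp only [crDx, crD, kap]; ring
  simp only [crGxx, crGxy, crGx, crGy, Pi.mul_apply]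
  field_simp
  linear_combination (-crG X Y (f t) (g t) * g') * hE

lemma hasDerivAt_crGy (hD : crD X Y (f t) (g t) ≠ 0) : HasDerivAt (fun t => crGy X Y (f t) (g t))
    (crGxy X Y (f t) (g t) * f' + crGyy X Y (f t) (g t) * g') t := by
  have hD' : crD X Y (g t) (f t) ≠ 0 := by rw [crD_swap]; exact neg_ne_zero.2 hD
  refine (((hasDerivAt_kap hg hXg hYg).mul (hasDerivAt_crG hg hf hXg hYg hXf hYf hD')).div
    (hasDerivAt_crD hf hg hXf hYf hXg hYg) hD).neg.congr_deriv ?_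
  simp only [crGyy, crGxy, crGx, crGy, crD_swap X Y (g t) (f t), Pi.mul_apply]
  field_simp
  ring
end

lemma kap_mul_crG_mul_crGy (X Y : ℕ → ℂ → ℂ) (x y : ℂ) :
    kap X Y x * crG X Y x y * crGy X Y x y = -(kap X Y y * crG X Y y x * crGy X Y y x) := by
  simp only [crGy, crD_swap X Y y x]; ring

/-- Pointwise estimates extracted from the asymptotic ones. -/
structure CrBd (C δ : ℝ) (X Y : ℕ → ℂ → ℂ) (x y : ℂ) : Prop where
  D : δ ≤ C * ‖crD X Y x y‖
  G : ‖crG X Y x y - (y - x) / 2‖ ≤ C * δ ^ 3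
  Gx : ‖crGx X Y x y + 1 / 2‖ ≤ C * δ ^ 2
  Gy : ‖crGy X Y x y - 1 / 2‖ ≤ C * δ ^ 2
  Gxx : ‖crGxx X Y x y‖ ≤ C * δ
  Gxy : ‖crGxy X Y x y‖ ≤ C * δ
  Gyy : ‖crGyy X Y x y‖ ≤ C * δ

lemma exists_crBd {M c : ℝ} (hM : 0 ≤ M) (hc : 0 < c) : ∃ C δ₀ : ℝ, 1 ≤ C ∧ 0 < δ₀ ∧
    ∀ p : Pt M c, p.δ ≤ δ₀ → CrBd C p.δ p.X p.Y p.x p.y := by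
  obtain ⟨C1, d1, hC1, h1, H1⟩ := Pt.lo_D (M := M) (c := c) hM hc
  obtain ⟨C2, d2, h2, H2⟩ := Pt.od_G_sub (M := M) (c := c) hM hc
  obtain ⟨C3, d3, h3, H3⟩ := Pt.od_Gx_add (M := M) (c := c) hM hc
  obtain ⟨C4, d4, h4, H4⟩ := Pt.od_Gy_sub (M := M) (c := c) hM hc
  obtain ⟨C5, d5, h5, H5⟩ := Pt.od_Gxx (M := M) (c := c) hM hc
  obtain ⟨C6, d6, h6, H6⟩ := Pt.od_Gxy (M := M) (c := c) hM hc
  obtain ⟨C7, d7, h7, H7⟩ := Pt.od_Gyy (M := M) (c := c) hM hc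
  set C := 1 + 1 / C1 + |C2| + |C3| + |C4| + |C5| + |C6| + |C7|
  have hC1' : 0 < 1 / C1 := by positivity
  refine ⟨C, min d1 (min d2 (min d3 (min d4 (min d5 (min d6 d7))))), ?_, by positivity, fun p hp => ?_⟩
  · have := abs_nonneg C2; have := abs_nonneg C3; have := abs_nonneg C4; have := abs_nonneg C5
    have := abs_nonneg C6; have := abs_nonneg C7
    linarith
  simp only [le_min_iff] at hp
  obtain ⟨e1, e2, e3, e4, e5, e6, e7⟩ := hp
  have hd := p.hδ
  have key : ∀ (a A B : ℝ), a ≤ A * B → A ≤ C → 0 ≤ B → a ≤ C * B := fun a A B h1 h2 h3 =>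
    h1.trans (mul_le_mul_of_nonneg_right h2 h3)
  have a2 := le_abs_self C2; have a3 := le_abs_self C3; have a4 := le_abs_self C4
  have a5 := le_abs_self C5; have a6 := le_abs_self C6; have a7 := le_abs_self C7
  have b2 := abs_nonneg C2; have b3 := abs_nonneg C3; have b4 := abs_nonneg C4
  have b5 := abs_nonneg C5; have b6 := abs_nonneg C6; have b7 := abs_nonneg C7
  refine ⟨key _ (1 / C1) _ ?_ ?_ (norm_nonneg _), key _ C2 _ (mod_cast H2 p e2) ?_ (by positivity),
    key _ C3 _ (mod_cast H3 p e3) ?_ (by positivity), key _ C4 _ (mod_cast H4 p e4) ?_ (by positivity),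
    key _ C5 _ (by simpa using H5 p e5) ?_ hd.le, key _ C6 _ (by simpa using H6 p e6) ?_ hd.le,
    key _ C7 _ (by simpa using H7 p e7) ?_ hd.le⟩
  · have := H1 p e1
    rw [div_mul_eq_mul_div, le_div_iff₀ hC1]
    simp only [zpow_one] at this
    linarith
  all_goals simp only [C]; linarith

lemma Crv.taylor {M c δ R C : ℝ} {X Y : ℕ → ℂ → ℂ} {x y ξ η : ℂ} (h : Crv M c δ R X Y) (hδ : 0 < δ)
    (hC : ∀ x ∈ strip R, ∀ y ∈ strip R, δ / 2 ≤ ‖y - x‖ → ‖y - x‖ ≤ 4 * δ → CrBd C δ X Y x y)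
    (hx : x ∈ strip R) (hy : y ∈ strip R) (hx' : x + ξ ∈ strip R) (hy' : y + η ∈ strip R)
    (hl : δ / 2 + ‖ξ‖ + ‖η‖ ≤ ‖y - x‖) (hu : ‖y - x‖ + ‖ξ‖ + ‖η‖ ≤ 4 * δ) :
    ‖crG X Y (x + ξ) (y + η) - crG X Y x y - crGx X Y x y * ξ - crGy X Y x y * η‖
      ≤ C * δ * (‖ξ‖ + ‖η‖) ^ 2 := by
  have hseg : ∀ t ∈ segment ℝ (0 : ℂ) 1, x + t * ξ ∈ strip R ∧ y + t * η ∈ strip R ∧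
      CrBd C δ X Y (x + t * ξ) (y + t * η) ∧ ‖t‖ ≤ 1 := by
    intro t ht
    rw [segment_eq_image] at ht
    obtain ⟨s, hs, rfl⟩ := ht
    simp only [smul_zero, Complex.real_smul, mul_one, zero_add]
    have h1 : x + s * ξ ∈ strip R := by
      have := (convex_strip R).add_smul_sub_mem hx hx' hs
      simpa using this
    have h2 : y + s * η ∈ strip R := by
      have := (convex_strip R).add_smul_sub_mem hy hy' hs
      simpa using this
    have h3 : ‖(s : ℂ)‖ ≤ 1 := by rw [Complex.norm_of_nonneg hs.1]; exact hs.2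
    have h4 : ‖(s : ℂ) * ξ‖ ≤ ‖ξ‖ := by
      rw [norm_mul]; exact mul_le_of_le_one_left (norm_nonneg _) h3
    have h5 : ‖(s : ℂ) * η‖ ≤ ‖η‖ := by
      rw [norm_mul]; exact mul_le_of_le_one_left (norm_nonneg _) h3
    have h6 : y + s * η - (x + s * ξ) = (y - x) + (s * η - s * ξ) := by ring
    have h7 := norm_sub_le ((s : ℂ) * η) (s * ξ)
    refine ⟨h1, h2, hC _ h1 _ h2 ?_ ?_, h3⟩
    · rw [h6]
      have := norm_sub_le ((y - x) + (s * η - s * ξ)) (s * η - s * ξ)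
      rw [add_sub_cancel_right] at this
      linarith
    · rw [h6]
      have := norm_add_le (y - x) (s * η - s * ξ)
      linarith
  have key := norm_sub_taylor_le (s := segment ℝ (0 : ℂ) 1) (n := 2) (M := C * δ * (‖ξ‖ + ‖η‖) ^ 2)
    (X := fun m t => match m with
      | 0 => crG X Y (x + t * ξ) (y + t * η)
      | 1 => crGx X Y (x + t * ξ) (y + t * η) * ξ + crGy X Y (x + t * ξ) (y + t * η) * η
      | _ => (crGxx X Y (x + t * ξ) (y + t * η) * ξ + crGxy X Y (x + t * ξ) (y + t * η) * η) * ξ +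
        (crGxy X Y (x + t * ξ) (y + t * η) * ξ + crGyy X Y (x + t * ξ) (y + t * η) * η) * η)
    (convex_segment _ _) ?_ ?_ (left_mem_segment ℝ 0 1) (right_mem_segment ℝ 0 1)
  · simp [Finset.sum_range_succ] at key
    rw [← sub_sub, ← sub_sub] at key
    exact key
  · intro m hm t ht
    obtain ⟨h1, h2, h3, -⟩ := hseg t ht
    have hD : crD X Y (x + t * ξ) (y + t * η) ≠ 0 := by
      intro h0
      have := h3.D
      rw [h0] at this; simp at this; linarith
    have hf : HasDerivAt (fun t : ℂ => x + t * ξ) ξ t := by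
      simpa using ((hasDerivAt_id t).mul_const ξ).const_add x
    have hg : HasDerivAt (fun t : ℂ => y + t * η) η t := by
      simpa using ((hasDerivAt_id t).mul_const η).const_add y
    have a1 := fun m => h.dX m _ h1
    have a2 := fun m => h.dY m _ h1
    have a3 := fun m => h.dX m _ h2
    have a4 := fun m => h.dY m _ h2
    interval_cases m
    · exact hasDerivAt_crG hf hg a1 a2 a3 a4 hD
    · exact ((hasDerivAt_crGx hf hg a1 a2 a3 a4 hD).mul_const ξ).add
        ((hasDerivAt_crGy hf hg a1 a2 a3 a4 hD).mul_const η)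
  · intro t ht
    obtain ⟨-, -, h3, -⟩ := hseg t ht
    have h4 := h3.Gxx; have h5 := h3.Gxy; have h6 := h3.Gyy
    calc _ ≤ (C * δ * ‖ξ‖ + C * δ * ‖η‖) * ‖ξ‖ + (C * δ * ‖ξ‖ + C * δ * ‖η‖) * ‖η‖ := by
          refine (norm_add_le _ _).trans ?_
          rw [norm_mul, norm_mul]
          gcongr <;> refine (norm_add_le _ _).trans ?_ <;> rw [norm_mul, norm_mul] <;> gcongr
      _ = _ := by ring

end DualBilliard

namespace DualBilliard

namespace Pt
variable {M c : ℝ}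
local notation "𝒪" => Od (Pt.δ (M := M) (c := c))

lemma od_D (hM : 0 ≤ M) : 𝒪 1 fun p => crD p.X p.Y p.x p.y :=
  (((od_D_sub hM).mono (m := 1)).add (Od.mul od_kap od_h)).congr fun p => by ring

lemma od_N (hM : 0 ≤ M) : 𝒪 2 fun p => crN p.X p.Y p.x p.y :=
  (((od_N_sub hM).mono (m := 2)).add ((Od.mul (Od.mul od_kap (od_h_pow 2) (k := 2))
    (Od.const (1 / 2))))).congr fun p => by ring

lemma od_D_expand (hM : 0 ≤ M) : 𝒪 4 fun p => crD p.X p.Y p.x p.y -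
    (kap p.X p.Y p.x * (p.y - p.x) + kap' p.X p.Y p.x * (p.y - p.x) ^ 2 / 2 +
      (p.X 1 p.x * p.Y 4 p.x - p.Y 1 p.x * p.X 4 p.x) * (p.y - p.x) ^ 3 / 6) := by
  have hX := od_taylor_X (c := c) hM 1 4 (by norm_num)
  have hY := od_taylor_Y (c := c) hM 1 4 (by norm_num)
  have h1 : 𝒪 4 _ := Od.mul (od_X (i := 1)) hY
  have h2 : 𝒪 4 _ := Od.mul (od_Y (i := 1)) hX
  refine (h1.sub h2).congr fun p => ?_
  simp only [Finset.sum_range_succ, Finset.sum_range_zero, crD, kap, kap', Nat.factorial]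
  push_cast
  ring

lemma od_N_expand (hM : 0 ≤ M) : 𝒪 5 fun p => crN p.X p.Y p.x p.y -
    (kap p.X p.Y p.x * (p.y - p.x) ^ 2 / 2 + kap' p.X p.Y p.x * (p.y - p.x) ^ 3 / 3 +
      ((p.X 1 p.x * p.Y 4 p.x - p.Y 1 p.x * p.X 4 p.x) / 8 +
       (p.X 2 p.x * p.Y 3 p.x - p.Y 2 p.x * p.X 3 p.x) / 12) * (p.y - p.x) ^ 4) := by
  have hX := od_taylor_X (c := c) hM 1 4 (by norm_num)
  have hY := od_taylor_Y (c := c) hM 1 4 (by norm_num)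
  have hX0 := od_taylor_X (c := c) hM 0 5 (by norm_num)
  have hY0 := od_taylor_Y (c := c) hM 0 5 (by norm_num)
  have h1 : 𝒪 5 _ := Od.mul hX0 (od_Y' (i := 1))
  have h2 : 𝒪 5 _ := Od.mul hY0 (od_X' (i := 1))
  have hX1 := od_taylor_X (c := c) hM 0 1 (by norm_num)
  have hY1 := od_taylor_Y (c := c) hM 0 1 (by norm_num)
  have h3 : 𝒪 5 _ := Od.mul ((hX1.sub ((hX0.mono (m := 1))))) hY
  have h4 : 𝒪 5 _ := Od.mul ((hY1.sub ((hY0.mono (m := 1))))) hX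
  have e : ∀ i j : ℕ, i ≤ 5 → j ≤ 5 → ∀ q : ℂ, 𝒪 5 fun p : Pt M c =>
      (p.X i p.x * p.Y j p.x - p.Y i p.x * p.X j p.x) * ((p.y - p.x) ^ 5 * q) := fun i j hi hj q =>
    Od.mul (k := 5) (((Od.mul (od_X hi) (od_Y hj)).sub (Od.mul (od_Y hi) (od_X hj))) : 𝒪 0 _)
      ((od_h_pow 5).mul (Od.const q) (k := 5))
  have e6 : 𝒪 5 fun p : Pt M c => (p.X 3 p.x * p.Y 4 p.x - p.Y 3 p.x * p.X 4 p.x) *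
      ((p.y - p.x) ^ 6 * (1 / 144)) := by
    have := Od.mul (k := 6) (((Od.mul (od_X (i := 3)) (od_Y (i := 4))).sub
      (Od.mul (od_Y (i := 3)) (od_X (i := 4)))) : 𝒪 0 _)
      ((od_h_pow 6).mul (Od.const (1 / 144)) (k := 6))
    exact this.mono (m := 5)
  have h5 := e 2 4 (by norm_num) (by norm_num) (1 / 24)
  refine (((h1.sub h2).add (h3.sub h4)).add (h5.add e6)).congr fun p => ?_
  simp only [Finset.sum_range_succ, Finset.sum_range_zero, crN, kap, kap', Nat.factorial]
  push_cast
  ring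

end Pt

/-- A pair of points `x, y` together with the reflection of `y` in `x`, along a curve whose
curvature is almost constant. -/
structure SPt (M c : ℝ) extends Pt M c where
  hz : 2 * x - y ∈ strip R
  flat : ‖kap' X Y x‖ ≤ M * δ ^ 2

namespace SPt
variable {M c : ℝ}

abbrev size (p : SPt M c) : ℝ := p.δ

instance : PosFun (size (M := M) (c := c)) := ⟨fun p => p.hδ⟩

def refl (p : SPt M c) : Pt M c where
  __ := p
  y := 2 * p.x - p.y
  hy := p.hz
  low := by rw [show 2 * p.x - p.y - p.x = -(p.y - p.x) by ring, norm_neg]; exact p.low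
  upp := by rw [show 2 * p.x - p.y - p.x = -(p.y - p.x) by ring, norm_neg]; exact p.upp

local notation "𝒪" => Od (size (M := M) (c := c))
local notation "ℒ" => Lo (size (M := M) (c := c))

lemma od_toPt {k : ℤ} {f : Pt M c → ℂ} (hf : Od (Pt.δ (M := M) (c := c)) k f) :
    𝒪 k fun p => f p.toPt := hf.comp _ fun _ => rfl

lemma od_refl {k : ℤ} {f : Pt M c → ℂ} (hf : Od (Pt.δ (M := M) (c := c)) k f) :
    𝒪 k fun p => f p.refl := hf.comp _ fun _ => rfl

lemma lo_toPt {k : ℤ} {f : Pt M c → ℂ} (hf : Lo (Pt.δ (M := M) (c := c)) k f) :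
    ℒ k fun p => f p.toPt := by
  obtain ⟨A, a, hA, ha, hf⟩ := hf
  exact ⟨A, a, hA, ha, fun q hq => hf _ hq⟩

lemma lo_refl {k : ℤ} {f : Pt M c → ℂ} (hf : Lo (Pt.δ (M := M) (c := c)) k f) :
    ℒ k fun p => f p.refl := by
  obtain ⟨A, a, hA, ha, hf⟩ := hf
  exact ⟨A, a, hA, ha, fun q hq => hf q.refl hq⟩

lemma od_sum (hM : 0 ≤ M) (hc : 0 < c) : 𝒪 4 fun p =>
    crG p.X p.Y p.x p.y + crG p.X p.Y p.x (2 * p.x - p.y) := by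
  have n1 := od_toPt (Pt.od_N_expand (c := c) hM)
  have n2 := od_refl (Pt.od_N_expand (c := c) hM)
  have d1 := od_toPt (Pt.od_D_expand (c := c) hM)
  have d2 := od_refl (Pt.od_D_expand (c := c) hM)
  have N1 := od_toPt (Pt.od_N (c := c) hM)
  have N2 := od_refl (Pt.od_N (c := c) hM)
  have D1 := od_toPt (Pt.od_D (c := c) hM)
  have D2 := od_refl (Pt.od_D (c := c) hM)
  have l1 := lo_toPt (Pt.lo_D (c := c) hM hc)
  have l2 := lo_refl (Pt.lo_D (c := c) hM hc)
  have a1 : 𝒪 6 _ := Od.mul n1 D2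
  have a2 : 𝒪 6 _ := Od.mul N1 d2
  have a3 : 𝒪 6 _ := (Od.mul (k := 9) n1 d2).mono
  have b1 : 𝒪 6 _ := Od.mul n2 D1
  have b2 : 𝒪 6 _ := Od.mul N2 d1
  have b3 : 𝒪 6 _ := (Od.mul (k := 9) n2 d1).mono
  have e : ∀ i j : ℕ, i ≤ 5 → j ≤ 5 → 𝒪 0 fun p : SPt M c =>
      (p.X i p.x * p.Y j p.x - p.Y i p.x * p.X j p.x) := fun i j hi hj => od_toPt
    ((Od.mul (Pt.od_X hi) (Pt.od_Y hj)).sub (Od.mul (Pt.od_Y hi) (Pt.od_X hj)))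
  have hk : 𝒪 2 fun p : SPt M c => kap' p.X p.Y p.x := Od.of_le M fun p => mod_cast p.flat
  have h4 : 𝒪 4 _ := od_toPt (Pt.od_h_pow (M := M) (c := c) 4)
  have c1 : 𝒪 6 _ := Od.mul (Od.mul (k := 2) hk (e 1 2 (by norm_num) (by norm_num))) h4
  have c2 : 𝒪 6 _ := (Od.mul (k := 8) (Od.mul (k := 2) hk (e 1 4 (by norm_num) (by norm_num)))
    (od_toPt (Pt.od_h_pow (M := M) (c := c) 6))).mono
  have c3 : 𝒪 6 _ := (Od.mul (k := 8) (Od.mul (k := 2) hk (e 2 3 (by norm_num) (by norm_num)))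
    (od_toPt (Pt.od_h_pow (M := M) (c := c) 6))).mono
  have hnum := (((a1.add a2).sub a3).add ((b1.add b2).sub b3)).add
    (((Od.const (-1 / 6)).mul c1 (k := 6)).add (((Od.const (1 / 72)).mul c2 (k := 6)).add
      ((Od.const (1 / 12)).mul c3 (k := 6))))
  obtain ⟨C, δ₁, h2, h3⟩ := hnum.div (k := 4) (Lo.mul (k := 2) l1 l2)
  obtain ⟨δ₂, h4, hne⟩ := l1.ne_zero
  obtain ⟨δ₃, h5, hne'⟩ := l2.ne_zero
  refine ⟨C, min δ₁ (min δ₂ δ₃), by positivity, fun p hp => ?_⟩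
  simp only [le_min_iff] at hp
  refine le_of_eq_of_le (congrArg _ ?_) (h3 p hp.1)
  have e1 := hne p hp.2.1
  have e2 := hne' p hp.2.2
  simp only [refl] at e2 ⊢
  simp only [crG]
  rw [div_add_div _ _ e1 e2]
  congr 1
  simp only [kap, kap']
  ring

end SPt

lemma exists_sum_bd {M c : ℝ} (hM : 0 ≤ M) (hc : 0 < c) : ∃ C δ₀ : ℝ, 0 ≤ C ∧ 0 < δ₀ ∧
    ∀ (δ R : ℝ) (X Y : ℕ → ℂ → ℂ) (x : ℂ) (ω : ℝ), 0 < δ → δ ≤ δ₀ → Crv M c δ R X Y →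
    x ∈ strip R → ‖kap' X Y x‖ ≤ M * δ ^ 2 → δ ≤ ω → ω ≤ 2 * δ →
    ‖crG X Y x (x + ω) + crG X Y x (x - ω)‖ ≤ C * δ ^ 4 := by
  obtain ⟨C, δ₀, h0, h⟩ := SPt.od_sum (M := M) (c := c) hM hc
  refine ⟨|C|, δ₀, abs_nonneg _, h0, fun δ R X Y x ω hδ hδ0 hC hx hk h1 h2 => ?_⟩
  have hω : ‖(ω : ℂ)‖ = ω := Complex.norm_of_nonneg (by linarith)
  have := h ⟨⟨δ, R, X, Y, x, x + ω, hδ, hC, hx, add_ofReal_mem_strip hx ω, by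
    rw [add_sub_cancel_left, hω]; linarith, by rw [add_sub_cancel_left, hω]; linarith⟩, by
    simpa [two_mul] using sub_ofReal_mem_strip hx ω, hk⟩ hδ0
  simp only [SPt.size] at this
  rw [show 2 * x - (x + ω) = x - ω by ring] at this
  exact this.trans (by exact_mod_cast mul_le_mul_of_nonneg_right (le_abs_self C) (by positivity))

/-- Dependence of `crG` on the curve. -/
lemma exists_crG_sub_bd {M c : ℝ} (hM : 0 ≤ M) (hc : 0 < c) : ∃ C δ₀ : ℝ, 0 ≤ C ∧ 0 < δ₀ ∧
    ∀ (δ R R' : ℝ) (X Y X' Y' : ℕ → ℂ → ℂ) (x y : ℂ) (e₀ e₁ : ℝ), 0 < δ → δ ≤ δ₀ →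
    Crv M c δ R X Y → Crv M c δ R' X' Y' → x ∈ strip R → y ∈ strip R → x ∈ strip R' → y ∈ strip R' →
    δ / 2 ≤ ‖y - x‖ → ‖y - x‖ ≤ 4 * δ →
    (∀ z, z = x ∨ z = y → ‖X 0 z - X' 0 z‖ ≤ e₀ ∧ ‖Y 0 z - Y' 0 z‖ ≤ e₀ ∧
      ‖X 1 z - X' 1 z‖ ≤ e₁ ∧ ‖Y 1 z - Y' 1 z‖ ≤ e₁) →
    ‖crG X Y x y - crG X' Y' x y‖ ≤ C * (e₀ / δ + e₁) := by
  obtain ⟨C₀, δ₀, hC0, h0, h⟩ := exists_crBd (M := M) (c := c) hM hc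
  refine ⟨C₀ * (4 * M + 8 * M + (C₀ * 1 + 2) * (4 * M)), min δ₀ 1, by positivity,
    by positivity, fun δ R R' X Y X' Y' x y e₀ e₁ hδ hδ0 hc1 hc2 hx hy hx' hy' hl hu he => ?_⟩
  have hB := h ⟨δ, R, X, Y, x, y, hδ, hc1, hx, hy, hl, hu⟩ (hδ0.trans (min_le_left _ _))
  have hB' := h ⟨δ, R', X', Y', x, y, hδ, hc2, hx', hy', hl, hu⟩ (hδ0.trans (min_le_left _ _))
  simp only at hB hB'
  obtain ⟨a1, a2, a3, a4⟩ := he x (Or.inl rfl)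
  obtain ⟨b1, b2, b3, b4⟩ := he y (Or.inr rfl)
  have he0 : 0 ≤ e₀ := (norm_nonneg _).trans a1
  have he1 : 0 ≤ e₁ := (norm_nonneg _).trans a3
  have hDn : crD X Y x y ≠ 0 := fun h0 => by have := hB.D; rw [h0] at this; simp at this; linarith
  have hDn' : crD X' Y' x y ≠ 0 := fun h0 => by
    have := hB'.D; rw [h0] at this; simp at this; linarith
  have hlip : ∀ {Z : ℕ → ℂ → ℂ}, (∀ z ∈ strip R', HasDerivAt (Z 0) (Z 1 z) z) →
      (∀ z ∈ strip R', ‖Z 1 z‖ ≤ M) → ‖Z 0 y - Z 0 x‖ ≤ M * (4 * δ) := fun h1 h2 =>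
    ((convex_strip R').norm_image_sub_le_of_norm_hasDerivWithin_le
      (fun z hz => (h1 z hz).hasDerivWithinAt) h2 hx' hy').trans (by gcongr)
  have l1 := hlip (hc2.dX 0) (hc2.bX 1 (by norm_num))
  have l2 := hlip (hc2.dY 0) (hc2.bY 1 (by norm_num))
  have hN : ‖crN X Y x y - crN X' Y' x y‖ ≤ 4 * M * e₀ + 8 * M * δ * e₁ := by
    have : crN X Y x y - crN X' Y' x y =
      ((X 0 y - X' 0 y) - (X 0 x - X' 0 x)) * Y 1 y - ((Y 0 y - Y' 0 y) - (Y 0 x - Y' 0 x)) * X 1 y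
      + (X' 0 y - X' 0 x) * (Y 1 y - Y' 1 y) - (Y' 0 y - Y' 0 x) * (X 1 y - X' 1 y) := by
        simp only [crN]; ring
    rw [this]
    calc _ ≤ (e₀ + e₀) * M + (e₀ + e₀) * M + M * (4 * δ) * e₁ + M * (4 * δ) * e₁ := by
          refine (norm_sub_le _ _).trans (add_le_add ((norm_add_le _ _).trans (add_le_add
            ((norm_sub_le _ _).trans (add_le_add ?_ ?_)) ?_)) ?_) <;> rw [norm_mul]
          · exact mul_le_mul ((norm_sub_le _ _).trans (add_le_add b1 a1))
              (hc1.bY 1 (by norm_num) _ hy) (norm_nonneg _) (by positivity)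
          · exact mul_le_mul ((norm_sub_le _ _).trans (add_le_add b2 a2))
              (hc1.bX 1 (by norm_num) _ hy) (norm_nonneg _) (by positivity)
          · gcongr
          · gcongr
      _ = _ := by ring
  have hDD : ‖crD X Y x y - crD X' Y' x y‖ ≤ 4 * M * e₁ := by
    have : crD X Y x y - crD X' Y' x y =
      (X 1 x - X' 1 x) * Y 1 y - (Y 1 x - Y' 1 x) * X 1 y
      + X' 1 x * (Y 1 y - Y' 1 y) - Y' 1 x * (X 1 y - X' 1 y) := by
        simp only [crD]; ring
    rw [this]
    calc _ ≤ e₁ * M + e₁ * M + M * e₁ + M * e₁ := by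
          refine (norm_sub_le _ _).trans (add_le_add ((norm_add_le _ _).trans (add_le_add
            ((norm_sub_le _ _).trans (add_le_add ?_ ?_)) ?_)) ?_) <;> rw [norm_mul]
          · exact mul_le_mul a3 (hc1.bY 1 (by norm_num) _ hy) (norm_nonneg _) he1
          · exact mul_le_mul a4 (hc1.bX 1 (by norm_num) _ hy) (norm_nonneg _) he1
          · exact mul_le_mul (hc2.bX 1 (by norm_num) _ hx') b4 (norm_nonneg _) hM
          · exact mul_le_mul (hc2.bY 1 (by norm_num) _ hx') b3 (norm_nonneg _) hM
      _ = _ := by ring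
  have hG : ‖crG X' Y' x y‖ ≤ (C₀ * 1 + 2) * δ := by
    have h1 := hB'.G
    have h2 := norm_add_le (crG X' Y' x y - (y - x) / 2) ((y - x) / 2)
    rw [sub_add_cancel, norm_div, Complex.norm_ofNat] at h2
    have h3 : δ ^ 2 ≤ 1 := pow_le_one₀ hδ.le (hδ0.trans (min_le_right _ _))
    nlinarith [mul_nonneg (by positivity : 0 ≤ C₀ * δ) (sub_nonneg.2 h3)]
  have hkey : (crG X Y x y - crG X' Y' x y) * crD X Y x y =
      (crN X Y x y - crN X' Y' x y) - crG X' Y' x y * (crD X Y x y - crD X' Y' x y) := by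
    simp only [crG]; field_simp; ring
  have h1 : ‖crG X Y x y - crG X' Y' x y‖ * ‖crD X Y x y‖ ≤
      4 * M * e₀ + 8 * M * δ * e₁ + (C₀ * 1 + 2) * δ * (4 * M * e₁) := by
    rw [← norm_mul, hkey]
    refine (norm_sub_le _ _).trans ?_
    rw [norm_mul]
    gcongr
  have h2 : ‖crG X Y x y - crG X' Y' x y‖ * δ ≤
      C₀ * (4 * M * e₀ + 8 * M * δ * e₁ + (C₀ * 1 + 2) * δ * (4 * M * e₁)) := by
    nlinarith [hB.D, norm_nonneg (crG X Y x y - crG X' Y' x y)]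
  rw [← le_div_iff₀ hδ] at h2
  refine h2.trans ?_
  rw [div_le_iff₀ hδ, mul_assoc C₀, mul_assoc C₀]
  refine mul_le_mul_of_nonneg_left ?_ (by positivity)
  have e1 : (e₀ / δ + e₁) * δ = e₀ + e₁ * δ := by field_simp
  rw [mul_assoc _ (e₀ / δ + e₁) δ, e1]
  have : 0 ≤ M * e₀ := by positivity
  have : 0 ≤ M * (e₁ * δ) := by positivity
  have : 0 ≤ C₀ * (M * e₀) := by positivity
  nlinarith


end DualBilliard

namespace DualBilliard

lemma SF.congr {R : ℝ} {f g : ℂ → ℂ} (hf : SF R f) (h : ∀ z, g z = f z) : SF R g := by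
  rwa [show g = f from funext h]

lemma SF.norm_sub_re_le {R L : ℝ} {v : ℂ → ℂ} (hv : SF R v) (hL : ∀ z ∈ strip R, ‖_root_.deriv v z‖ ≤ L)
    {z w : ℂ} (hz : z ∈ strip R) (hw : w ∈ strip R) : ‖v w - v z‖ ≤ L * ‖w - z‖ :=
  (convex_strip R).norm_image_sub_le_of_norm_deriv_le (fun _ h => hv.differentiableAt h) hL hz hw

/-- The lift `z ↦ z + v z` of a circle map. -/
def lft (v : ℂ → ℂ) (z : ℂ) : ℂ := z + v z

lemma SF.comp_lft {R R' : ℝ} {F v : ℂ → ℂ} (hF : SF R' F) (hv : SF R v)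
    (h : ∀ z ∈ strip R, lft v z ∈ strip R') : SF R (fun z => F (lft v z)) := by
  refine ⟨hF.diff.comp (differentiableOn_id.add hv.diff) h, fun z => ?_, fun x => ?_⟩
  · rw [← hF.per (lft v z)]
    simp only [lft, hv.per]
    ring_nf
  · have := hF.real (x + (v x).re)
    rwa [Complex.ofReal_add, hv.ofReal_re] at this

/-- Data for one step of the Newton iteration. -/
structure Stp (M c C δ r ω : ℝ) (X Y : ℕ → ℂ → ℂ) (v : ℂ → ℂ) : Prop where
  hM : 0 ≤ M
  hc : 0 < c
  hC : 1 ≤ C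
  hδ : 0 < δ
  hr : 0 < r
  hrδ : r ≤ δ
  sm : C * δ ^ 2 ≤ 1 / 200
  low : δ ≤ ω
  upp : ω ≤ 2 * δ
  crv : Crv M c δ (2 * r) X Y
  bd : ∀ x ∈ strip (2 * r), ∀ y ∈ strip (2 * r), δ / 2 ≤ ‖y - x‖ → ‖y - x‖ ≤ 4 * δ → CrBd C δ X Y x y
  sv : SF r v
  dv : ∀ z ∈ strip r, ‖deriv v z‖ ≤ 1 / 10

section
variable (X Y : ℕ → ℂ → ℂ) (v : ℂ → ℂ) (ω : ℝ) (z : ℂ)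
noncomputable def stG : ℂ := crG X Y (lft v z) (lft v (z + ω))
noncomputable def stGx : ℂ := crGx X Y (lft v z) (lft v (z + ω))
noncomputable def stGy : ℂ := crGy X Y (lft v z) (lft v (z + ω))
noncomputable def stE : ℂ := stG X Y v ω z + stG X Y v (-ω) z
noncomputable def dlft : ℂ := 1 + deriv v z
def stK : ℂ := kap X Y (lft v z)
noncomputable def stB : ℂ := stK X Y v z * stG X Y v ω z * stGy X Y v ω z * dlft v z * dlft v (z + ω)
noncomputable def stF : ℂ := 1 / 2 * (stK X Y v z * dlft v z * (stG X Y v ω z ^ 2 - stG X Y v (-ω) z ^ 2))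
/-- The area form `[a, a']` along the curve. -/
def crm : ℂ := X 0 z * Y 1 z - Y 0 z * X 1 z
end

lemma stGy_eq (X Y : ℕ → ℂ → ℂ) (v : ℂ → ℂ) (s : ℝ) (z : ℂ) : stGy X Y v s z =
    -(stK X Y v (z + s) * stG X Y v (-s) (z + s) / crD X Y (lft v z) (lft v (z + s))) := by
  have : z + s + (-s : ℝ) = z := by push_cast; ring
  simp only [stGy, crGy, stK, stG, this]


lemma stB_swap (X Y : ℕ → ℂ → ℂ) (v : ℂ → ℂ) (s : ℝ) (z : ℂ) : stB X Y v s (z + (-s : ℝ)) = - stB X Y v (-s) z := by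
  have := kap_mul_crG_mul_crGy X Y (lft v z) (lft v (z + (-s : ℝ)))
  have e : z + (-s : ℝ) + s = z := by push_cast; ring
  simp only [stB, stK, stG, stGy, e]
  linear_combination (dlft v (z + (-s : ℝ)) * dlft v z) * this


namespace Stp
variable {M c C δ r ω : ℝ} {X Y : ℕ → ℂ → ℂ} {v : ℂ → ℂ} (h : Stp M c C δ r ω X Y v)
include h

lemma lft_mem {z : ℂ} (hz : z ∈ strip r) : lft v z ∈ strip (11 / 10 * |z.im|+ r / 10) := by
  have h1 := h.sv.norm_sub_re_le h.dv (ofReal_mem_strip h.hr z.re) hz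
  have h2 : z - z.re = z.im * Complex.I := by
    apply Complex.ext <;> simp
  rw [h2, norm_mul, Complex.norm_I, Complex.norm_real, mul_one, Real.norm_eq_abs] at h1
  have h3 : (lft v z).im = z.im + (v z - v z.re).im := by
    simp [lft, h.sv.real]
  show |(lft v z).im| < _
  rw [h3]
  have h4 := Complex.abs_im_le_norm (v z - v z.re)
  have h5 := abs_add_le z.im (v z - v z.re).im
  have := h.hr
  linarith

lemma lft_mem' {z : ℂ} (hz : z ∈ strip r) : lft v z ∈ strip (2 * r) := by
  refine strip_mono ?_ (h.lft_mem hz)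
  have : |z.im| < r := hz
  have := h.hr
  linarith

lemma sX (m : ℕ) : SF r fun z => X m (lft v z) := (h.crv.sX m).comp_lft h.sv fun _ => h.lft_mem'
lemma sY (m : ℕ) : SF r fun z => Y m (lft v z) := (h.crv.sY m).comp_lft h.sv fun _ => h.lft_mem'

lemma sdlft : SF r (dlft v) := by
  have := (SF.const r 1).add (h.sv.deriv h.hr)
  exact this.congr fun z => by simp [dlft]

lemma sK : SF r (stK X Y v) := ((h.sX 1).mul (h.sY 2)).sub ((h.sY 1).mul (h.sX 2))

lemma diff_le {z : ℂ} (hz : z ∈ strip r) (s : ℝ) :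
    ‖lft v (z + s) - lft v z - s‖ ≤ |s| / 10 := by
  have h1 := h.sv.norm_sub_re_le h.dv hz (add_ofReal_mem_strip hz s)
  rw [add_sub_cancel_left, Complex.norm_real, Real.norm_eq_abs] at h1
  have : lft v (z + s) - lft v z - s = v (z + s) - v z := by simp only [lft]; ring
  rw [this]; linarith

lemma hasDerivAt_lft {z : ℂ} (hz : z ∈ strip r) : HasDerivAt (lft v) (dlft v z) z :=
  (hasDerivAt_id z).add (h.sv.differentiableAt hz).hasDerivAt

lemma hasDerivAt_lft_add (s : ℝ) {z : ℂ} (hz : z ∈ strip r) :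
    HasDerivAt (fun z => lft v (z + s)) (dlft v (z + s)) z := by
  have := (h.hasDerivAt_lft (add_ofReal_mem_strip hz s)).comp z
    ((hasDerivAt_id z).add_const (s : ℂ))
  simpa [Function.comp_def] using this

variable {s : ℝ} (hs1 : δ ≤ |s|) (hs2 : |s| ≤ 2 * δ)
include hs1 hs2

omit hs2 in
lemma diff_low {z : ℂ} (hz : z ∈ strip r) : 9 / 10 * δ ≤ ‖lft v (z + s) - lft v z‖ := by
  have h1 := h.diff_le hz s
  have h2 := norm_sub_norm_le (s : ℂ) (s - (lft v (z + s) - lft v z))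
  rw [sub_sub_cancel, norm_sub_rev (s : ℂ), Complex.norm_real, Real.norm_eq_abs] at h2
  linarith

omit hs1 in
lemma diff_upp {z : ℂ} (hz : z ∈ strip r) : ‖lft v (z + s) - lft v z‖ ≤ 11 / 5 * δ := by
  have h1 := h.diff_le hz s
  have h2 := norm_sub_norm_le (lft v (z + s) - lft v z) (s : ℂ)
  rw [Complex.norm_real, Real.norm_eq_abs] at h2
  linarith

lemma crBd {z : ℂ} (hz : z ∈ strip r) : CrBd C δ X Y (lft v z) (lft v (z + s)) := by
  have := h.diff_low hs1 hz
  have := h.diff_upp hs2 hz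
  have := h.hδ
  exact h.bd _ (h.lft_mem' hz) _ (h.lft_mem' (add_ofReal_mem_strip hz s)) (by linarith) (by linarith)

lemma crD_ne {z : ℂ} (hz : z ∈ strip r) : crD X Y (lft v z) (lft v (z + s)) ≠ 0 := fun h0 => by
  have h1 := (h.crBd hs1 hs2 hz).D
  have := h.hδ
  rw [h0, norm_zero, mul_zero] at h1
  linarith

lemma sG : SF r (stG X Y v s) :=
  ((((((h.sX 0).shift s).sub (h.sX 0)).mul ((h.sY 1).shift s))).sub
    ((((h.sY 0).shift s).sub (h.sY 0)).mul ((h.sX 1).shift s))).div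
    (((h.sX 1).mul ((h.sY 1).shift s)).sub ((h.sY 1).mul ((h.sX 1).shift s)))
    fun _ hz => h.crD_ne hs1 hs2 hz

lemma sGy : SF r (stGy X Y v s) := by
  have h1 := h.sG (s := -s) (by rwa [abs_neg]) (by rwa [abs_neg])
  refine (((h.sK.shift s).mul (h1.shift s)).div
    (((h.sX 1).mul ((h.sY 1).shift s)).sub ((h.sY 1).mul ((h.sX 1).shift s)))
    fun _ hz => h.crD_ne hs1 hs2 hz).neg.congr fun z => stGy_eq X Y v s z

lemma sB : SF r (stB X Y v s) :=
  (((h.sK.mul (h.sG hs1 hs2)).mul (h.sGy hs1 hs2)).mul h.sdlft).mul (h.sdlft.shift s)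

lemma hasDerivAt_G {z : ℂ} (hz : z ∈ strip r) : HasDerivAt (stG X Y v s)
    (stGx X Y v s z * dlft v z + stGy X Y v s z * dlft v (z + s)) z := by
  have m1 := h.lft_mem' hz
  have m2 := h.lft_mem' (add_ofReal_mem_strip hz s)
  exact hasDerivAt_crG (h.hasDerivAt_lft hz) (h.hasDerivAt_lft_add s hz)
    (fun m => h.crv.dX m _ m1) (fun m => h.crv.dY m _ m1) (fun m => h.crv.dX m _ m2)
    (fun m => h.crv.dY m _ m2) (h.crD_ne hs1 hs2 hz)

end Stp
end DualBilliard

namespace DualBilliard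

lemma norm_mul_sub_one_le {a b : ℂ} {A B : ℝ} (ha : ‖a - 1‖ ≤ A) (hb : ‖b - 1‖ ≤ B) :
    ‖a * b - 1‖ ≤ A + B + A * B := by
  have : a * b - 1 = (a - 1) + (b - 1) + (a - 1) * (b - 1) := by ring
  rw [this]
  have hA := (norm_nonneg _).trans ha
  refine (norm_add_le _ _).trans (add_le_add ((norm_add_le _ _).trans (add_le_add ha hb)) ?_)
  rw [norm_mul]; gcongr

lemma norm_ge_of_sub_one {a : ℂ} {A : ℝ} (ha : ‖a - 1‖ ≤ A) : 1 - A ≤ ‖a‖ := by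
  have := norm_sub_norm_le (1 : ℂ) a
  rw [norm_sub_rev, norm_one] at this; linarith

lemma norm_le_of_sub_one {a : ℂ} {A : ℝ} (ha : ‖a - 1‖ ≤ A) : ‖a‖ ≤ 1 + A := by
  have := norm_sub_norm_le a (1 : ℂ)
  rw [norm_one] at this; linarith

lemma fc_zero (f : ℂ → ℂ) : fc f 0 = 1 / (2 * π) * ∫ x in (0:ℝ)..(2 * π), f x := by simp [fc]

section
variable {R : ℝ} {f g : ℂ → ℂ}

lemma SF.intervalIntegrable (hf : SF R f) (hR : 0 < R) (a b : ℝ) :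
    IntervalIntegrable (fun x : ℝ => f x) volume a b :=
  (hf.continuous_ofReal hR).intervalIntegrable _ _

lemma SF.periodic (hf : SF R f) : Function.Periodic (fun x : ℝ => f x) (2 * π) := fun x => by
  have := hf.per x
  push_cast; exact this

lemma SF.integral_shift (hf : SF R f) (s : ℝ) :
    ∫ x in (0:ℝ)..(2 * π), f (x + s) = ∫ x in (0:ℝ)..(2 * π), f x := by
  have h1 := intervalIntegral.integral_comp_add_right (a := 0) (b := 2 * π) (fun x : ℝ => f x) s
  have h2 := hf.periodic.intervalIntegral_add_eq s 0
  simp only [zero_add] at h1 h2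
  rw [add_comm s] at h2
  rw [h2] at h1
  rw [← h1]
  push_cast; rfl

lemma SF.integral_eq_zero_of_hasDerivAt (hf : SF R f) (hg : SF R g) (hR : 0 < R)
    (h : ∀ x : ℝ, HasDerivAt f (g x) x) : ∫ x in (0:ℝ)..(2 * π), g x = 0 := by
  rw [intervalIntegral.integral_eq_sub_of_hasDerivAt (f := fun x : ℝ => f x)
    (fun x _ => (h x).comp_ofReal) (hg.intervalIntegrable hR _ _)]
  have := hf.per 0
  rw [zero_add] at this
  push_cast; rw [this, sub_self]
end

lemma hasDerivAt_exact {X Y : ℕ → ℂ → ℂ} {f g : ℂ → ℂ} {f' g' t : ℂ}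
    (hf : HasDerivAt f f' t) (hg : HasDerivAt g g' t)
    (hXf : ∀ m, HasDerivAt (X m) (X (m + 1) (f t)) (f t))
    (hYf : ∀ m, HasDerivAt (Y m) (Y (m + 1) (f t)) (f t))
    (hXg : ∀ m, HasDerivAt (X m) (X (m + 1) (g t)) (g t))
    (hYg : ∀ m, HasDerivAt (Y m) (Y (m + 1) (g t)) (g t)) (hD : crD X Y (f t) (g t) ≠ 0) :
    HasDerivAt (fun t => crG X Y (f t) (g t) * crm X Y (f t) - crG X Y (g t) (f t) * crm X Y (g t))
      (-(crm X Y (f t) * f') - kap X Y (f t) * crG X Y (f t) (g t) ^ 2 * f' +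
        (crm X Y (g t) * g' + kap X Y (g t) * crG X Y (g t) (f t) ^ 2 * g')) t := by
  have hD' : crD X Y (g t) (f t) ≠ 0 := by rw [crD_swap]; exact neg_ne_zero.2 hD
  have m1 : HasDerivAt (fun t => crm X Y (f t))
      ((X 0 (f t) * Y 2 (f t) - Y 0 (f t) * X 2 (f t)) * f') t := by
    refine ((((hXf 0).comp t hf).mul ((hYf 1).comp t hf)).sub
      (((hYf 0).comp t hf).mul ((hXf 1).comp t hf))).congr_deriv ?_
    simp only [Function.comp]; ring
  have m2 : HasDerivAt (fun t => crm X Y (g t))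
      ((X 0 (g t) * Y 2 (g t) - Y 0 (g t) * X 2 (g t)) * g') t := by
    refine ((((hXg 0).comp t hg).mul ((hYg 1).comp t hg)).sub
      (((hYg 0).comp t hg).mul ((hXg 1).comp t hg))).congr_deriv ?_
    simp only [Function.comp]; ring
  refine (((hasDerivAt_crG hf hg hXf hYf hXg hYg hD).mul m1).sub
    ((hasDerivAt_crG hg hf hXg hYg hXf hYf hD').mul m2)).congr_deriv ?_
  have key : ∀ x y : ℂ, crD X Y x y ≠ 0 → crGx X Y x y * crm X Y x +
      crG X Y x y * (X 0 x * Y 2 x - Y 0 x * X 2 x) - crGy X Y y x * crm X Y y =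
      -(crm X Y x) - kap X Y x * crG X Y x y ^ 2 := by
    intro x y h0
    have hp : (X 0 x * Y 2 x - Y 0 x * X 2 x) * crD X Y x y = crDx X Y x y * crm X Y x
        + kap X Y x * (X 0 x * Y 1 y - Y 0 x * X 1 y) := by
      simp only [crD, crDx, crm, kap]; ring
    have hN : crG X Y x y * crD X Y x y = crm X Y y - (X 0 x * Y 1 y - Y 0 x * X 1 y) := by
      simp only [crG, div_mul_cancel₀ _ h0, crN, crm]; ring
    simp only [crGx, crGy, crD_swap X Y y x]
    field_simp
    linear_combination crG X Y x y * hp + (crG X Y x y * kap X Y x) * hN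
  linear_combination f' * key _ _ hD - g' * key _ _ hD'

namespace Stp
variable {M c C δ r ω : ℝ} {X Y : ℕ → ℂ → ℂ} {v : ℂ → ℂ} (h : Stp M c C δ r ω X Y v)
include h

lemma abs_ω : |ω| = ω := abs_of_pos (h.hδ.trans_le h.low)
lemma low₁ : δ ≤ |ω| := by rw [h.abs_ω]; exact h.low
lemma upp₁ : |ω| ≤ 2 * δ := by rw [h.abs_ω]; exact h.upp
lemma low₂ : δ ≤ |-ω| := by rw [abs_neg]; exact h.low₁
lemma upp₂ : |-ω| ≤ 2 * δ := by rw [abs_neg]; exact h.upp₁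

lemma sE : SF r (stE X Y v ω) := (h.sG h.low₁ h.upp₁).add (h.sG h.low₂ h.upp₂)

lemma sF : SF r (stF X Y v ω) := by
  have h1 := h.sG h.low₁ h.upp₁
  have h2 := h.sG h.low₂ h.upp₂
  have := (SF.const r (1 / 2)).mul ((h.sK.mul h.sdlft).mul ((h1.mul h1).sub (h2.mul h2)))
  exact this.congr fun z => by simp only [stF]; push_cast; ring

lemma fc_stF : fc (stF X Y v ω) 0 = 0 := by
  have h1 := h.sG h.low₁ h.upp₁
  have h2 := h.sG h.low₂ h.upp₂
  have sm : SF r fun z => crm X Y (lft v z) := ((h.sX 0).mul (h.sY 1)).sub ((h.sY 0).mul (h.sX 1))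
  have sS := sm.mul h.sdlft
  have sT := (h.sK.mul (h1.mul h1)).mul h.sdlft
  have sT' := (h.sK.mul (h2.mul h2)).mul h.sdlft
  have sQ := (h1.mul sm).sub ((h2.shift ω).mul (sm.shift ω))
  have hz := sQ.integral_eq_zero_of_hasDerivAt
    ((sS.neg.sub sT).add ((sS.shift ω).add (sT'.shift ω))) h.hr ?_
  · have e1 := sS.integral_shift ω
    have e2 := sT'.integral_shift ω
    have i1 := sS.intervalIntegrable h.hr 0 (2 * π)
    have i2 := sT.intervalIntegrable h.hr 0 (2 * π)
    have i3 := sT'.intervalIntegrable h.hr 0 (2 * π)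
    have i4 := (sS.shift ω).intervalIntegrable h.hr 0 (2 * π)
    have i5 := (sT'.shift ω).intervalIntegrable h.hr 0 (2 * π)
    have i1' := sS.neg.intervalIntegrable h.hr 0 (2 * π)
    rw [intervalIntegral.integral_add (i1'.sub i2) (i4.add i5), intervalIntegral.integral_sub i1' i2,
      intervalIntegral.integral_neg, intervalIntegral.integral_add i4 i5, e1, e2] at hz
    rw [fc_zero]
    have : ∀ x : ℝ, stF X Y v ω x = 1 / 2 * ((stK X Y v x * (stG X Y v ω x * stG X Y v ω x) * dlft v x) -
        (stK X Y v x * (stG X Y v (-ω) x * stG X Y v (-ω) x) * dlft v x)) := fun x => by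
      simp only [stF]; ring
    simp only [this]
    rw [intervalIntegral.integral_const_mul, intervalIntegral.integral_sub i2 i3]
    linear_combination (-(1 / (2 * π) : ℂ) / 2) * hz
  · intro x
    have hx := ofReal_mem_strip h.hr x
    have m1 := h.lft_mem' hx
    have m2 := h.lft_mem' (add_ofReal_mem_strip hx ω)
    have e : ∀ z : ℂ, z + ω + (-ω : ℝ) = z := fun z => by push_cast; ring
    refine (hasDerivAt_exact (h.hasDerivAt_lft hx) (h.hasDerivAt_lft_add ω hx)
      (fun m => h.crv.dX m _ m1) (fun m => h.crv.dY m _ m1) (fun m => h.crv.dX m _ m2)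
      (fun m => h.crv.dY m _ m2) (h.crD_ne h.low₁ h.upp₁ hx)).congr_deriv ?_ |>.congr_of_eventuallyEq ?_
    · simp only [stG, stK, e]; ring
    · refine Filter.Eventually.of_forall fun z => ?_
      simp only [stG, e]

end Stp
end DualBilliard

namespace DualBilliard
namespace Stp
variable {M c C δ r ω : ℝ} {X Y : ℕ → ℂ → ℂ} {v : ℂ → ℂ} (h : Stp M c C δ r ω X Y v)
include h

lemma δ_le_one : δ ≤ 1 := by
  have := h.sm; have := h.hC; have := h.hδ
  nlinarith

lemma K_sub {z : ℂ} (hz : z ∈ strip r) : ‖stK X Y v z / c - 1‖ ≤ 1 / 20 := by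
  have h1 := h.crv.near _ (h.lft_mem' hz)
  have hc : (c : ℂ) ≠ 0 := by exact_mod_cast h.hc.ne'
  rw [show stK X Y v z / c - 1 = (kap X Y (lft v z) - c) / c by rw [sub_div, div_self hc]; rfl,
    norm_div, Complex.norm_of_nonneg h.hc.le, div_le_iff₀ h.hc]
  linarith

lemma dlft_sub {z : ℂ} (hz : z ∈ strip r) : ‖dlft v z - 1‖ ≤ 1 / 10 := by
  have := h.dv z hz
  rwa [dlft, add_sub_cancel_left]

section
variable {s : ℝ} (hs1 : δ ≤ |s|) (hs2 : |s| ≤ 2 * δ)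
include hs1 hs2

lemma G_sub {z : ℂ} (hz : z ∈ strip r) : ‖2 * stG X Y v s z / s - 1‖ ≤ 11 / 100 := by
  have h1 := (h.crBd hs1 hs2 hz).G
  have h2 := h.diff_le hz s
  have h0 := h.hδ
  have hs : 0 < |s| := h0.trans_le hs1
  have hs' : (s : ℂ) ≠ 0 := by exact_mod_cast abs_pos.1 hs
  have e : 2 * stG X Y v s z / s - 1 = (2 * (stG X Y v s z - (lft v (z + s) - lft v z) / 2) +
    (lft v (z + s) - lft v z - s)) / s := by field_simp; ring
  rw [e, norm_div, Complex.norm_real, Real.norm_eq_abs, div_le_iff₀ hs]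
  refine (norm_add_le _ _).trans ?_
  rw [norm_mul, Complex.norm_ofNat]
  have h3 : C * δ ^ 3 ≤ δ / 200 := by nlinarith [h.sm]
  have h4 : ‖stG X Y v s z - (lft v (z + s) - lft v z) / 2‖ ≤ C * δ ^ 3 := h1
  linarith

lemma Gy_sub {z : ℂ} (hz : z ∈ strip r) : ‖2 * stGy X Y v s z - 1‖ ≤ 1 / 100 := by
  have h1 : ‖stGy X Y v s z - 1 / 2‖ ≤ C * δ ^ 2 := (h.crBd hs1 hs2 hz).Gy
  have h3 := h.sm
  rw [show 2 * stGy X Y v s z - 1 = 2 * (stGy X Y v s z - 1 / 2) by ring, norm_mul, Complex.norm_ofNat]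
  linarith

lemma norm_G_le {z : ℂ} (hz : z ∈ strip r) : ‖stG X Y v s z‖ ≤ 111 / 100 * δ := by
  have h1 := norm_le_of_sub_one (h.G_sub hs1 hs2 hz)
  rw [norm_div, norm_mul, Complex.norm_ofNat, Complex.norm_real, Real.norm_eq_abs,
    div_le_iff₀ (h.hδ.trans_le hs1)] at h1
  linarith

lemma norm_G_ge {z : ℂ} (hz : z ∈ strip r) : 89 / 200 * δ ≤ ‖stG X Y v s z‖ := by
  have h1 := norm_ge_of_sub_one (h.G_sub hs1 hs2 hz)
  rw [norm_div, norm_mul, Complex.norm_ofNat, Complex.norm_real, Real.norm_eq_abs,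
    le_div_iff₀ (h.hδ.trans_le hs1)] at h1
  linarith

lemma B_sub {z : ℂ} (hz : z ∈ strip r) : ‖stB X Y v s z / (c * s / 4) - 1‖ ≤ 1 / 2 := by
  have hc : (c : ℂ) ≠ 0 := by exact_mod_cast h.hc.ne'
  have hs' : (s : ℂ) ≠ 0 := by exact_mod_cast abs_pos.1 (h.hδ.trans_le hs1)
  have := norm_mul_sub_one_le (norm_mul_sub_one_le (norm_mul_sub_one_le (norm_mul_sub_one_le (h.K_sub hz)
    (h.G_sub hs1 hs2 hz)) (h.Gy_sub hs1 hs2 hz)) (h.dlft_sub hz)) (h.dlft_sub (add_ofReal_mem_strip hz s))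
  refine (le_of_eq ?_).trans (this.trans (by norm_num))
  congr 2
  simp only [stB]
  field_simp
  ring

lemma norm_B_ge {z : ℂ} (hz : z ∈ strip r) : c * δ / 8 ≤ ‖stB X Y v s z‖ := by
  have h1 := norm_ge_of_sub_one (h.B_sub hs1 hs2 hz)
  have h2 := h.hc
  have h3 := h.hδ.trans_le hs1
  rw [norm_div, norm_div, norm_mul, Complex.norm_ofNat, Complex.norm_of_nonneg h2.le, Complex.norm_real,
    Real.norm_eq_abs, le_div_iff₀ (by positivity)] at h1
  nlinarith

lemma B_ne {z : ℂ} (hz : z ∈ strip r) : stB X Y v s z ≠ 0 := by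
  have h1 := h.norm_B_ge hs1 hs2 hz
  have h2 := h.hc
  have h3 := h.hδ
  exact norm_pos_iff.1 ((by positivity : 0 < c * δ / 8).trans_le h1)

end

lemma norm_F_le {e : ℝ} {z : ℂ} (hz : z ∈ strip r) (he : ‖stE X Y v ω z‖ ≤ e) :
    ‖stF X Y v ω z‖ ≤ 2 * c * δ * e := by
  have e1 : stF X Y v ω z = c * (stK X Y v z / c) * dlft v z * stE X Y v ω z *
      ((stG X Y v ω z - stG X Y v (-ω) z) / 2) := by
    have hc : (c : ℂ) ≠ 0 := by exact_mod_cast h.hc.ne'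
    simp only [stF, stE]; field_simp; ring
  have a1 := norm_le_of_sub_one (h.K_sub hz)
  have a2 := norm_le_of_sub_one (h.dlft_sub hz)
  have a3 : ‖(stG X Y v ω z - stG X Y v (-ω) z) / 2‖ ≤ 111 / 100 * δ := by
    rw [norm_div, Complex.norm_ofNat]
    have := norm_sub_le (stG X Y v ω z) (stG X Y v (-ω) z)
    have := h.norm_G_le h.low₁ h.upp₁ hz
    have := h.norm_G_le h.low₂ h.upp₂ hz
    linarith
  have h0 := h.hδ; have hc := h.hc
  have he0 := (norm_nonneg _).trans he
  rw [e1, norm_mul, norm_mul, norm_mul, norm_mul, Complex.norm_of_nonneg hc.le]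
  calc _ ≤ c * (1 + 1 / 20) * (1 + 1 / 10) * e * (111 / 100 * δ) := by gcongr
    _ ≤ _ := by nlinarith [mul_nonneg (mul_nonneg hc.le h0.le) he0]

/-- Adding a suitable constant makes the second cohomological equation solvable. -/
lemma exists_mean_zero {P : ℂ → ℂ} {R A : ℝ} (hR : 0 < R) (hRr : R ≤ r) (hP : SF R P)
    (hA : ∀ z ∈ strip R, ‖P z‖ ≤ A) :
    ∃ s : ℝ, |s| ≤ 3 * A ∧ fc (fun z => (P (z + ω) + s) / stB X Y v ω z) 0 = 0 := by
  have hsub := strip_mono hRr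
  have hω : 0 < ω := h.hδ.trans_le h.low
  have hc := h.hc
  set b : ℂ → ℂ := fun z => (c * ω / 4) / stB X Y v ω z with hb
  have hcω : ((c : ℂ) * ω / 4) ≠ 0 := by
    have : c * ω / 4 ≠ 0 := by positivity
    exact_mod_cast this
  have sb : SF R b := ((SF.const R (c * ω / 4)).div ((h.sB h.low₁ h.upp₁).mono hRr)
    fun z hz => h.B_ne h.low₁ h.upp₁ (hsub hz)).congr fun z => by simp [hb]
  have sPb := (hP.shift ω).mul sb
  set q := ∫ x in (0:ℝ)..(2 * π), (P (x + ω) * b x) with hq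
  set Q := ∫ x in (0:ℝ)..(2 * π), b x with hQ
  have hbx : ∀ x : ℝ, 2 / 3 ≤ (b x).re ∧ (b x).re ≤ 2 := by
    intro x
    have h1 := h.B_sub h.low₁ h.upp₁ (ofReal_mem_strip h.hr x)
    rw [show stB X Y v ω x / (c * ω / 4) = (b x)⁻¹ by simp [hb], ← sb.ofReal_re x, ← Complex.ofReal_inv] at h1
    have h2 : |((b x).re)⁻¹ - 1| ≤ 1 / 2 := by
      have : ((((b x).re)⁻¹ - 1 : ℝ) : ℂ) = (((b x).re)⁻¹ : ℝ) - 1 := by push_cast; rfl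
      rwa [← this, Complex.norm_real, Real.norm_eq_abs] at h1
    rw [abs_le] at h2
    set t := (b x).re
    have h3 : 0 < t⁻¹ := by linarith
    have h4 : 0 < t := inv_pos.1 h3
    have h5 : t * t⁻¹ = 1 := mul_inv_cancel₀ h4.ne'
    constructor <;> nlinarith
  have eq : ∀ {f : ℂ → ℂ}, SF R f → ∫ x in (0:ℝ)..(2 * π), f x =
      ((∫ x in (0:ℝ)..(2 * π), (f x).re : ℝ) : ℂ) := fun {f} hf => by
    rw [← intervalIntegral.integral_ofReal]
    simp only [hf.ofReal_re]
  have q1 : ‖q‖ ≤ (A * 2) * |2 * π - 0| := by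
    refine intervalIntegral.norm_integral_le_of_norm_le_const fun x _ => ?_
    rw [norm_mul]
    have h1 := hA _ (add_ofReal_mem_strip (ofReal_mem_strip hR x) ω)
    have h2 : ‖b x‖ ≤ 2 := by
      rw [← sb.ofReal_re, Complex.norm_real, Real.norm_eq_abs, abs_le]
      have := hbx x; constructor <;> linarith
    have := (norm_nonneg _).trans h1
    gcongr
  have Q1 : (2 * π) * (2 / 3) ≤ ∫ x in (0:ℝ)..(2 * π), (b x).re := by
    have hcont : Continuous fun x : ℝ => (b x).re :=
      Complex.continuous_re.comp (sb.continuous_ofReal hR)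
    have := intervalIntegral.integral_mono_on (by positivity : (0:ℝ) ≤ 2 * π)
      ((continuous_const (y := (2:ℝ) / 3)).intervalIntegrable (μ := volume) _ _) (hcont.intervalIntegrable _ _) (fun x _ => (hbx x).1)
    rwa [intervalIntegral.integral_const, sub_zero, smul_eq_mul] at this
  rw [eq sb] at hQ
  rw [eq sPb] at hq
  set q' := ∫ x in (0:ℝ)..(2 * π), (P (x + ω) * b x).re
  set Q' := ∫ x in (0:ℝ)..(2 * π), (b x).re
  have hπ := Real.pi_pos
  have hQ0 : 0 < Q' := lt_of_lt_of_le (by positivity) Q1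
  refine ⟨-(q' / Q'), ?_, ?_⟩
  · rw [abs_neg, abs_div, abs_of_pos hQ0, div_le_iff₀ hQ0]
    rw [hq, Complex.norm_real, Real.norm_eq_abs, sub_zero,
      abs_of_pos (by positivity : 0 < 2 * π)] at q1
    have hA0 : 0 ≤ A := (norm_nonneg _).trans (hA _ (ofReal_mem_strip hR 0))
    nlinarith
  · rw [fc_zero]
    have : ∀ x : ℝ, (P (x + ω) + (-(q' / Q') : ℝ)) / stB X Y v ω x =
        (c * ω / 4 : ℂ)⁻¹ * (P (x + ω) * b x - (q' / Q' : ℂ) * b x) := by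
      intro x
      have := h.B_ne h.low₁ h.upp₁ (ofReal_mem_strip h.hr x)
      have hc' : (c : ℂ) ≠ 0 := by exact_mod_cast hc.ne'
      have hω' : (ω : ℂ) ≠ 0 := by exact_mod_cast hω.ne'
      simp only [hb]
      push_cast
      field_simp
      ring
    simp only [this]
    rw [intervalIntegral.integral_const_mul, intervalIntegral.integral_sub (sPb.intervalIntegrable hR _ _)
      ((sb.intervalIntegrable hR _ _).const_mul _), intervalIntegral.integral_const_mul, eq sb, eq sPb]
    have : (Q' : ℂ) ≠ 0 := by exact_mod_cast hQ0.ne'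
    rw [div_mul_cancel₀ _ this, sub_self, mul_zero, mul_zero]

end Stp
end DualBilliard

namespace DualBilliard
namespace Stp
variable {M c C δ r ω : ℝ} {X Y : ℕ → ℂ → ℂ} {v : ℂ → ℂ} (h : Stp M c C δ r ω X Y v)
include h

/-- Solution of the linearized equation up to terms of second order. -/
lemma exists_correction {Θ e : ℝ} (hD : Dio (r / 8) ω Θ) (he : ∀ z ∈ strip r, ‖stE X Y v ω z‖ ≤ e) :
    ∃ P η : ℂ → ℂ, SF (6 / 8 * r) η ∧ (∀ z ∈ strip (7 / 8 * r), ‖P z‖ ≤ 8 * c * δ * e * Θ) ∧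
      (∀ z ∈ strip (7 / 8 * r), P (z + ω) - P z = -stF X Y v ω z) ∧
      (∀ z ∈ strip (6 / 8 * r), η (z + ω) - η z = P (z + ω) / stB X Y v ω z) ∧
      ∀ z ∈ strip (6 / 8 * r), ‖η z‖ ≤ 64 * e * Θ ^ 2 := by
  have hr := h.hr
  have hc := h.hc
  have hδ := h.hδ
  have he0 : 0 ≤ e := (norm_nonneg _).trans (he _ (ofReal_mem_strip hr 0))
  obtain ⟨P₀, sP, eP, bP⟩ := h.sF.neg.exists_coboundary (R' := 7 / 8 * r) (T := Θ) (M := 2 * c * δ * e)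
    (fun z hz => by rw [norm_neg]; exact h.norm_F_le hz (he z hz))
    (by
      have := h.fc_stF
      rw [fc_zero] at this ⊢
      rw [intervalIntegral.integral_neg, mul_neg, this, neg_zero]) (by linarith) (by linarith)
    (by convert hD using 1; ring)
  obtain ⟨s, hs, hm⟩ := h.exists_mean_zero (by linarith) (by linarith) sP bP
  have sPs := sP.add (SF.const _ s)
  have hsub : strip (7 / 8 * r) ⊆ strip r := strip_mono (by linarith)
  have bPs : ∀ z ∈ strip (7 / 8 * r), ‖P₀ z + s‖ ≤ 8 * c * δ * e * Θ := fun z hz => by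
    refine (norm_add_le _ _).trans ?_
    have := bP z hz
    rw [Complex.norm_real, Real.norm_eq_abs]; linarith
  have sq := (sPs.shift ω).div ((h.sB h.low₁ h.upp₁).mono (by linarith : 7 / 8 * r ≤ r))
    fun z hz => h.B_ne h.low₁ h.upp₁ (hsub hz)
  obtain ⟨η, sη, eη, bη⟩ := sq.exists_coboundary (R' := 6 / 8 * r) (T := Θ) (M := 64 * e * Θ)
    (fun z hz => by
      have h1 := h.norm_B_ge h.low₁ h.upp₁ (hsub hz)
      have h2 := bPs _ (add_ofReal_mem_strip hz ω)
      have h3 : 0 ≤ 64 * (e * Θ) := by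
        have h4 := (norm_nonneg _).trans h2
        by_contra h5
        have : 8 * c * δ * e * Θ = (c * δ / 8) * (64 * (e * Θ)) := by ring
        rw [this] at h4
        have h6 : 0 < c * δ / 8 := by positivity
        nlinarith
      rw [norm_div, div_le_iff₀ (lt_of_lt_of_le (by positivity) h1)]
      nlinarith) hm (by linarith) (by linarith) (by convert hD using 1; ring)
  exact ⟨fun z => P₀ z + s, η, sη, bPs, fun z hz => by rw [← eP z hz]; ring, eη,
    fun z hz => (bη z hz).trans (by rw [pow_two, mul_assoc])⟩

/-- One step of the Newton iteration. -/
theorem step {Θ e : ℝ} (hD : Dio (r / 8) ω Θ) (hΘ : 1 ≤ r * Θ)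
    (he : ∀ z ∈ strip r, ‖stE X Y v ω z‖ ≤ e) (hsm : 800 * Θ ^ 2 * e ≤ r) :
    ∃ w, SF (r / 2) w ∧ (∀ z ∈ strip (r / 2), ‖w z‖ ≤ 80 * Θ ^ 2 * e ∧
      ‖deriv w z‖ ≤ 800 * Θ ^ 2 * e / r) ∧
      ∀ z ∈ strip (r / 2), ‖stE X Y (fun z => v z + w z) ω z‖ ≤ 60000 * C * δ * Θ ^ 4 * e ^ 2 := by
  have hr := h.hr
  have hc := h.hc
  have hδ := h.hδ
  have hδ1 := h.δ_le_one
  have hrδ := h.hrδ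
  have hC := h.hC
  have he0 : 0 ≤ e := (norm_nonneg _).trans (he _ (ofReal_mem_strip hr 0))
  have hΘ0 : 0 < Θ := pos_of_mul_pos_right (one_pos.trans_le hΘ) hr.le
  obtain ⟨P, η, sη, bP, eP, eη, bη⟩ := h.exists_correction hD he
  have hsub6 : strip (6 / 8 * r) ⊆ strip r := strip_mono (by linarith)
  have hsub7 : strip (6 / 8 * r) ⊆ strip (7 / 8 * r) := strip_mono (by linarith)
  have hsub : strip (r / 2) ⊆ strip (6 / 8 * r) := strip_mono (by linarith)
  have sw := (h.sdlft.mono (by linarith : 6 / 8 * r ≤ r)).mul sη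
  set w : ℂ → ℂ := fun z => dlft v z * η z with hw
  have bw : ∀ z ∈ strip (6 / 8 * r), ‖w z‖ ≤ 80 * Θ ^ 2 * e := fun z hz => by
    have h1 := norm_le_of_sub_one (h.dlft_sub (hsub6 hz))
    have h2 := bη z hz
    rw [hw]; dsimp only
    rw [norm_mul]
    calc _ ≤ (1 + 1 / 10) * (64 * e * Θ ^ 2) := by gcongr
      _ ≤ _ := by nlinarith [mul_nonneg he0 (sq_nonneg Θ)]
  refine ⟨w, sw.mono (by linarith), fun z hz => ⟨bw z (hsub hz), ?_⟩, fun z hz => ?_⟩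
  · refine (sw.norm_deriv_le bw (by positivity : 0 < r / 8) (by linarith) hz).trans ?_
    rw [div_div_eq_mul_div]
    refine div_le_div_of_nonneg_right ?_ hr.le
    nlinarith [mul_nonneg he0 (sq_nonneg Θ)]
  have z6 := hsub hz
  have zr := hsub6 z6
  have zp := add_ofReal_mem_strip zr ω
  have zm := add_ofReal_mem_strip zr (-ω)
  -- second order Taylor expansions
  have bwr : 80 * Θ ^ 2 * e ≤ r / 10 := by linarith
  have tay : ∀ s : ℝ, δ ≤ |s| → |s| ≤ 2 * δ → ‖stG X Y (fun z => v z + w z) s z - stG X Y v s z -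
      stGx X Y v s z * w z - stGy X Y v s z * w (z + s)‖ ≤ C * δ * (160 * Θ ^ 2 * e) ^ 2 := by
    intro s hs1 hs2
    have zs := add_ofReal_mem_strip hz s
    have b1 := bw z z6
    have b2 := bw _ (hsub zs)
    have m : ∀ {z : ℂ}, z ∈ strip (r / 2) → lft v z + w z ∈ strip (2 * r) := fun {z} hz => by
      have h1 : |z.im| < r / 2 := hz
      refine mem_strip_of_norm_sub_le (s := r / 10) (h.lft_mem (hsub6 (hsub hz))) ?_ (by linarith)
      rw [add_sub_cancel_left]
      exact (bw z (hsub hz)).trans bwr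
    have h1 := h.diff_low hs1 zr
    have h2 := h.diff_upp hs2 zr
    have := h.crv.taylor hδ h.bd (h.lft_mem' zr) (h.lft_mem' (hsub6 (hsub zs))) (m hz) (m zs)
      (by linarith) (by linarith)
    have e1 : ∀ z, lft (fun z => v z + w z) z = lft v z + w z := fun z => by simp only [lft]; ring
    simp only [stG, e1]
    refine this.trans ?_
    gcongr
    linarith
  have t1 := tay ω h.low₁ h.upp₁
  have t2 := tay (-ω) h.low₂ h.upp₂
  -- the linear part
  set E := stE X Y v ω z with hE
  set Ex := deriv (stE X Y v ω) z with hEx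
  have hEx' : Ex = (stGx X Y v ω z + stGx X Y v (-ω) z) * dlft v z +
      stGy X Y v ω z * dlft v (z + ω) + stGy X Y v (-ω) z * dlft v (z + (-ω : ℝ)) := by
    have := ((h.hasDerivAt_G h.low₁ h.upp₁ zr).add (h.hasDerivAt_G h.low₂ h.upp₂ zr)).deriv
    rw [hEx]
    refine Eq.trans ?_ (this.trans (by ring))
    rfl
  have n1 := norm_pos_iff.1 (lt_of_lt_of_le (by positivity) (h.norm_G_ge h.low₁ h.upp₁ zr))
  have n2 := norm_pos_iff.1 (lt_of_lt_of_le (by positivity) (h.norm_G_ge h.low₂ h.upp₂ zr))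
  have n3 := h.B_ne h.low₁ h.upp₁ zr
  have n4 := h.B_ne h.low₂ h.upp₂ zr
  have e1 : η (z + ω) - η z = P (z + ω) / stB X Y v ω z := eη z z6
  have e2 : η (z + (-ω : ℝ)) - η z = P z / stB X Y v (-ω) z := by
    have := eη _ (add_ofReal_mem_strip z6 (-ω))
    rw [stB_swap, show z + (-ω : ℝ) + ω = z by push_cast; ring, div_neg] at this
    linear_combination -this
  have e3 := eP z (hsub7 z6)
  have hK : stK X Y v z ≠ 0 := fun h0 => n3 (by simp [stB, h0])
  have hu : dlft v z ≠ 0 := fun h0 => n3 (by simp [stB, h0])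
  have lin : E + (stGx X Y v ω z * w z + stGy X Y v ω z * w (z + ω)) +
      (stGx X Y v (-ω) z * w z + stGy X Y v (-ω) z * w (z + (-ω : ℝ))) =
      η z * Ex + P z * E / (stG X Y v ω z * stG X Y v (-ω) z * (stK X Y v z * dlft v z)) +
        E ^ 2 / (2 * stG X Y v ω z) := by
    have f1 : stGy X Y v ω z * dlft v (z + ω) * (η (z + ω) - η z) =
        P (z + ω) / (stK X Y v z * stG X Y v ω z * dlft v z) := by
      rw [e1, mul_div_assoc', div_eq_div_iff n3 (mul_ne_zero (mul_ne_zero hK n1) hu)]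
      simp only [stB]; ring
    have f2 : stGy X Y v (-ω) z * dlft v (z + (-ω : ℝ)) * (η (z + (-ω : ℝ)) - η z) =
        P z / (stK X Y v z * stG X Y v (-ω) z * dlft v z) := by
      rw [e2, mul_div_assoc', div_eq_div_iff n4 (mul_ne_zero (mul_ne_zero hK n2) hu)]
      simp only [stB]; ring
    have f3 : P (z + ω) / (stK X Y v z * stG X Y v ω z * dlft v z) +
        P z / (stK X Y v z * stG X Y v (-ω) z * dlft v z) + E =
        P z * E / (stG X Y v ω z * stG X Y v (-ω) z * (stK X Y v z * dlft v z)) +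
        E ^ 2 / (2 * stG X Y v ω z) := by
      rw [show P (z + ω) = P z - stF X Y v ω z by linear_combination e3, hE]
      simp only [stF, stE]
      field_simp
      ring
    rw [← sub_eq_zero] at f3 ⊢
    rw [hEx', hw]
    dsimp only
    linear_combination f3 + f1 + f2
  have key : stE X Y (fun z => v z + w z) ω z = η z * Ex +
      P z * E / (stG X Y v ω z * stG X Y v (-ω) z * (stK X Y v z * dlft v z)) +
        E ^ 2 / (2 * stG X Y v ω z) + (stG X Y (fun z => v z + w z) ω z - stG X Y v ω z -
      stGx X Y v ω z * w z - stGy X Y v ω z * w (z + ω)) +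
      (stG X Y (fun z => v z + w z) (-ω) z - stG X Y v (-ω) z -
      stGx X Y v (-ω) z * w z - stGy X Y v (-ω) z * w (z + (-ω : ℝ))) := by
    rw [← lin, hE]; simp only [stE]; ring
  -- estimates
  have hδΘ : 1 ≤ δ * Θ := hΘ.trans (by gcongr)
  have hΘ1 : 1 ≤ Θ := hδΘ.trans (by nlinarith)
  have u1 : ‖η z * Ex‖ ≤ 128 * (δ * Θ ^ 4 * e ^ 2) := by
    have a1 := bη z z6
    have a2 : ‖Ex‖ ≤ e / (r / 2) := h.sE.norm_deriv_le he (by positivity) (by linarith) hz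
    rw [norm_mul]
    have a3 : e / (r / 2) ≤ 2 * Θ * e := by
      rw [div_le_iff₀ (by positivity)]; nlinarith
    calc _ ≤ (64 * e * Θ ^ 2) * (2 * Θ * e) := by gcongr; exact a2.trans a3
      _ = 128 * (1 * Θ ^ 3 * e ^ 2) := by ring
      _ ≤ 128 * ((δ * Θ) * Θ ^ 3 * e ^ 2) := by gcongr
      _ = _ := by ring
  have g1 := h.norm_G_ge h.low₁ h.upp₁ zr
  have g2 := h.norm_G_ge h.low₂ h.upp₂ zr
  have hEe := he z zr
  have u2 : ‖P z * E / (stG X Y v ω z * stG X Y v (-ω) z * (stK X Y v z * dlft v z))‖ ≤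
      80 * (δ * Θ ^ 4 * e ^ 2) := by
    have a1 := bP z (hsub7 z6)
    have a2 := norm_ge_of_sub_one (h.K_sub zr)
    have a3 := norm_ge_of_sub_one (h.dlft_sub zr)
    rw [norm_div, Complex.norm_of_nonneg hc.le, le_div_iff₀ hc] at a2
    rw [norm_div, norm_mul, norm_mul, norm_mul, norm_mul]
    calc _ ≤ (8 * c * δ * e * Θ) * e / ((89 / 200 * δ) * (89 / 200 * δ) *
          (((1 - 1 / 20) * c) * (1 - 1 / 10))) := by
            have := (norm_nonneg _).trans a1
            gcongr
      _ ≤ 80 * (e ^ 2 * Θ / δ) := by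
        rw [div_le_iff₀ (by positivity)]
        have : 80 * (e ^ 2 * Θ / δ) * (89 / 200 * δ * (89 / 200 * δ) * ((1 - 1 / 20) * c * (1 - 1 / 10))) =
          (80 * (89 / 200) ^ 2 * (1 - 1 / 20) * (1 - 1 / 10)) * (c * δ * e * Θ * e) := by
          field_simp
        rw [this]
        have : 0 ≤ c * δ * e * Θ * e := by positivity
        nlinarith
      _ ≤ _ := by
        gcongr
        rw [div_le_iff₀ hδ]
        have : e ^ 2 * Θ * 1 ≤ e ^ 2 * Θ * ((δ * Θ) ^ 2 * Θ) := by
          gcongr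
          nlinarith [mul_le_mul hδΘ hδΘ zero_le_one (by linarith)]
        linarith
  have u3 : ‖E ^ 2 / (2 * stG X Y v ω z)‖ ≤ 2 * (δ * Θ ^ 4 * e ^ 2) := by
    rw [norm_div, norm_pow, norm_mul, Complex.norm_ofNat]
    calc _ ≤ e ^ 2 / (2 * (89 / 200 * δ)) := by gcongr
      _ ≤ 2 * (e ^ 2 * Θ) := by
        rw [div_le_iff₀ (by positivity)]
        nlinarith [mul_le_mul_of_nonneg_left hδΘ (sq_nonneg e)]
      _ ≤ 2 * (e ^ 2 * Θ * ((δ * Θ) * (Θ * Θ))) := by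
        have : 1 ≤ (δ * Θ) * (Θ * Θ) := by
          nlinarith [mul_le_mul hδΘ (mul_le_mul hΘ1 hΘ1 zero_le_one hΘ0.le) (by norm_num) (by linarith)]
        have h0 : 0 ≤ e ^ 2 * Θ := by positivity
        nlinarith
      _ = _ := by ring
  rw [key]
  have hX : 0 ≤ δ * Θ ^ 4 * e ^ 2 := by positivity
  calc _ ≤ 128 * (δ * Θ ^ 4 * e ^ 2) + 80 * (δ * Θ ^ 4 * e ^ 2) + 2 * (δ * Θ ^ 4 * e ^ 2) +
      C * δ * (160 * Θ ^ 2 * e) ^ 2 + C * δ * (160 * Θ ^ 2 * e) ^ 2 :=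
        (norm_add_le _ _).trans (add_le_add ((norm_add_le _ _).trans (add_le_add
          (norm_add₃_le.trans (add_le_add (add_le_add u1 u2) u3)) t1)) t2)
    _ = (210 + 51200 * C) * (δ * Θ ^ 4 * e ^ 2) := by ring
    _ ≤ (60000 * C) * (δ * Θ ^ 4 * e ^ 2) := by gcongr; linarith
    _ = _ := by ring

end Stp
end DualBilliard

namespace DualBilliard

/-- The contribution of the frequencies `±n` to the `m`-th derivative of a real trigonometric series. -/
noncomputable def tm (a : ℕ → ℂ) (m : ℕ) (z : ℂ) (n : ℕ) : ℂ :=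
  (n * Complex.I) ^ m * a n * Complex.exp (n * z * Complex.I) +
    (-(n * Complex.I)) ^ m * (starRingEnd ℂ) (a n) * Complex.exp (-(n * z * Complex.I))

/-- Truncation of a trigonometric series (`m`-th derivative). -/
noncomputable def tr (a : ℕ → ℂ) (N m : ℕ) (z : ℂ) : ℂ := ∑ n ∈ Finset.range (N + 1), tm a m z n

lemma tm_hasDerivAt (a : ℕ → ℂ) (m n : ℕ) (z : ℂ) :
    HasDerivAt (fun z => tm a m z n) (tm a (m + 1) z n) z := by
  have h1 : HasDerivAt (fun z : ℂ => (n : ℂ) * z * Complex.I) (n * Complex.I) z := by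
    simpa using ((hasDerivAt_id z).const_mul (n : ℂ)).mul_const Complex.I
  refine ((h1.cexp.const_mul _).add (h1.fun_neg.cexp.const_mul _)).congr_deriv ?_
  simp only [tm, pow_succ]
  ring

lemma tr_hasDerivAt (a : ℕ → ℂ) (N m : ℕ) (z : ℂ) : HasDerivAt (tr a N m) (tr a N (m + 1) z) z :=
  HasDerivAt.fun_sum fun n _ => tm_hasDerivAt a m n z

lemma sF_tr (a : ℕ → ℂ) (N m : ℕ) (R : ℝ) : SF R (tr a N m) := by
  refine ⟨fun z _ => (tr_hasDerivAt a N m z).differentiableAt.differentiableWithinAt, fun z => ?_, fun x => ?_⟩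
  · refine Finset.sum_congr rfl fun n _ => ?_
    have h1 : Complex.exp (n * (z + 2 * π) * Complex.I) = Complex.exp (n * z * Complex.I) :=
      Complex.exp_eq_exp_iff_exists_int.2 ⟨n, by push_cast; ring⟩
    simp only [tm, Complex.exp_neg, h1]
  · rw [← Complex.conj_eq_iff_im, tr, map_sum]
    refine Finset.sum_congr rfl fun n _ => ?_
    simp only [tm, map_add, map_mul, map_pow, map_neg, Complex.conj_I, ← Complex.exp_conj,
      Complex.conj_natCast, Complex.conj_ofReal, Complex.conj_conj]
    rw [add_comm]
    congr 3 <;> ring_nf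

section
variable {M₀ R : ℝ} {a : ℕ → ℂ} {m N N' : ℕ} {z : ℂ}

lemma norm_tm_le (ha : ∀ n, ‖a n‖ ≤ M₀ / (1 + n) ^ 7) (hz : z ∈ strip R) {n : ℕ} (hn : n * R ≤ 4) :
    ‖tm a m z n‖ ≤ 2 * rexp 4 * M₀ * (n ^ m / (1 + n) ^ 7) := by
  have hz' : |z.im| < R := hz
  have h1 : ∀ s : ℝ, |s| = 1 → ‖Complex.exp (s * (n * z * Complex.I))‖ ≤ rexp 4 := fun s hs => by
    rw [Complex.norm_exp]
    refine Real.exp_le_exp.2 ?_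
    have : (s * (n * z * Complex.I)).re = -(s * (n * z.im)) := by simp
    rw [this]
    refine (neg_le_abs _).trans ?_
    rw [abs_mul, hs, one_mul, abs_mul, Nat.abs_cast]
    refine le_trans ?_ hn
    gcongr
  have e1 := h1 1 (by simp)
  have e2 := h1 (-1) (by simp)
  rw [Complex.ofReal_one, one_mul] at e1
  rw [Complex.ofReal_neg, Complex.ofReal_one, neg_one_mul] at e2
  have hb := ha n
  refine (norm_add_le _ _).trans ?_
  simp only [norm_mul, norm_pow, norm_neg, RCLike.norm_conj, Complex.norm_I, mul_one, Complex.norm_natCast]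
  have := (norm_nonneg _).trans hb
  calc _ ≤ (n:ℝ) ^ m * (M₀ / (1 + n) ^ 7) * rexp 4 + (n:ℝ) ^ m * (M₀ / (1 + n) ^ 7) * rexp 4 := by
        gcongr
    _ = _ := by ring

lemma norm_tr_sub_le (hM : 0 ≤ M₀) (ha : ∀ n, ‖a n‖ ≤ M₀ / (1 + n) ^ 7) (hz : z ∈ strip R) (hm : m ≤ 5) (hN : 1 ≤ N)
    (hNN : N ≤ N') (hR : N' * R ≤ 4) :
    ‖tr a N' m z - tr a N m z‖ ≤ 2 * rexp 4 * M₀ / (N : ℝ) ^ (6 - m) := by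
  have hR0 : 0 < R := (abs_nonneg _).trans_lt hz
  rw [tr, tr, ← Finset.sum_Ico_eq_sub _ (by omega)]
  have hN0 : (0:ℝ) < N := by exact_mod_cast hN
  have h1 : ∀ n ∈ Finset.Ioc N N', ‖tm a m z n‖ ≤
      2 * rexp 4 * M₀ / (N:ℝ) ^ (5 - m) * ((n:ℝ) ^ 2)⁻¹ := by
    intro n hn
    rw [Finset.mem_Ioc] at hn
    have hn1 : (N:ℝ) ≤ n := by exact_mod_cast hn.1.le
    have hn2 : (n:ℝ) ≤ N' := by exact_mod_cast hn.2
    have hn0 : (0:ℝ) < n := hN0.trans_le hn1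
    refine (norm_tm_le ha hz (le_trans (by gcongr) hR)).trans ?_
    have : (n:ℝ) ^ m / (1 + n) ^ 7 ≤ ((N:ℝ) ^ (5 - m))⁻¹ * ((n:ℝ) ^ 2)⁻¹ := by
      calc (n:ℝ) ^ m / (1 + n) ^ 7 ≤ (n:ℝ) ^ m / n ^ 7 := by gcongr; linarith
        _ = ((n:ℝ) ^ (5 - m))⁻¹ * ((n:ℝ) ^ 2)⁻¹ := by
          rw [← mul_inv, ← pow_add, div_eq_iff (by positivity), eq_comm, inv_mul_eq_iff_eq_mul₀ (by positivity),
            ← pow_add]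
          congr 1; omega
        _ ≤ _ := by gcongr
    calc _ ≤ 2 * rexp 4 * M₀ * (((N:ℝ) ^ (5 - m))⁻¹ * ((n:ℝ) ^ 2)⁻¹) := by gcongr
      _ = _ := by ring
  have h2 : Finset.Ico (N + 1) (N' + 1) = Finset.Ioc N N' := by ext; simp only [Finset.mem_Ico, Finset.mem_Ioc]; omega
  rw [h2]
  refine (norm_sum_le_of_le _ h1).trans ?_
  rw [← Finset.mul_sum]
  have h3 := sum_Ioc_inv_sq_le_sub (α := ℝ) (by omega : N ≠ 0) hNN
  have h4 : (0:ℝ) ≤ (N':ℝ)⁻¹ := by positivity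
  calc _ ≤ 2 * rexp 4 * M₀ / (N:ℝ) ^ (5 - m) * (N:ℝ)⁻¹ := by gcongr; linarith
    _ = _ := by rw [show 6 - m = (5 - m) + 1 by omega, pow_succ]; field_simp

lemma norm_tr_le (hM : 0 ≤ M₀) (ha : ∀ n, ‖a n‖ ≤ M₀ / (1 + n) ^ 7) (hz : z ∈ strip R) (hm : m ≤ 5)
    (hN : 1 ≤ N) (hR : N * R ≤ 4) : ‖tr a N m z‖ ≤ 6 * rexp 4 * M₀ := by
  have hR0 : 0 < R := (abs_nonneg _).trans_lt hz
  have h1 := norm_tr_sub_le hM ha hz hm le_rfl hN hR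
  have hR1 : ((1:ℕ):ℝ) * R ≤ 4 := le_trans (by gcongr) hR
  have h2 : ‖tr a 1 m z‖ ≤ 2 * (2 * rexp 4 * M₀) := by
    rw [tr, Finset.sum_range_succ, Finset.sum_range_one]
    have b0 := norm_tm_le (m := m) ha hz (n := 0) (by norm_num)
    have b1 := norm_tm_le (m := m) ha hz (n := 1) hR1
    have hA : 0 ≤ 2 * rexp 4 * M₀ := by positivity
    have c0 : (((0:ℕ):ℝ) ^ m / (1 + ((0:ℕ):ℝ)) ^ 7) ≤ 1 := by
      rcases Nat.eq_zero_or_pos m with rfl | h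
      · norm_num
      · simp [h.ne']
    have c1 : (((1:ℕ):ℝ) ^ m / (1 + ((1:ℕ):ℝ)) ^ 7) ≤ 1 := by norm_num
    have := norm_add_le (tm a m z 0) (tm a m z 1)
    nlinarith [mul_le_mul_of_nonneg_left c0 hA, mul_le_mul_of_nonneg_left c1 hA]
  have := norm_sub_norm_le (tr a N m z) (tr a 1 m z)
  simp only [Nat.cast_one, one_pow, div_one] at h1
  linarith
end

/-- A real function with `x m` its `m`-th derivative, given by a Fourier series with decaying coefficients. -/
structure Cf (M₀ : ℝ) (a : ℕ → ℂ) (x : ℕ → ℝ → ℝ) : Prop where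
  bd : ∀ n, ‖a n‖ ≤ M₀ / (1 + n) ^ 7
  hs : ∀ m ≤ 5, ∀ t : ℝ, HasSum (tm a m t) (x m t : ℂ)
  der : ∀ m < 5, ∀ t : ℝ, HasDerivAt (x m) (x (m + 1) t) t

namespace Cf
variable {M₀ : ℝ} {a : ℕ → ℂ} {x : ℕ → ℝ → ℝ} (h : Cf M₀ a x)
include h

lemma M_nonneg : 0 ≤ M₀ := by simpa using (norm_nonneg _).trans (h.bd 0)

lemma tendsto {m : ℕ} (hm : m ≤ 5) (t : ℝ) :
    Filter.Tendsto (fun N => tr a N m t) Filter.atTop (nhds (x m t : ℂ)) :=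
  (h.hs m hm t).tendsto_sum_nat.comp (Filter.tendsto_add_atTop_nat 1)

lemma norm_sub_le {m N : ℕ} (hm : m ≤ 5) (hN : 1 ≤ N) (t : ℝ) :
    ‖(x m t : ℂ) - tr a N m t‖ ≤ 2 * rexp 4 * M₀ / (N : ℝ) ^ (6 - m) := by
  refine le_of_tendsto ((h.tendsto hm t).sub_const _).norm ?_
  filter_upwards [Filter.eventually_ge_atTop N] with N' hN'
  have h0 : (0:ℝ) < N' := by exact_mod_cast (by omega : 0 < N')
  exact norm_tr_sub_le (R := 4 / N') h.M_nonneg h.bd (ofReal_mem_strip (by positivity) t) hm hN hN'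
    (by field_simp; rfl)

lemma abs_le {m : ℕ} (hm : m ≤ 5) (t : ℝ) : ‖(x m t : ℂ)‖ ≤ 6 * rexp 4 * M₀ := by
  refine le_of_tendsto (h.tendsto hm t).norm ?_
  filter_upwards [Filter.eventually_ge_atTop 1] with N' hN'
  have h0 : (0:ℝ) < N' := by exact_mod_cast (by omega : 0 < N')
  exact norm_tr_le (R := 4 / N') h.M_nonneg h.bd (ofReal_mem_strip (by positivity) t) hm hN'
    (by field_simp; rfl)

end Cf
end DualBilliard

namespace DualBilliard

lemma norm_mul_sub_mul_le {a b a' b' : ℂ} {L e : ℝ} (ha : ‖a - a'‖ ≤ e) (hb : ‖b - b'‖ ≤ e)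
    (hL : ‖b‖ ≤ L) (hL' : ‖a'‖ ≤ L) : ‖a * b - a' * b'‖ ≤ 2 * L * e := by
  have h1 : a * b - a' * b' = (a - a') * b + a' * (b - b') := by ring
  have h2 := (norm_nonneg _).trans ha
  have h3 := (norm_nonneg _).trans hL
  rw [h1]
  refine (norm_add_le _ _).trans ?_
  rw [norm_mul, norm_mul]
  calc _ ≤ e * L + L * e := by gcongr
    _ = _ := by ring

section
variable {M₀ c : ℝ} {a b : ℕ → ℂ} {x y : ℕ → ℝ → ℝ} (hx : Cf M₀ a x) (hy : Cf M₀ b y)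
  (hk : ∀ t, x 1 t * y 2 t - y 1 t * x 2 t = c)
include hx hy hk

lemma kappa_deriv (t : ℝ) : x 1 t * y 3 t - y 1 t * x 3 t = 0 := by
  have h1 := ((hx.der 1 (by norm_num) t).mul (hy.der 2 (by norm_num) t)).sub
    ((hy.der 1 (by norm_num) t).mul (hx.der 2 (by norm_num) t))
  have h2 : HasDerivAt (fun t => x 1 t * y 2 t - y 1 t * x 2 t) 0 t := by
    simp only [hk]; exact hasDerivAt_const t c
  have := h1.unique h2
  norm_num at this
  linarith

lemma kappa_deriv₂ (t : ℝ) : x 2 t * y 3 t + x 1 t * y 4 t - y 2 t * x 3 t - y 1 t * x 4 t = 0 := by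
  have h1 := ((hx.der 1 (by norm_num) t).mul (hy.der 3 (by norm_num) t)).sub
    ((hy.der 1 (by norm_num) t).mul (hx.der 3 (by norm_num) t))
  have h2 : HasDerivAt (fun t => x 1 t * y 3 t - y 1 t * x 3 t) 0 t := by
    simp only [kappa_deriv hx hy hk]; exact hasDerivAt_const t 0
  have := h1.unique h2
  norm_num at this
  linarith

lemma exists_crv_tr (hc : 0 < c) : ∃ M δ₀ : ℝ, 0 ≤ M ∧ 0 < δ₀ ∧ ∀ (δ r : ℝ) (N : ℕ), 0 < r → r ≤ δ → δ ≤ δ₀ →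
    1 ≤ N * r → N * r ≤ 2 → Crv M c δ (2 * r) (tr a N) (tr b N) ∧
      ∀ z ∈ strip (2 * r), ‖kap' (tr a N) (tr b N) z‖ ≤ M * r ^ 2 := by
  set L := 6 * rexp 4 * M₀ with hL
  have hM := hx.M_nonneg
  have hL0 : 0 ≤ L := by positivity
  refine ⟨L + 44 * L ^ 2, min 1 (c / (20 * (92 * L ^ 2 + 1))), by positivity, by positivity, ?_⟩
  intro δ r N hr hrδ hδ hN1 hN2
  have hr1 : r ≤ 1 := hrδ.trans (hδ.trans (min_le_left _ _))
  have hrc : r ≤ c / (20 * (92 * L ^ 2 + 1)) := hrδ.trans (hδ.trans (min_le_right _ _))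
  have hr2 : r ^ 2 ≤ r := by nlinarith
  have hN : 1 ≤ N := by
    rcases Nat.eq_zero_or_pos N with rfl | h
    · norm_num at hN1
    · exact h
  have hN0 : (0:ℝ) < N := by exact_mod_cast hN
  set X := tr a N
  set Y := tr b N
  have bX : ∀ m ≤ 5, ∀ z ∈ strip (2 * r), ‖X m z‖ ≤ L := fun m hm z hz =>
    norm_tr_le hM hx.bd hz hm hN (by linarith)
  have bY : ∀ m ≤ 5, ∀ z ∈ strip (2 * r), ‖Y m z‖ ≤ L := fun m hm z hz =>
    norm_tr_le hM hy.bd hz hm hN (by linarith)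
  have tail : ∀ m ≤ 4, 2 * rexp 4 * M₀ / (N : ℝ) ^ (6 - m) ≤ L * r ^ 2 := fun m hm => by
    rw [div_le_iff₀ (by positivity)]
    have h1 : 1 ≤ r ^ 2 * (N:ℝ) ^ (6 - m) := by
      have e : 6 - m = 2 + (4 - m) := by omega
      rw [e, pow_add, ← mul_assoc, ← mul_pow]
      have h2 : (1:ℝ) ≤ (N:ℝ) ^ (4 - m) := one_le_pow₀ (by exact_mod_cast hN)
      have h3 : 1 ≤ (r * N) ^ 2 := one_le_pow₀ (by linarith)
      nlinarith
    have h2 : 2 * rexp 4 * M₀ ≤ L := by rw [hL]; nlinarith [Real.exp_pos 4, mul_nonneg (Real.exp_pos 4).le hM]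
    calc _ ≤ L * 1 := by linarith
      _ ≤ L * (r ^ 2 * (N:ℝ) ^ (6 - m)) := by gcongr
      _ = _ := by ring
  have dX : ∀ m ≤ 4, ∀ t : ℝ, ‖X m t - x m t‖ ≤ L * r ^ 2 := fun m hm t => by
    rw [norm_sub_rev]; exact (hx.norm_sub_le (by omega) hN t).trans (tail m hm)
  have dY : ∀ m ≤ 4, ∀ t : ℝ, ‖Y m t - y m t‖ ≤ L * r ^ 2 := fun m hm t => by
    rw [norm_sub_rev]; exact (hy.norm_sub_le (by omega) hN t).trans (tail m hm)
  have prod : ∀ m ≤ 4, ∀ n ≤ 4, ∀ t : ℝ, ‖X m t * Y n t - x m t * y n t‖ ≤ 2 * L ^ 2 * r ^ 2 :=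
    fun m hm n hn t => (norm_mul_sub_mul_le (dX m hm t) (dY n hn t)
      (bY n (by omega) _ (ofReal_mem_strip (by linarith) t)) (hx.abs_le (by omega) t)).trans (by
        apply le_of_eq; ring)
  have k0 : ∀ t : ℝ, ‖kap X Y t - c‖ ≤ 4 * L ^ 2 * r ^ 2 := fun t => by
    have e : kap X Y t - c = (X 1 t * Y 2 t - x 1 t * y 2 t) - (X 2 t * Y 1 t - x 2 t * y 1 t) := by
      rw [← hk t]; simp only [kap]; push_cast; ring
    rw [e]
    have := norm_sub_le (X 1 t * Y 2 t - x 1 t * y 2 t) (X 2 t * Y 1 t - x 2 t * y 1 t)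
    have := prod 1 (by norm_num) 2 (by norm_num) t
    have := prod 2 (by norm_num) 1 (by norm_num) t
    linarith
  have k1 : ∀ t : ℝ, ‖kap' X Y t‖ ≤ 4 * L ^ 2 * r ^ 2 := fun t => by
    have e : kap' X Y t = (X 1 t * Y 3 t - x 1 t * y 3 t) - (X 3 t * Y 1 t - x 3 t * y 1 t) := by
      have : ((x 1 t * y 3 t - y 1 t * x 3 t : ℝ) : ℂ) = 0 := by rw [kappa_deriv hx hy hk, Complex.ofReal_zero]
      push_cast at this
      simp only [kap']; linear_combination this
    rw [e]
    have := norm_sub_le (X 1 t * Y 3 t - x 1 t * y 3 t) (X 3 t * Y 1 t - x 3 t * y 1 t)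
    have := prod 1 (by norm_num) 3 (by norm_num) t
    have := prod 3 (by norm_num) 1 (by norm_num) t
    linarith
  set K : ℕ → ℂ → ℂ := fun m z => match m with
    | 0 => kap' X Y z
    | 1 => X 2 z * Y 3 z + X 1 z * Y 4 z - Y 2 z * X 3 z - Y 1 z * X 4 z
    | _ => 2 * (X 2 z * Y 4 z) + X 1 z * Y 5 z - 2 * (Y 2 z * X 4 z) - Y 1 z * X 5 z with hK
  have k2 : ∀ t : ℝ, ‖K 1 t‖ ≤ 8 * L ^ 2 * r ^ 2 := fun t => by
    have e : K 1 t = ((X 2 t * Y 3 t - x 2 t * y 3 t) + (X 1 t * Y 4 t - x 1 t * y 4 t)) -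
        ((X 3 t * Y 2 t - x 3 t * y 2 t) + (X 4 t * Y 1 t - x 4 t * y 1 t)) := by
      have : ((x 2 t * y 3 t + x 1 t * y 4 t - y 2 t * x 3 t - y 1 t * x 4 t : ℝ) : ℂ) = 0 := by
        rw [kappa_deriv₂ hx hy hk, Complex.ofReal_zero]
      push_cast at this
      simp only [hK]; linear_combination this
    rw [e]
    have := norm_sub_le ((X 2 t * Y 3 t - x 2 t * y 3 t) + (X 1 t * Y 4 t - x 1 t * y 4 t))
      ((X 3 t * Y 2 t - x 3 t * y 2 t) + (X 4 t * Y 1 t - x 4 t * y 1 t))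
    have := norm_add_le (X 2 t * Y 3 t - x 2 t * y 3 t) (X 1 t * Y 4 t - x 1 t * y 4 t)
    have := norm_add_le (X 3 t * Y 2 t - x 3 t * y 2 t) (X 4 t * Y 1 t - x 4 t * y 1 t)
    have := prod 2 (by norm_num) 3 (by norm_num) t
    have := prod 1 (by norm_num) 4 (by norm_num) t
    have := prod 3 (by norm_num) 2 (by norm_num) t
    have := prod 4 (by norm_num) 1 (by norm_num) t
    linarith
  have dXz := fun m z => tr_hasDerivAt a N m z
  have dYz := fun m z => tr_hasDerivAt b N m z
  have mulb : ∀ m ≤ 5, ∀ n ≤ 5, ∀ z ∈ strip (2 * r), ‖X m z * Y n z‖ ≤ L ^ 2 ∧ ‖Y m z * X n z‖ ≤ L ^ 2 := by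
    intro m hm n hn z hz
    rw [norm_mul, norm_mul, pow_two]
    exact ⟨mul_le_mul (bX m hm z hz) (bY n hn z hz) (norm_nonneg _) hL0,
      mul_le_mul (bY m hm z hz) (bX n hn z hz) (norm_nonneg _) hL0⟩
  have near_re : ∀ z ∈ strip (2 * r), ‖z - z.re‖ ≤ 2 * r := fun z hz => by
    have h1 : |z.im| < 2 * r := hz
    have h2 : z - z.re = z.im * Complex.I := by apply Complex.ext <;> simp
    rw [h2, norm_mul, Complex.norm_I, mul_one, Complex.norm_real]
    exact h1.le
  have hK' : ∀ z ∈ strip (2 * r), ‖kap' X Y z‖ ≤ 44 * L ^ 2 * r ^ 2 := by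
    intro z hz
    have h1 := norm_sub_taylor_le (X := K) (n := 2) (M := 6 * L ^ 2) (convex_strip (2 * r)) ?_ ?_
      (ofReal_mem_strip (by linarith : 0 < 2 * r) z.re) hz
    · rw [Finset.sum_range_succ, Finset.sum_range_one] at h1
      simp only [pow_zero, mul_one, pow_one, Nat.factorial, Nat.cast_one, div_one] at h1
      have h2 := near_re z hz
      have h3 : K 0 z = (K 0 z - (K 0 z.re + K 1 z.re * (z - z.re))) + K 0 z.re + K 1 z.re * (z - z.re) := by
        ring
      have h4 : ‖K 1 z.re * (z - z.re)‖ ≤ (8 * L ^ 2 * r ^ 2) * (2 * r) := by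
        rw [norm_mul]; exact mul_le_mul (k2 _) h2 (norm_nonneg _) (by positivity)
      have h5 : 6 * L ^ 2 * ‖z - z.re‖ ^ 2 ≤ 6 * L ^ 2 * (2 * r) ^ 2 := by gcongr
      have h6 := norm_add₃_le (a := K 0 z - (K 0 z.re + K 1 z.re * (z - z.re))) (b := K 0 z.re)
        (c := K 1 z.re * (z - z.re))
      rw [← h3] at h6
      have h7 := k1 z.re
      have h8 : 0 ≤ L ^ 2 * r ^ 2 := by positivity
      have h9 : (8 * L ^ 2 * r ^ 2) * (2 * r) ≤ 16 * L ^ 2 * r ^ 2 := by nlinarith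
      change ‖K 0 z‖ ≤ _
      change ‖K 0 z.re‖ ≤ _ at h7
      linarith
    · intro m hm z _
      interval_cases m
      · refine (((dXz 1 z).mul (dYz 3 z)).sub ((dYz 1 z).mul (dXz 3 z))).congr_deriv ?_
        simp only [hK]; ring
      · refine (((((dXz 2 z).mul (dYz 3 z)).add ((dXz 1 z).mul (dYz 4 z))).sub
          ((dYz 2 z).mul (dXz 3 z))).sub ((dYz 1 z).mul (dXz 4 z))).congr_deriv ?_
        simp only [hK]; ring
    · intro z hz
      have a1 := (mulb 2 (by norm_num) 4 (by norm_num) z hz)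
      have a2 := (mulb 1 (by norm_num) 5 (by norm_num) z hz)
      have b1 := norm_sub_le (2 * (X 2 z * Y 4 z) + X 1 z * Y 5 z - 2 * (Y 2 z * X 4 z)) (Y 1 z * X 5 z)
      have b2 := norm_sub_le (2 * (X 2 z * Y 4 z) + X 1 z * Y 5 z) (2 * (Y 2 z * X 4 z))
      have b3 := norm_add_le (2 * (X 2 z * Y 4 z)) (X 1 z * Y 5 z)
      have b4 : ‖2 * (X 2 z * Y 4 z)‖ = 2 * ‖X 2 z * Y 4 z‖ := by rw [norm_mul, Complex.norm_ofNat]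
      have b5 : ‖2 * (Y 2 z * X 4 z)‖ = 2 * ‖Y 2 z * X 4 z‖ := by rw [norm_mul, Complex.norm_ofNat]
      change ‖2 * (X 2 z * Y 4 z) + X 1 z * Y 5 z - 2 * (Y 2 z * X 4 z) - Y 1 z * X 5 z‖ ≤ _
      linarith [a1.1, a1.2, a2.1, a2.2]
  have hr2' : r ^ 2 ≤ δ := by linarith
  refine ⟨⟨fun m => sF_tr a N m _, fun m => sF_tr b N m _, fun m z _ => dXz m z, fun m z _ => dYz m z,
    fun m hm z hz => (bX m hm z hz).trans (by nlinarith [sq_nonneg L]),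
    fun m hm z hz => (bY m hm z hz).trans (by nlinarith [sq_nonneg L]), fun z hz => ?_, fun z hz => ?_⟩,
    fun z hz => ?_⟩
  · have h1 : ‖kap X Y z - kap X Y z.re‖ ≤ 44 * L ^ 2 * r ^ 2 * ‖z - z.re‖ := by
      refine (convex_strip (2 * r)).norm_image_sub_le_of_norm_hasDerivWithin_le (f' := kap' X Y)
        (fun w hw => ?_) hK' (ofReal_mem_strip (by linarith) z.re) hz
      refine ((((dXz 1 w).mul (dYz 2 w)).sub ((dYz 1 w).mul (dXz 2 w))).congr_deriv ?_).hasDerivWithinAt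
      simp only [kap']; ring
    have h2 := near_re z hz
    have h3 := k0 z.re
    have h4 := norm_add_le (kap X Y z - kap X Y z.re) (kap X Y z.re - c)
    rw [sub_add_sub_cancel] at h4
    have h5 : 44 * L ^ 2 * r ^ 2 * ‖z - z.re‖ ≤ 44 * L ^ 2 * r ^ 2 * 2 := by
      gcongr; linarith
    rw [le_div_iff₀ (by positivity)] at hrc
    have h6 : (92 * L ^ 2) * r ^ 2 ≤ (92 * L ^ 2) * r := by gcongr
    linarith
  · refine (hK' z hz).trans ?_
    calc _ ≤ 44 * L ^ 2 * δ := by gcongr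
      _ ≤ (L + 44 * L ^ 2) * δ := by nlinarith [mul_nonneg hL0 (hr.le.trans hrδ)]
  · refine (hK' z hz).trans ?_
    gcongr; linarith
end
end DualBilliard

namespace DualBilliard

/-- The uniform estimates for the truncated curves at scale `δ`. -/
structure Env (M c C C' M₀ δ : ℝ) (a b : ℕ → ℂ) : Prop where
  hM : 0 ≤ M
  hc : 0 < c
  hC : 1 ≤ C
  hC' : 0 ≤ C'
  hM₀ : 0 ≤ M₀
  hδ : 0 < δ
  sm : C * δ ^ 2 ≤ 1 / 200
  ha : ∀ n, ‖a n‖ ≤ M₀ / (1 + n) ^ 7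
  hb : ∀ n, ‖b n‖ ≤ M₀ / (1 + n) ^ 7
  crv : ∀ (r : ℝ) (N : ℕ), 0 < r → r ≤ δ → 1 ≤ N * r → N * r ≤ 2 →
    Crv M c δ (2 * r) (tr a N) (tr b N)
  bd : ∀ (R : ℝ) (X Y : ℕ → ℂ → ℂ), Crv M c δ R X Y → ∀ x ∈ strip R, ∀ y ∈ strip R,
    δ / 2 ≤ ‖y - x‖ → ‖y - x‖ ≤ 4 * δ → CrBd C δ X Y x y
  cmp : ∀ (R R' : ℝ) (X Y X' Y' : ℕ → ℂ → ℂ) (x y : ℂ) (e₀ e₁ : ℝ),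
    Crv M c δ R X Y → Crv M c δ R' X' Y' → x ∈ strip R → y ∈ strip R → x ∈ strip R' → y ∈ strip R' →
    δ / 2 ≤ ‖y - x‖ → ‖y - x‖ ≤ 4 * δ →
    (∀ z, z = x ∨ z = y → ‖X 0 z - X' 0 z‖ ≤ e₀ ∧ ‖Y 0 z - Y' 0 z‖ ≤ e₀ ∧
      ‖X 1 z - X' 1 z‖ ≤ e₁ ∧ ‖Y 1 z - Y' 1 z‖ ≤ e₁) →
    ‖crG X Y x y - crG X' Y' x y‖ ≤ C' * (e₀ / δ + e₁)

lemma exists_nat_mul {r : ℝ} (hr : 0 < r) (hr1 : r ≤ 1) : ∃ N : ℕ, 1 ≤ N * r ∧ N * r ≤ 2 := by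
  refine ⟨⌈1 / r⌉₊, ?_, ?_⟩
  · rw [← div_le_iff₀ hr]; exact Nat.le_ceil _
  · have h1 := (Nat.ceil_lt_add_one (a := 1 / r) (by positivity)).le
    have h2 : (⌈1 / r⌉₊ : ℝ) * r ≤ (1 / r + 1) * r := by gcongr
    have h3 : (1 / r + 1) * r = 1 + r := by field_simp
    linarith

namespace Env
variable {M c C C' M₀ δ : ℝ} {a b : ℕ → ℂ} (h : Env M c C C' M₀ δ a b)
include h

lemma stp {r ω : ℝ} {N : ℕ} {v : ℂ → ℂ} (hr : 0 < r) (hrδ : r ≤ δ) (h1 : 1 ≤ N * r) (h2 : N * r ≤ 2)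
    (low : δ ≤ ω) (upp : ω ≤ 2 * δ) (sv : SF r v) (dv : ∀ z ∈ strip r, ‖deriv v z‖ ≤ 1 / 10) :
    Stp M c C δ r ω (tr a N) (tr b N) v :=
  ⟨h.hM, h.hc, h.hC, h.hδ, hr, hrδ, h.sm, low, upp, h.crv r N hr hrδ h1 h2,
    h.bd _ _ _ (h.crv r N hr hrδ h1 h2), sv, dv⟩

/-- Effect of refining the truncation. -/
lemma norm_stE_sub_le {r ω : ℝ} {N N' : ℕ} {v : ℂ → ℂ} (hr : 0 < r) (hrδ : r ≤ δ)
    (h1 : 1 ≤ N * r) (h2 : N * r ≤ 2) (h1' : 1 ≤ N' * (r / 32)) (h2' : N' * (r / 32) ≤ 2)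
    (low : δ ≤ ω) (upp : ω ≤ 2 * δ) (sv : SF (r / 32) v) (dv : ∀ z ∈ strip (r / 32), ‖deriv v z‖ ≤ 1 / 10)
    {z : ℂ} (hz : z ∈ strip (r / 32)) :
    ‖stE (tr a N') (tr b N') v ω z - stE (tr a N) (tr b N) v ω z‖ ≤ 8 * C' * rexp 4 * M₀ * r ^ 5 := by
  have hδ := h.hδ
  have hS := h.stp (by positivity) (by linarith) h1' h2' low upp sv dv
  have hN0 : (0:ℝ) < N := by
    rcases Nat.eq_zero_or_pos N with h0 | h0
    · rw [h0] at h1; norm_num at h1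
    · exact_mod_cast h0
  have hN1 : 1 ≤ N := by exact_mod_cast hN0
  have hNr : 1 / (N:ℝ) ≤ r := by rw [div_le_iff₀ hN0]; linarith
  have hNN : N ≤ N' := by
    have : (N:ℝ) ≤ N' := by nlinarith
    exact_mod_cast this
  have hd : ∀ (f : ℕ → ℂ), (∀ n, ‖f n‖ ≤ M₀ / (1 + n) ^ 7) → ∀ m ≤ 5, ∀ w ∈ strip (2 * (r / 32)),
      ‖tr f N' m w - tr f N m w‖ ≤ 2 * rexp 4 * M₀ * r ^ (6 - m) := fun f hf m hm w hw => by
    refine (norm_tr_sub_le h.hM₀ hf hw hm hN1 hNN (by linarith)).trans ?_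
    rw [div_eq_mul_one_div, ← one_div_pow]
    have := h.hM₀
    gcongr
  have key : ∀ s : ℝ, |s| = ω → ‖stG (tr a N') (tr b N') v s z - stG (tr a N) (tr b N) v s z‖ ≤
      4 * C' * rexp 4 * M₀ * r ^ 5 := fun s hs => by
    have m1 := hS.lft_mem' hz
    have m2 := hS.lft_mem' (add_ofReal_mem_strip hz s)
    have l1 := hS.diff_low (s := s) (by linarith) hz
    have l2 := hS.diff_upp (s := s) (by linarith) hz
    have hm : strip (2 * (r / 32)) ⊆ strip (2 * r) := strip_mono (by linarith)
    refine (h.cmp _ _ _ _ _ _ _ _ (2 * rexp 4 * M₀ * r ^ 6) (2 * rexp 4 * M₀ * r ^ 5)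
      hS.crv (h.crv r N hr hrδ h1 h2) m1 m2 (hm m1) (hm m2) (by linarith) (by linarith) ?_).trans ?_
    · intro w hw
      have hw' : w ∈ strip (2 * (r / 32)) := by rcases hw with rfl | rfl <;> assumption
      exact ⟨hd a h.ha 0 (by norm_num) w hw', hd b h.hb 0 (by norm_num) w hw',
        hd a h.ha 1 (by norm_num) w hw', hd b h.hb 1 (by norm_num) w hw'⟩
    · have h3 : 2 * rexp 4 * M₀ * r ^ 6 / δ ≤ 2 * rexp 4 * M₀ * r ^ 5 := by
        rw [div_le_iff₀ hδ, show 2 * rexp 4 * M₀ * r ^ 6 = 2 * rexp 4 * M₀ * r ^ 5 * r by ring]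
        have := h.hM₀
        gcongr
      nlinarith [h.hC', mul_le_mul_of_nonneg_left h3 h.hC']
  have hω : 0 ≤ ω := by linarith
  have k1 := key ω (abs_of_nonneg hω)
  have k2 := key (-ω) (by rw [abs_neg, abs_of_nonneg hω])
  simp only [stE]
  rw [add_sub_add_comm]
  refine (norm_add_le _ _).trans ?_
  linarith

end Env

/-- The state of the iteration at time `t = 2⁻ʲ`. -/
structure Stage (ν ω : ℝ) (a b : ℕ → ℂ) (t : ℝ) (N : ℕ) (v : ℂ → ℂ) : Prop where
  one_le : 1 ≤ N * (ν ^ 10 * t ^ 5)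
  le_two : N * (ν ^ 10 * t ^ 5) ≤ 2
  sv : SF (ν ^ 10 * t ^ 5) v
  dv : ∀ z ∈ strip (ν ^ 10 * t ^ 5), ‖deriv v z‖ ≤ 1 / 10 * (1 - t)
  err : ∀ z ∈ strip (ν ^ 10 * t ^ 5), ‖stE (tr a N) (tr b N) v ω z‖ ≤ ν ^ 39 * t ^ 25

lemma Stage.exists_next {M c C C' M₀ ν ω K t : ℝ} {a b : ℕ → ℂ} {N : ℕ} {v : ℂ → ℂ}
    (h : Stage ν ω a b t N v) (hE : Env M c C C' M₀ (ν ^ 10) a b) (hν : 0 < ν) (hν1 : ν ≤ 1)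
    (ht : 0 < t) (ht1 : t ≤ 1) (low : ν ^ 10 ≤ ω) (upp : ω ≤ 2 * ν ^ 10) (hK : 1 ≤ K)
    (hD : Dio (ν ^ 10 * t ^ 5 / 8) ω (K / (ν ^ 12 * t ^ 6)))
    (s1 : 16000 * K ^ 2 * ν ≤ 1) (s2 : 60000 * 2 ^ 26 * C * K ^ 4 * ν ≤ 1)
    (s3 : 8 * 2 ^ 26 * C' * rexp 4 * M₀ * ν ≤ 1) :
    ∃ N' v', Stage ν ω a b (t / 2) N' v' ∧
      ∀ z ∈ strip (ν ^ 10 * (t / 2) ^ 5), ‖v' z - v z‖ ≤ t / 2 := by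
  set r := ν ^ 10 * t ^ 5 with hr
  have hr0 : 0 < r := by positivity
  have hrδ : r ≤ ν ^ 10 := mul_le_of_le_one_right (by positivity) (pow_le_one₀ ht.le ht1)
  have hr' : ν ^ 10 * (t / 2) ^ 5 = r / 32 := by rw [hr]; ring
  have hS := hE.stp hr0 hrδ h.one_le h.le_two low upp h.sv fun z hz => (h.dv z hz).trans (by linarith)
  have pw : ∀ k ≥ 1, ν ^ k ≤ ν := fun k hk => pow_le_of_le_one hν.le hν1 (by omega)
  have pt : ∀ k : ℕ, t ^ k ≤ 1 := fun k => pow_le_one₀ ht.le ht1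
  have q1 : 16000 * K ^ 2 * ν ^ 5 * t ^ 7 ≤ 1 := by
    calc _ ≤ 16000 * K ^ 2 * ν * 1 := by gcongr; exacts [pw 5 (by norm_num), pt 7]
      _ ≤ 1 := by linarith
  have q1' : 16000 * K ^ 2 * ν ^ 15 * t ^ 12 ≤ 1 := by
    calc _ ≤ 16000 * K ^ 2 * ν * 1 := by gcongr; exacts [pw 15 (by norm_num), pt 12]
      _ ≤ 1 := by linarith
  have e1 : (K / (ν ^ 12 * t ^ 6)) ^ 2 * (ν ^ 39 * t ^ 25) = K ^ 2 * ν ^ 15 * t ^ 13 := by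
    field_simp
  have e2 : (K / (ν ^ 12 * t ^ 6)) ^ 4 * (ν ^ 39 * t ^ 25) ^ 2 = K ^ 4 * ν ^ 30 * t ^ 26 := by
    field_simp
  obtain ⟨w, sw, hw, hw'⟩ := hS.step hD
    (by rw [mul_div_assoc', le_div_iff₀ (by positivity), hr]
        calc 1 * (ν ^ 12 * t ^ 6) = 1 * (ν ^ 10 * t ^ 5) * (ν ^ 2 * t) := by ring
          _ ≤ K * (ν ^ 10 * t ^ 5) * (1 * 1) := by gcongr; exact pow_le_one₀ hν.le hν1
          _ = _ := by ring) h.err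
    (by rw [mul_assoc, e1, hr]
        calc _ = (16000 * K ^ 2 * ν ^ 5 * t ^ 7) * (ν ^ 10 * t ^ 5) * t / 20 := by ring
          _ ≤ 1 * (ν ^ 10 * t ^ 5) * 1 / 20 := by gcongr
          _ ≤ _ := by nlinarith [hr0])
  obtain ⟨N', hN1, hN2⟩ := exists_nat_mul (r := r / 32) (by positivity)
    (by have : ν ^ 10 ≤ 1 := pow_le_one₀ hν.le hν1
        linarith)
  have hm : strip (r / 32) ⊆ strip (r / 2) := strip_mono (by linarith)
  have hm' : strip (r / 32) ⊆ strip r := strip_mono (by linarith)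
  have sv' : SF (r / 32) fun z => v z + w z := (h.sv.mono (by linarith)).add (sw.mono (by linarith))
  have dv' : ∀ z ∈ strip (r / 32), ‖deriv (fun z => v z + w z) z‖ ≤ 1 / 10 * (1 - t / 2) := fun z hz => by
    rw [deriv_fun_add (h.sv.differentiableAt (hm' hz)) (sw.differentiableAt (hm hz))]
    refine (norm_add_le _ _).trans ?_
    have a1 := h.dv z (hm' hz)
    have a2 := (hw z (hm hz)).2
    have a3 : 800 * (K / (ν ^ 12 * t ^ 6)) ^ 2 * (ν ^ 39 * t ^ 25) / r ≤ t / 20 := by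
      rw [mul_assoc, e1, div_le_iff₀ hr0, hr]
      calc _ = (16000 * K ^ 2 * ν ^ 5 * t ^ 7) * (t / 20 * (ν ^ 10 * t ^ 5)) := by ring
        _ ≤ 1 * (t / 20 * (ν ^ 10 * t ^ 5)) := by gcongr
        _ = _ := by ring
    linarith
  refine ⟨N', fun z => v z + w z, ⟨by rwa [hr'], by rwa [hr'], by rwa [hr'], by rwa [hr'], ?_⟩, ?_⟩
  · rw [hr']
    intro z hz
    have b1 := hw' z (hm hz)
    have b2 := hE.norm_stE_sub_le hr0 hrδ h.one_le h.le_two hN1 hN2 low upp sv'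
      (fun z hz => (dv' z hz).trans (by linarith)) hz
    have b3 : 60000 * C * ν ^ 10 * (K / (ν ^ 12 * t ^ 6)) ^ 4 * (ν ^ 39 * t ^ 25) ^ 2 ≤
        ν ^ 39 * t ^ 25 / 2 ^ 26 := by
      rw [mul_assoc, e2]
      have := hE.hC
      calc _ = (60000 * 2 ^ 26 * C * K ^ 4 * ν) * (ν ^ 39 * t ^ 25) * t / 2 ^ 26 := by ring
        _ ≤ 1 * (ν ^ 39 * t ^ 25) * 1 / 2 ^ 26 := by gcongr
        _ = _ := by ring
    have b4 : 8 * C' * rexp 4 * M₀ * r ^ 5 ≤ ν ^ 39 * t ^ 25 / 2 ^ 26 := by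
      have := hE.hC'
      have := hE.hM₀
      calc _ = (8 * 2 ^ 26 * C' * rexp 4 * M₀ * ν ^ 11) * (ν ^ 39 * t ^ 25) / 2 ^ 26 := by rw [hr]; ring
        _ ≤ (8 * 2 ^ 26 * C' * rexp 4 * M₀ * ν) * (ν ^ 39 * t ^ 25) / 2 ^ 26 := by
          gcongr; exact pw 11 (by norm_num)
        _ ≤ 1 * (ν ^ 39 * t ^ 25) / 2 ^ 26 := by gcongr
        _ = _ := by ring
    have b5 := norm_add_le (stE (tr a N') (tr b N') (fun z => v z + w z) ω z -
      stE (tr a N) (tr b N) (fun z => v z + w z) ω z) (stE (tr a N) (tr b N) (fun z => v z + w z) ω z)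
    rw [sub_add_cancel] at b5
    calc _ ≤ ν ^ 39 * t ^ 25 / 2 ^ 26 + ν ^ 39 * t ^ 25 / 2 ^ 26 := by linarith
      _ = _ := by ring
  · rw [hr']
    intro z hz
    rw [add_sub_cancel_left]
    refine (hw z (hm hz)).1.trans ?_
    rw [mul_assoc, e1]
    calc _ = (16000 * K ^ 2 * ν ^ 15 * t ^ 12) * t / 200 := by ring
      _ ≤ 1 * t / 200 := by gcongr
      _ ≤ _ := by linarith

lemma exists_seq_of_step {α : Type*} {P : ℕ → α → Prop} {Q : ℕ → α → α → Prop} {a₀ : α} (h0 : P 0 a₀)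
    (h : ∀ n a, P n a → ∃ b, P (n + 1) b ∧ Q n a b) :
    ∃ f : ℕ → α, f 0 = a₀ ∧ (∀ n, P n (f n)) ∧ ∀ n, Q n (f n) (f (n + 1)) := by
  choose g hg using fun n (a : {a // P n a}) => h n a.1 a.2
  let F : ∀ n, {a // P n a} := fun n => Nat.rec ⟨a₀, h0⟩ (fun n a => ⟨g n a, (hg n a).1⟩) n
  exact ⟨fun n => (F n).1, rfl, fun n => (F n).2, fun n => (hg n (F n)).2⟩
end DualBilliard

namespace DualBilliard
open Filter Topology

section
variable (x y : ℕ → ℝ → ℝ) (s t : ℝ)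
def rD : ℝ := x 1 s * y 1 t - y 1 s * x 1 t
noncomputable def rG : ℝ := ((x 0 t - x 0 s) * y 1 t - (y 0 t - y 0 s) * x 1 t) / rD x y s t
end

/-- Real estimates for the intersection parameter `rG`. -/
structure RBd (x y : ℕ → ℝ → ℝ) (δ : ℝ) : Prop where
  D : ∀ s t, δ / 2 ≤ |t - s| → |t - s| ≤ 4 * δ → rD x y s t ≠ 0
  G : ∀ s t, δ / 2 ≤ |t - s| → |t - s| ≤ 4 * δ → |rG x y s t - (t - s) / 2| ≤ |t - s| / 4
  lip : ∀ s t t', s + δ / 2 ≤ t → t ≤ t' → t' ≤ s + 4 * δ →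
    |rG x y s t' - rG x y s t - (t' - t) / 2| ≤ (t' - t) / 4

/-- An invariant circle of rotation `ω`, given by the tangency parameter `u`. -/
structure InvU (x y : ℕ → ℝ → ℝ) (ω : ℝ) (u : ℝ → ℝ) : Prop where
  per : ∀ t, u (t + 2 * π) = u t + 2 * π
  low : ∀ s t, s ≤ t → 9 / 10 * (t - s) ≤ u t - u s
  upp : ∀ s t, s ≤ t → u t - u s ≤ 11 / 10 * (t - s)
  eq : ∀ t, rG x y (u t) (u (t + ω)) + rG x y (u t) (u (t - ω)) = 0

lemma Cf.tendsto_diag {M₀ : ℝ} {a : ℕ → ℂ} {x : ℕ → ℝ → ℝ} (h : Cf M₀ a x) {m : ℕ} (hm : m < 5)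
    {N : ℕ → ℕ} (hN : Tendsto N atTop atTop) {s : ℕ → ℝ} {s₀ : ℝ} (hs : Tendsto s atTop (𝓝 s₀)) :
    Tendsto (fun j => tr a (N j) m (s j)) atTop (𝓝 (x m s₀ : ℂ)) := by
  have h1 : Tendsto (fun j => ((x m (s j) : ℝ) : ℂ)) atTop (𝓝 (x m s₀ : ℂ)) :=
    (Complex.continuous_ofReal.tendsto _).comp ((h.der m hm s₀).continuousAt.tendsto.comp hs)
  have h2 : Tendsto (fun j => (x m (s j) : ℂ) - tr a (N j) m (s j)) atTop (𝓝 0) := by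
    refine squeeze_zero_norm' (a := fun j => 2 * rexp 4 * M₀ / (N j : ℝ) ^ (6 - m)) ?_ ?_
    · filter_upwards [hN.eventually_ge_atTop 1] with j hj
      exact h.norm_sub_le hm.le hj _
    · refine Tendsto.div_atTop tendsto_const_nhds ((tendsto_pow_atTop (by omega)).comp ?_)
      exact tendsto_natCast_atTop_atTop.comp hN
  simpa using h1.sub h2

section
variable {M₀ : ℝ} {a b : ℕ → ℂ} {x y : ℕ → ℝ → ℝ} (hx : Cf M₀ a x) (hy : Cf M₀ b y)
  {N : ℕ → ℕ} (hN : Tendsto N atTop atTop) {s t : ℕ → ℝ} {s₀ t₀ : ℝ}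
  (hs : Tendsto s atTop (𝓝 s₀)) (ht : Tendsto t atTop (𝓝 t₀))
include hx hy hN hs ht

lemma tendsto_crD : Tendsto (fun j => crD (tr a (N j)) (tr b (N j)) (s j) (t j)) atTop
    (𝓝 (rD x y s₀ t₀ : ℂ)) := by
  have := ((hx.tendsto_diag (m := 1) (by norm_num) hN hs).mul
    (hy.tendsto_diag (m := 1) (by norm_num) hN ht)).sub
    ((hy.tendsto_diag (m := 1) (by norm_num) hN hs).mul (hx.tendsto_diag (m := 1) (by norm_num) hN ht))
  simpa [rD, crD] using this

lemma tendsto_crG (hD : rD x y s₀ t₀ ≠ 0) :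
    Tendsto (fun j => crG (tr a (N j)) (tr b (N j)) (s j) (t j)) atTop (𝓝 (rG x y s₀ t₀ : ℂ)) := by
  have := ((((hx.tendsto_diag (m := 0) (by norm_num) hN ht).sub
    (hx.tendsto_diag (m := 0) (by norm_num) hN hs)).mul
    (hy.tendsto_diag (m := 1) (by norm_num) hN ht)).sub
    (((hy.tendsto_diag (m := 0) (by norm_num) hN ht).sub
    (hy.tendsto_diag (m := 0) (by norm_num) hN hs)).mul
    (hx.tendsto_diag (m := 1) (by norm_num) hN ht))).div (tendsto_crD hx hy hN hs ht)
    (by exact_mod_cast hD)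
  simp only [rG, crG, crN]
  push_cast
  exact this
end

lemma Crv.norm_crG_sub_le {M c C δ R : ℝ} {X Y : ℕ → ℂ → ℂ} (h : Crv M c δ R X Y) (hδ : 0 < δ) (hR : 0 < R)
    (hbd : ∀ x ∈ strip R, ∀ y ∈ strip R, δ / 2 ≤ ‖y - x‖ → ‖y - x‖ ≤ 4 * δ → CrBd C δ X Y x y)
    {s t t' : ℝ} (h1 : s + δ / 2 ≤ t) (h2 : t ≤ t') (h3 : t' ≤ s + 4 * δ) :
    ‖crG X Y s t' - crG X Y s t - (t' - t) / 2‖ ≤ C * δ ^ 2 * (t' - t) := by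
  have key : ∀ τ ∈ Set.Icc t t', CrBd C δ X Y s τ := fun τ hτ => by
    have : ‖(τ : ℂ) - s‖ = τ - s := by
      rw [← Complex.ofReal_sub, Complex.norm_of_nonneg]; linarith [hτ.1]
    exact hbd _ (ofReal_mem_strip hR s) _ (ofReal_mem_strip hR τ) (by linarith [hτ.1]) (by linarith [hτ.2])
  have := (convex_Icc t t').norm_image_sub_le_of_norm_hasDerivWithin_le (𝕜 := ℝ)
    (f := fun τ : ℝ => crG X Y s τ - (τ : ℂ) / 2) (f' := fun τ : ℝ => crGy X Y s τ - 1 / 2)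
    (fun τ hτ => ?_) (fun τ hτ => (key τ hτ).Gy) (Set.left_mem_Icc.2 h2) (Set.right_mem_Icc.2 h2)
  · rw [Real.norm_of_nonneg (by linarith : 0 ≤ t' - t)] at this
    have e : crG X Y s t' - crG X Y s t - (t' - t) / 2 =
      crG X Y s t' - (t' : ℂ) / 2 - (crG X Y s t - (t : ℂ) / 2) := by ring
    rwa [e]
  · have hD : crD X Y s τ ≠ 0 := fun h0 => by
      have := (key τ hτ).D
      rw [h0, norm_zero, mul_zero] at this
      linarith
    have := hasDerivAt_crG (hasDerivAt_const (τ : ℂ) (s : ℂ)) (hasDerivAt_id (τ : ℂ))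
      (fun m => h.dX m _ (ofReal_mem_strip hR s)) (fun m => h.dY m _ (ofReal_mem_strip hR s))
      (fun m => h.dX m _ (ofReal_mem_strip hR τ)) (fun m => h.dY m _ (ofReal_mem_strip hR τ)) hD
    have h4 := (this.sub ((hasDerivAt_id (τ : ℂ)).div_const 2)).comp_ofReal.hasDerivWithinAt (s := Set.Icc t t')
    simpa using h4

lemma Env.rBd {M c C C' M₀ δ : ℝ} {a b : ℕ → ℂ} (h : Env M c C C' M₀ δ a b) {x y : ℕ → ℝ → ℝ}
    (hx : Cf M₀ a x) (hy : Cf M₀ b y) : RBd x y δ := by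
  have hδ := h.hδ
  have hC := h.hC
  have hsm := h.sm
  have hN : Tendsto (fun j : ℕ => j) atTop atTop := tendsto_id
  have hcrv : ∀ᶠ j : ℕ in atTop, 0 < (1 / j : ℝ) ∧ Crv M c δ (2 * (1 / j)) (tr a j) (tr b j) := by
    filter_upwards [eventually_ge_atTop (max 1 ⌈1 / δ⌉₊)] with j hj
    have hj0 : (0:ℝ) < j := by exact_mod_cast (le_max_left _ _).trans hj
    have hj1 : 1 / δ ≤ j := (Nat.le_ceil _).trans (by exact_mod_cast (le_max_right _ _).trans hj)
    refine ⟨by positivity, h.crv _ j (by positivity) ?_ ?_ ?_⟩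
    · rwa [div_le_comm₀ hj0 hδ]
    · rw [mul_one_div_cancel hj0.ne']
    · rw [mul_one_div_cancel hj0.ne']; norm_num
  have key : ∀ s t : ℝ, δ / 2 ≤ |t - s| → |t - s| ≤ 4 * δ →
      ∀ᶠ j : ℕ in atTop, CrBd C δ (tr a j) (tr b j) s t := fun s t h1 h2 => by
    filter_upwards [hcrv] with j hj
    have : ‖(t : ℂ) - s‖ = |t - s| := by rw [← Complex.ofReal_sub, Complex.norm_real, Real.norm_eq_abs]
    exact h.bd _ _ _ hj.2 _ (ofReal_mem_strip (by linarith [hj.1]) s) _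
      (ofReal_mem_strip (by linarith [hj.1]) t) (by linarith) (by linarith)
  have hD : ∀ s t : ℝ, δ / 2 ≤ |t - s| → |t - s| ≤ 4 * δ → rD x y s t ≠ 0 := fun s t h1 h2 h0 => by
    have := ge_of_tendsto ((tendsto_crD hx hy hN (s := fun _ => s) (t := fun _ => t)
      tendsto_const_nhds tendsto_const_nhds).norm.const_mul C) ((key s t h1 h2).mono fun j hj => hj.D)
    rw [h0] at this
    simp at this
    linarith
  have hG : ∀ s t : ℝ, δ / 2 ≤ |t - s| → |t - s| ≤ 4 * δ → Tendsto (fun j => crG (tr a j) (tr b j) s t)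
      atTop (𝓝 (rG x y s t : ℂ)) := fun s t h1 h2 =>
    tendsto_crG hx hy hN (s := fun _ => s) (t := fun _ => t) tendsto_const_nhds tendsto_const_nhds (hD s t h1 h2)
  refine ⟨hD, fun s t h1 h2 => ?_, fun s t t' h1 h2 h3 => ?_⟩
  · have := le_of_tendsto ((hG s t h1 h2).sub_const (((t - s) / 2 : ℝ) : ℂ)).norm
      ((key s t h1 h2).mono fun j hj => by simpa using hj.G)
    rw [← Complex.ofReal_sub, Complex.norm_real, Real.norm_eq_abs] at this
    refine this.trans ?_
    nlinarith
  · have e1 : |t - s| = t - s := abs_of_nonneg (by linarith)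
    have e2 : |t' - s| = t' - s := abs_of_nonneg (by linarith)
    have := le_of_tendsto (((hG s t' (by linarith) (by linarith)).sub
      (hG s t (by linarith) (by linarith))).sub_const (((t' - t) / 2 : ℝ) : ℂ)).norm
      (hcrv.mono fun j hj => by
        simpa using hj.2.norm_crG_sub_le hδ (by linarith [hj.1]) (h.bd _ _ _ hj.2) h1 h2 h3)
    rw [← Complex.ofReal_sub, ← Complex.ofReal_sub, Complex.norm_real, Real.norm_eq_abs] at this
    refine this.trans ?_
    nlinarith
end DualBilliard

namespace DualBilliard
open Filter Topology

lemma dio_exponent_le {K ν t : ℝ} (hK : 0 ≤ K) (hν : 0 < ν) (ht : 0 < t) :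
    K * (ν ^ 10 * t ^ 5 / 8) ^ (-(6 / 5) : ℝ) ≤ 16 * K / (ν ^ 12 * t ^ 6) := by
  have h1 : (ν ^ 10 * t ^ 5 : ℝ) ^ (6 / 5 : ℝ) = ν ^ 12 * t ^ 6 := by
    rw [show ν ^ 10 * t ^ 5 = (ν ^ 2 * t) ^ (5:ℝ) by norm_cast; ring, ← Real.rpow_mul (by positivity)]
    norm_num
    ring
  have h2 : (8:ℝ) ^ (6 / 5 : ℝ) ≤ 16 := by
    calc (8:ℝ) ^ (6 / 5 : ℝ) ≤ 8 ^ (4 / 3 : ℝ) := Real.rpow_le_rpow_of_exponent_le (by norm_num) (by norm_num)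
      _ = ((2:ℝ) ^ (3:ℝ)) ^ (4 / 3 : ℝ) := by norm_num
      _ = 16 := by rw [← Real.rpow_mul (by norm_num)]; norm_num
  rw [Real.rpow_neg (by positivity), Real.div_rpow (by positivity) (by norm_num), h1, inv_div,
    mul_div_assoc', mul_comm 16 K]
  gcongr

section
variable {M c C C' M₀ ν ω K : ℝ} {a b : ℕ → ℂ} {x y : ℕ → ℝ → ℝ}

theorem exists_invU (hx : Cf M₀ a x) (hy : Cf M₀ b y) (hE : Env M c C C' M₀ (ν ^ 10) a b)
    (hν : 0 < ν) (hν1 : ν ≤ 1) (low : ν ^ 10 ≤ ω) (upp : ω ≤ 2 * ν ^ 10) (hK : 1 ≤ K)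
    (hD : ∀ j : ℕ, Dio (ν ^ 10 * ((1 / 2) ^ j) ^ 5 / 8) ω (K / (ν ^ 12 * ((1 / 2) ^ j) ^ 6)))
    (s1 : 16000 * K ^ 2 * ν ≤ 1) (s2 : 60000 * 2 ^ 26 * C * K ^ 4 * ν ≤ 1)
    (s3 : 8 * 2 ^ 26 * C' * rexp 4 * M₀ * ν ≤ 1)
    (h0 : ∀ N : ℕ, 1 ≤ N * ν ^ 10 → N * ν ^ 10 ≤ 2 → ∀ z ∈ strip (ν ^ 10),
      ‖stE (tr a N) (tr b N) (fun _ => 0) ω z‖ ≤ ν ^ 39) : ∃ u, InvU x y ω u := by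
  set δ := ν ^ 10 with hδ
  have hδ0 : 0 < δ := hE.hδ
  set T : ℕ → ℝ := fun j => (1 / 2) ^ j with hT
  have hT0 : ∀ j, 0 < T j := fun j => by positivity
  have hT1 : ∀ j, T j ≤ 1 := fun j => pow_le_one₀ (by norm_num) (by norm_num)
  have hTs : ∀ j, T (j + 1) = T j / 2 := fun j => by simp only [hT, pow_succ]; ring
  obtain ⟨N₀, hN₁, hN₂⟩ := exists_nat_mul hδ0 (pow_le_one₀ hν.le hν1)
  obtain ⟨f, -, hf, hf'⟩ := exists_seq_of_step (a₀ := ((N₀, fun _ => 0) : ℕ × (ℂ → ℂ)))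
    (P := fun j p => Stage ν ω a b (T j) p.1 p.2)
    (Q := fun j p q => ∀ z ∈ strip (δ * T (j + 1) ^ 5), ‖q.2 z - p.2 z‖ ≤ T j / 2)
    ⟨by simpa [hT] using hN₁, by simpa [hT] using hN₂, SF.const _ 0, by simp [hT],
      by simpa [hT] using h0 N₀ hN₁ hN₂⟩
    (fun j p hp => by
      obtain ⟨N', v', h1, h2⟩ := hp.exists_next hE hν hν1 (hT0 j) (hT1 j) low upp hK (hD j) s1 s2 s3
      exact ⟨(N', v'), by rw [hTs]; exact h1, by rw [hTs]; exact h2⟩)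
  have hr0 : ∀ j, 0 < δ * T j ^ 5 := fun j => mul_pos hδ0 (pow_pos (hT0 j) 5)
  have hS : ∀ j, Stp M c C δ (δ * T j ^ 5) ω (tr a (f j).1) (tr b (f j).1) (f j).2 := fun j =>
    hE.stp (hr0 j) (mul_le_of_le_one_right hδ0.le (pow_le_one₀ (hT0 j).le (hT1 j))) (hf j).one_le (hf j).le_two
      low upp (hf j).sv fun z hz => ((hf j).dv z hz).trans (by linarith [hT0 j])
  set V : ℕ → ℝ → ℝ := fun j t => ((f j).2 t).re with hV
  have hVc : ∀ j (t : ℝ), (f j).2 t = (V j t : ℂ) := fun j t => ((hf j).sv.ofReal_re t).symm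
  have hdist : ∀ t j, dist (V j t) (V (j + 1) t) ≤ 1 / 2 * (1 / 2) ^ j := fun t j => by
    have := hf' j t (ofReal_mem_strip (hr0 (j + 1)) t)
    rw [hVc, hVc, ← Complex.ofReal_sub, Complex.norm_real] at this
    rw [dist_comm, dist_eq_norm]
    refine this.trans (le_of_eq ?_)
    simp only [hT]; ring
  choose v hv using fun t => cauchySeq_tendsto_of_complete
    (cauchySeq_of_le_geometric (1 / 2) (1 / 2) (by norm_num) (hdist t))
  have hlim : ∀ t : ℝ, Tendsto (fun j => t + V j t) atTop (𝓝 (t + v t)) := fun t => (hv t).const_add t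
  have hlip : ∀ s t, s ≤ t → |v t - v s| ≤ 1 / 10 * (t - s) := fun s t hst => by
    refine le_of_tendsto ((hv t).sub (hv s)).abs (Eventually.of_forall fun j => ?_)
    have := (hS j).sv.norm_sub_re_le (hS j).dv (ofReal_mem_strip (hr0 j) s) (ofReal_mem_strip (hr0 j) t)
    rw [hVc, hVc, ← Complex.ofReal_sub, ← Complex.ofReal_sub, Complex.norm_real, Complex.norm_real,
      Real.norm_eq_abs, Real.norm_eq_abs, abs_of_nonneg (sub_nonneg.2 hst)] at this
    exact this
  have hN : Tendsto (fun j => (f j).1) atTop atTop := by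
    have h1 : Tendsto T atTop (𝓝[>] 0) := tendsto_nhdsWithin_iff.2
      ⟨tendsto_pow_atTop_nhds_zero_of_lt_one (by norm_num) (by norm_num), Eventually.of_forall hT0⟩
    refine tendsto_natCast_atTop_iff.1 (tendsto_atTop_mono (fun j => ?_) (tendsto_inv_nhdsGT_zero.comp h1))
    simp only [Function.comp]
    have h2 := (hf j).one_le
    have h3 : δ * T j ^ 5 ≤ T j := by
      calc δ * T j ^ 5 ≤ 1 * T j := by
            gcongr
            · exact pow_le_one₀ hν.le hν1
            · exact pow_le_of_le_one (hT0 j).le (hT1 j) (by norm_num)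
        _ = _ := one_mul _
    rw [inv_le_iff_one_le_mul₀ (hT0 j)]
    exact h2.trans (by gcongr)
  have hR := hE.rBd hx hy
  have hconv : ∀ σ : ℝ, |σ| = ω → ∀ t : ℝ, Tendsto (fun j => stG (tr a (f j).1) (tr b (f j).1) (f j).2 σ t) atTop
      (𝓝 (rG x y (t + v t) (t + σ + v (t + σ)) : ℂ)) := fun σ hσ t => by
    have e : ∀ j, stG (tr a (f j).1) (tr b (f j).1) (f j).2 σ t =
        crG (tr a (f j).1) (tr b (f j).1) ((t + V j t : ℝ) : ℂ) ((t + σ + V j (t + σ) : ℝ) : ℂ) := fun j => by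
      have := hVc j (t + σ)
      push_cast at this ⊢
      simp only [stG, lft, this, hVc j t]
    simp only [e]
    refine tendsto_crG hx hy hN (hlim t) (hlim _) (hR.D _ _ ?_ ?_)
    · refine ge_of_tendsto ((hlim (t + σ)).sub (hlim t)).abs (Eventually.of_forall fun j => ?_)
      have := (hS j).diff_low (s := σ) (by linarith) (ofReal_mem_strip (hr0 j) t)
      rw [← Complex.ofReal_add, lft, lft, hVc, hVc, ← Complex.ofReal_add, ← Complex.ofReal_add,
        ← Complex.ofReal_sub, Complex.norm_real, Real.norm_eq_abs] at this
      linarith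
    · refine le_of_tendsto ((hlim (t + σ)).sub (hlim t)).abs (Eventually.of_forall fun j => ?_)
      have := (hS j).diff_upp (s := σ) (by linarith) (ofReal_mem_strip (hr0 j) t)
      rw [← Complex.ofReal_add, lft, lft, hVc, hVc, ← Complex.ofReal_add, ← Complex.ofReal_add,
        ← Complex.ofReal_sub, Complex.norm_real, Real.norm_eq_abs] at this
      linarith
  refine ⟨fun t => t + v t, fun t => ?_, fun s t hst => ?_, fun s t hst => ?_, fun t => ?_⟩
  · have : v (t + 2 * π) = v t := by
      refine tendsto_nhds_unique (hv _) ((hv t).congr fun j => ?_)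
      have := (hf j).sv.per t
      simp only [hV]
      push_cast
      rw [this]
    simp only [this]; ring
  · have := (abs_le.1 (hlip s t hst)).1
    linarith
  · have := (abs_le.1 (hlip s t hst)).2
    linarith
  · have hω : 0 ≤ ω := by linarith
    have l1 := (hconv ω (abs_of_nonneg hω) t).add (hconv (-ω) (by rw [abs_neg, abs_of_nonneg hω]) t)
    have l2 : Tendsto (fun j => stE (tr a (f j).1) (tr b (f j).1) (f j).2 ω t) atTop (𝓝 0) := by
      refine squeeze_zero_norm (a := T) (fun j => ?_)
        (tendsto_pow_atTop_nhds_zero_of_lt_one (by norm_num) (by norm_num))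
      refine ((hf j).err t (ofReal_mem_strip (hr0 j) t)).trans ?_
      calc ν ^ 39 * T j ^ 25 ≤ 1 * T j := by
            have := (hT0 j).le
            gcongr
            · exact pow_le_one₀ hν.le hν1
            · exact pow_le_of_le_one (hT0 j).le (hT1 j) (by norm_num)
        _ = _ := one_mul _
    have := tendsto_nhds_unique l1 l2
    rw [← sub_eq_add_neg] at this
    exact_mod_cast this

theorem exists_env (hx : Cf M₀ a x) (hy : Cf M₀ b y) (hk : ∀ t, x 1 t * y 2 t - y 1 t * x 2 t = c)
    (hc : 0 < c) : ∃ M C C' δ₀ : ℝ, 0 < δ₀ ∧ (∀ δ, 0 < δ → δ ≤ δ₀ → Env M c C C' M₀ δ a b) ∧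
      ∃ C₂, ∀ (δ ω : ℝ) (N : ℕ), 0 < δ → δ ≤ δ₀ → δ ≤ ω → ω ≤ 2 * δ → 1 ≤ N * δ → N * δ ≤ 2 →
      ∀ z ∈ strip δ, ‖stE (tr a N) (tr b N) (fun _ => 0) ω z‖ ≤ C₂ * δ ^ 4 := by
  obtain ⟨M, d1, hM, hd1, h1⟩ := exists_crv_tr hx hy hk hc
  obtain ⟨C, d2, hC, hd2, h2⟩ := exists_crBd (M := M) (c := c) hM hc
  obtain ⟨C', d3, hC', hd3, h3⟩ := exists_crG_sub_bd (M := M) (c := c) hM hc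
  obtain ⟨C₂, d4, hC₂, hd4, h4⟩ := exists_sum_bd (M := M) (c := c) hM hc
  have hmin : ∀ δ, δ ≤ min (min (min d1 d2) (min d3 d4)) (1 / (200 * C)) →
      δ ≤ d1 ∧ δ ≤ d2 ∧ δ ≤ d3 ∧ δ ≤ d4 ∧ δ ≤ 1 / (200 * C) := fun δ h => by
    simp only [le_min_iff] at h; tauto
  refine ⟨M, C, C', min (min (min d1 d2) (min d3 d4)) (1 / (200 * C)), by positivity, fun δ hδ hδ' => ?_,
    C₂, fun δ ω N hδ hδ' low upp hN1 hN2 z hz => ?_⟩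
  · obtain ⟨a1, a2, a3, a4, a5⟩ := hmin δ hδ'
    refine ⟨hM, hc, hC, hC', hx.M_nonneg, hδ, ?_, hx.bd, hy.bd, fun r N hr hrδ p1 p2 =>
      (h1 δ r N hr hrδ a1 p1 p2).1, fun R X Y hcv x hx y hy l u => h2 ⟨δ, R, X, Y, x, y, hδ, hcv, hx, hy, l, u⟩ a2,
      fun R R' X Y X' Y' x y e₀ e₁ => h3 δ R R' X Y X' Y' x y e₀ e₁ hδ a3⟩
    have b1 : C * δ ≤ 1 / 200 := by
      rw [le_div_iff₀ (by positivity)] at a5; linarith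
    have b2 : δ ≤ 1 := by nlinarith
    nlinarith
  · obtain ⟨a1, a2, a3, a4, a5⟩ := hmin δ hδ'
    obtain ⟨b1, b2⟩ := h1 δ δ N hδ le_rfl a1 hN1 hN2
    have hz' : z ∈ strip (2 * δ) := strip_mono (by linarith) hz
    have := h4 δ (2 * δ) (tr a N) (tr b N) z ω hδ a4 b1 hz' (b2 z hz') low upp
    simpa [stE, stG, lft, ← sub_eq_add_neg] using this

/-- Positive measure of rotation numbers with an invariant circle, arbitrarily close to zero. -/
theorem kam (hx : Cf M₀ a x) (hy : Cf M₀ b y) (hk : ∀ t, x 1 t * y 2 t - y 1 t * x 2 t = c)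
    (hc : 0 < c) {ε : ℝ} (hε : 0 < ε) : ∃ δ, 0 < δ ∧ δ < ε ∧ RBd x y δ ∧ ∃ D : Set ℝ, IsCompact D ∧
      D ⊆ Set.Icc δ (2 * δ) ∧ 0 < volume D ∧ ∀ ω ∈ D, ∃ u, InvU x y ω u := by
  obtain ⟨M, C, C', δ₀, hδ₀, hE, C₂, hC₂⟩ := exists_env hx hy hk hc
  obtain ⟨K₀, hK₀, hdio⟩ := exists_dio
  have E0 := hE δ₀ hδ₀ le_rfl
  set K := 16 * K₀ with hK
  have hKK : 1 ≤ K := by linarith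
  set A₁ := 16000 * K ^ 2
  set A₂ := 60000 * 2 ^ 26 * C * K ^ 4
  set A₃ := 8 * 2 ^ 26 * C' * rexp 4 * M₀
  have p1 : 0 ≤ A₁ := by positivity
  have p2 : 0 ≤ A₂ := by have := E0.hC; positivity
  have p3 : 0 ≤ A₃ := by have := E0.hC'; have := E0.hM₀; positivity
  have p4 : 0 < 1 / δ₀ := by positivity
  have p5 : 0 < 2 / ε := by positivity
  set L := A₁ + A₂ + A₃ + |C₂| + 1 / δ₀ + 2 / ε + 1 with hL
  have hL0 : 0 < L := by positivity
  have p6 := abs_nonneg C₂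
  have hν : 0 < 1 / L := by positivity
  have small : ∀ A, A ≤ L → A * (1 / L) ≤ 1 := fun A hA => by rw [mul_one_div, div_le_one hL0]; exact hA
  have hν1 : 1 / L ≤ 1 := by simpa using small 1 (by linarith)
  set ν := 1 / L
  have hp : ν ^ 10 ≤ ν := pow_le_of_le_one hν.le hν1 (by norm_num)
  have hp1 : ν ^ 10 ≤ 1 := hp.trans hν1
  have b1 : ν ^ 10 ≤ δ₀ := by
    have := small (1 / δ₀) (by linarith)
    rw [one_div_mul_eq_div, div_le_one hδ₀] at this
    exact hp.trans this
  have b2 : ν ^ 10 < ε := by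
    have := small (2 / ε) (by linarith)
    rw [div_mul_eq_mul_div, div_le_one hε] at this
    linarith
  have EE := hE (ν ^ 10) (by positivity) b1
  obtain ⟨D, hDc, hDs, hDv, hDd⟩ := hdio (ν ^ 10) (by positivity) hp1
  refine ⟨ν ^ 10, by positivity, b2, EE.rBd hx hy, D, hDc, hDs, hDv, fun ω hω => ?_⟩
  refine exists_invU (K := K) hx hy EE hν hν1 (hDs hω).1 (hDs hω).2 hKK (fun j => ?_)
    (small A₁ (by linarith)) (small A₂ (by linarith)) (small A₃ (by linarith)) fun N hN1 hN2 z hz => ?_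
  · have h1 := hDd ω hω j
    have e : ((1 / 32 : ℝ)) ^ j = ((1 / 2) ^ j) ^ 5 := by
      rw [← pow_mul, mul_comm j 5, pow_mul]; norm_num
    rw [e] at h1
    exact ⟨h1.ne, h1.sum, h1.le.trans (dio_exponent_le (by linarith) hν (by positivity))⟩
  · refine (hC₂ (ν ^ 10) ω N (by positivity) b1 (hDs hω).1 (hDs hω).2 hN1 hN2 z hz).trans ?_
    have := small |C₂| (by linarith)
    calc C₂ * (ν ^ 10) ^ 4 ≤ |C₂| * (ν ^ 10) ^ 4 := by gcongr; exact le_abs_self _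
      _ = |C₂| * ν * ν ^ 39 := by ring
      _ ≤ 1 * ν ^ 39 := by gcongr
      _ = _ := one_mul _
end
end DualBilliard

namespace DualBilliard
open Filter Topology

/-- A strictly ordered family of graphs over a set of parameters of positive measure, whose gaps are
bounded below on average, fills a set of positive area. -/
theorem volume_graphs_pos {D : Set ℝ} (hDc : IsCompact D) (hD : 0 < volume D) {A B c : ℝ} (hAB : A ≤ B)
    (hc : 0 < c) {F : ℝ → ℝ → ℝ} (hF : ∀ ω ∈ D, Continuous (F ω))
    (hmono : ∀ ω₁ ∈ D, ∀ ω₂ ∈ D, ω₁ < ω₂ → ∀ y, F ω₁ y < F ω₂ y)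
    (hlow : ∀ ω₁ ∈ D, ∀ ω₂ ∈ D, ω₁ < ω₂ → c * (ω₂ - ω₁) ≤ ∫ y in A..B, (F ω₂ y - F ω₁ y))
    (hunif : ∀ ε > 0, ∃ η > 0, ∀ ω₁ ∈ D, ∀ ω₂ ∈ D, |ω₂ - ω₁| < η → ∀ y ∈ Set.Icc A B, |F ω₂ y - F ω₁ y| < ε) :
    0 < volume {p : ℝ × ℝ | p.1 ∈ Set.Icc A B ∧ ∃ ω ∈ D, p.2 = F ω p.1} := by
  rw [pos_iff_ne_zero]
  intro h0
  set S := {p : ℝ × ℝ | p.1 ∈ Set.Icc A B ∧ ∃ ω ∈ D, p.2 = F ω p.1} with hS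
  have hc' : 0 < ENNReal.ofReal c := ENNReal.ofReal_pos.2 hc
  obtain ⟨U, hSU, hU, hUv⟩ := S.exists_isOpen_lt_of_lt (μ := volume) (ENNReal.ofReal c * volume D)
    (by rw [h0]; exact ENNReal.mul_pos hc'.ne' hD.ne')
  have hmono' : ∀ ω₁ ∈ D, ∀ ω₂ ∈ D, ω₁ ≤ ω₂ → ∀ y, F ω₁ y ≤ F ω₂ y := fun ω₁ h1 ω₂ h2 h y => by
    rcases h.lt_or_eq with h | rfl
    exacts [(hmono _ h1 _ h2 h y).le, le_rfl]
  have hnear : ∀ ω ∈ D, ∃ ε > 0, ∀ y ∈ Set.Icc A B, ∀ w, |w - F ω y| < ε → (y, w) ∈ U := fun ω hω => by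
    have hK : IsCompact ((fun y => (y, F ω y)) '' Set.Icc A B) :=
      isCompact_Icc.image (continuous_id.prodMk (hF ω hω))
    obtain ⟨ε, hε, h⟩ := hK.exists_thickening_subset_open hU (by
      rintro _ ⟨y, hy, rfl⟩
      exact hSU ⟨hy, ω, hω, rfl⟩)
    refine ⟨ε, hε, fun y hy w hw => h (Metric.mem_thickening_iff.2 ⟨_, ⟨y, hy, rfl⟩, ?_⟩)⟩
    simpa [Prod.dist_eq, Real.dist_eq, hε] using hw
  choose! e he0 he using hnear
  have hη : ∀ ω ∈ D, ∃ η > 0, ∀ ω' ∈ D, |ω' - ω| < η → ∀ y ∈ Set.Icc A B, |F ω' y - F ω y| < e ω := fun ω hω => by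
    obtain ⟨η, h1, h2⟩ := hunif (e ω) (he0 ω hω)
    exact ⟨η, h1, fun ω' hω' => h2 ω hω ω' hω'⟩
  choose! η hη0 hη using hη
  obtain ⟨d, hd, hleb⟩ := lebesgue_number_lemma_of_metric hDc (ι := D) (c := fun ω => Metric.ball ω.1 (η ω.1))
    (fun _ => Metric.isOpen_ball) fun ω hω => Set.mem_iUnion.2 ⟨⟨ω, hω⟩, Metric.mem_ball_self (hη0 ω hω)⟩
  obtain ⟨a, ha⟩ := hDc.bddBelow
  obtain ⟨b, hb⟩ := hDc.bddAbove
  set h := d / 2 with hh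
  have hh0 : 0 < h := by positivity
  set I : ℕ → Set ℝ := fun k => D ∩ Set.Icc (a + k * h) (a + (k + 1) * h) with hI
  have hreg : ∀ k, ∃ R : Set (ℝ × ℝ), MeasurableSet R ∧ R ⊆ U ∧ ENNReal.ofReal c * volume (I k) ≤ volume R ∧
      ∀ p ∈ R, ∃ ω₁ ∈ I k, ∃ ω₂ ∈ I k, F ω₁ p.1 < p.2 ∧ p.2 < F ω₂ p.1 := fun k => by
    rcases (I k).eq_empty_or_nonempty with h0 | hne
    · exact ⟨∅, MeasurableSet.empty, Set.empty_subset _, by simp [h0], by simp⟩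
    have hIc : IsCompact (I k) := hDc.inter_right isClosed_Icc
    have hα := hIc.sInf_mem hne
    have hβ := hIc.sSup_mem hne
    set α := sInf (I k)
    set β := sSup (I k)
    have hsub : I k ⊆ Set.Icc α β := fun ω hω => ⟨csInf_le hIc.bddBelow hω, le_csSup hIc.bddAbove hω⟩
    have hαβ : α ≤ β := (hsub hα).2
    refine ⟨regionBetween (F α) (F β) (Set.Ioc A B), measurableSet_regionBetween (hF α hα.1).measurable
      (hF β hβ.1).measurable measurableSet_Ioc, ?_, ?_, fun p hp => ⟨α, hα, β, hβ, hp.2⟩⟩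
    · rintro ⟨y, w⟩ ⟨hy, hw⟩
      have hy' := Set.Ioc_subset_Icc_self hy
      obtain ⟨⟨ω, hω⟩, hball⟩ := hleb α hα.1
      have m1 := hball (Metric.mem_ball_self hd)
      have m2 : β ∈ Metric.ball α d := by
        rw [Metric.mem_ball, Real.dist_eq, abs_of_nonneg (by linarith)]
        have := hα.2.1
        have := hβ.2.2
        linarith
      have n1 := hη ω hω α hα.1 m1 y hy'
      have n2 := hη ω hω β hβ.1 (hball m2) y hy'
      have hw' : F α y < w ∧ w < F β y := hw
      refine he ω hω y hy' w (abs_lt.2 ⟨?_, ?_⟩)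
      · linarith [(abs_lt.1 n1).1]
      · linarith [(abs_lt.1 n2).2]
    · rcases hαβ.lt_or_eq with hlt | heq
      · rw [Measure.volume_eq_prod, volume_regionBetween_eq_integral
          ((hF α hα.1).integrableOn_Ioc) ((hF β hβ.1).integrableOn_Ioc) measurableSet_Ioc
          fun y _ => hmono' α hα.1 β hβ.1 hαβ y]
        calc ENNReal.ofReal c * volume (I k) ≤ ENNReal.ofReal c * volume (Set.Icc α β) := by gcongr
          _ = ENNReal.ofReal (c * (β - α)) := by rw [Real.volume_Icc, ENNReal.ofReal_mul hc.le]
          _ ≤ _ := ENNReal.ofReal_le_ofReal (by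
            have := hlow α hα.1 β hβ.1 hlt
            rwa [intervalIntegral.integral_of_le hAB] at this)
      · have : volume (I k) = 0 := measure_mono_null hsub (by rw [Real.volume_Icc, heq]; simp)
        simp [this]
  choose R hRm hRU hRv hR using hreg
  obtain ⟨n, hn⟩ := exists_nat_ge ((b - a) / h)
  have hcov : D ⊆ ⋃ k ∈ Finset.range (n + 1), I k := fun ω hω => by
    have h1 : 0 ≤ (ω - a) / h := div_nonneg (sub_nonneg.2 (ha hω)) hh0.le
    have h2 : (ω - a) / h ≤ n := le_trans (by have := hb hω; gcongr) hn
    have h3 := Nat.floor_le h1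
    have h4 := (Nat.lt_floor_add_one ((ω - a) / h)).le
    rw [le_div_iff₀ hh0] at h3
    rw [div_le_iff₀ hh0] at h4
    refine Set.mem_biUnion (x := ⌊(ω - a) / h⌋₊) ?_ ⟨hω, by linarith, by linarith⟩
    simp only [Finset.coe_range, Set.mem_Iio, Nat.lt_succ_iff]
    exact Nat.floor_le_of_le h2
  have hdisj : ∀ k l, k < l → Disjoint (R k) (R l) := fun k l hkl => by
    rw [Set.disjoint_left]
    intro p hp hp'
    obtain ⟨-, -, ω₂, h2, -, h3⟩ := hR k p hp
    obtain ⟨ω₁, h1, -, -, h4, -⟩ := hR l p hp'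
    have h5 : ω₂ ≤ ω₁ := by
      refine h2.2.2.trans (le_trans ?_ h1.2.1)
      have : (k : ℝ) + 1 ≤ l := by exact_mod_cast hkl
      gcongr
    linarith [hmono' ω₂ h2.1 ω₁ h1.1 h5 p.1]
  have : ENNReal.ofReal c * volume D ≤ volume U := by
    calc _ ≤ ENNReal.ofReal c * ∑ k ∈ Finset.range (n + 1), volume (I k) := by
          gcongr; exact (measure_mono hcov).trans (measure_biUnion_finset_le _ _)
      _ = ∑ k ∈ Finset.range (n + 1), ENNReal.ofReal c * volume (I k) := Finset.mul_sum _ _ _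
      _ ≤ ∑ k ∈ Finset.range (n + 1), volume (R k) := Finset.sum_le_sum fun k _ => hRv k
      _ = volume (⋃ k ∈ Finset.range (n + 1), R k) := by
          refine (measure_biUnion_finset (fun k _ l _ hkl => ?_) fun k _ => hRm k).symm
          rcases lt_or_gt_of_ne hkl with h | h
          exacts [hdisj k l h, (hdisj l k h).symm]
      _ ≤ _ := measure_mono (Set.iUnion₂_subset fun k _ => hRU k)
  exact absurd hUv (not_lt.2 this)
end DualBilliard

namespace DualBilliard
open Filter Topology

section
variable {x y : ℕ → ℝ → ℝ} {ω : ℝ} {u : ℝ → ℝ}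

lemma InvU.strictMono (h : InvU x y ω u) : StrictMono u := fun s t hst => by
  have := h.low s t hst.le; linarith

lemma InvU.abs_sub_le (h : InvU x y ω u) (s t : ℝ) : |u t - u s| ≤ 11 / 10 * |t - s| := by
  rcases le_total s t with hst | hst
  · rw [abs_of_nonneg (by linarith [h.low s t hst]), abs_of_nonneg (by linarith)]
    exact h.upp s t hst
  · rw [abs_sub_comm, abs_sub_comm t, abs_of_nonneg (by linarith [h.low t s hst]),
      abs_of_nonneg (by linarith)]
    exact h.upp t s hst

lemma InvU.continuous (h : InvU x y ω u) : Continuous u := by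
  refine (LipschitzWith.of_dist_le_mul (K := ⟨11 / 10, by norm_num⟩) fun s t => ?_).continuous
  rw [Real.dist_eq, Real.dist_eq]; exact h.abs_sub_le t s

lemma InvU.per_int (h : InvU x y ω u) (t : ℝ) (k : ℤ) : u (t + k * (2 * π)) = u t + k * (2 * π) := by
  induction k using Int.induction_on with
  | zero => simp
  | succ k ih =>
    have := h.per (t + k * (2 * π)); push_cast at ih ⊢
    rw [show t + ((k : ℝ) + 1) * (2 * π) = t + k * (2 * π) + 2 * π by ring, this, ih]; ring
  | pred k ih =>
    have := h.per (t + (-k - 1) * (2 * π)); push_cast at ih ⊢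
    rw [show t + (-(k : ℝ) - 1) * (2 * π) + 2 * π = t + -k * (2 * π) by ring, ih] at this; linarith

lemma InvU.abs_sub_self_le (h : InvU x y ω u) (t : ℝ) : |u t - t - u 0| ≤ 1 := by
  have hp := Real.pi_pos
  have hp' := Real.pi_lt_four
  set k := ⌊t / (2 * π)⌋
  have h1 : (k : ℝ) * (2 * π) ≤ t := by
    have := Int.floor_le (t / (2 * π)); rwa [le_div_iff₀ (by positivity)] at this
  have h2 : t < (k + 1) * (2 * π) := by
    have := Int.lt_floor_add_one (t / (2 * π)); rwa [div_lt_iff₀ (by positivity)] at this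
  have e := h.per_int (t - k * (2 * π)) k
  rw [sub_add_cancel] at e
  have l := h.low 0 (t - k * (2 * π)) (by linarith)
  have l' := h.upp 0 (t - k * (2 * π)) (by linarith)
  rw [abs_le]
  constructor <;> linarith

lemma InvU.surjective (h : InvU x y ω u) : Function.Surjective u := by
  intro z
  have h1 := abs_le.1 (h.abs_sub_self_le (z - u 0 - 1))
  have h2 := abs_le.1 (h.abs_sub_self_le (z - u 0 + 1))
  obtain ⟨t, -, ht⟩ := intermediate_value_Icc (by linarith) h.continuous.continuousOn
    (show z ∈ Set.Icc (u (z - u 0 - 1)) (u (z - u 0 + 1)) from ⟨by linarith, by linarith⟩)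
  exact ⟨t, ht⟩

/-- The inverse of the parametrisation `u`. -/
structure InvH (u h : ℝ → ℝ) : Prop where
  uh : ∀ z, u (h z) = z
  hu : ∀ t, h (u t) = t
  per : ∀ z, h (z + 2 * π) = h z + 2 * π
  low : ∀ s t, s ≤ t → 10 / 11 * (t - s) ≤ h t - h s
  upp : ∀ s t, s ≤ t → h t - h s ≤ 10 / 9 * (t - s)

lemma InvU.exists_invH (hU : InvU x y ω u) : ∃ h, InvH u h := by
  choose h hh using hU.surjective
  have hu : ∀ t, h (u t) = t := fun t => hU.strictMono.injective (hh _)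
  have mono : ∀ s t, s ≤ t → h s ≤ h t := fun s t hst => by
    rw [← hU.strictMono.le_iff_le, hh, hh]; exact hst
  refine ⟨h, hh, hu, fun z => ?_, fun s t hst => ?_, fun s t hst => ?_⟩
  · apply hU.strictMono.injective; rw [hh, hU.per, hh]
  · have := hU.upp _ _ (mono s t hst); rw [hh, hh] at this; linarith
  · have := hU.low _ _ (mono s t hst); rw [hh, hh] at this; linarith

lemma InvH.lipschitz {h : ℝ → ℝ} (H : InvH u h) : LipschitzWith (10 / 9) h := by
  refine LipschitzWith.of_dist_le_mul fun s t => ?_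
  rw [Real.dist_eq, Real.dist_eq]
  push_cast
  rcases le_total s t with hst | hst
  · rw [abs_sub_comm, abs_sub_comm s, abs_of_nonneg (by linarith [H.low s t hst]),
      abs_of_nonneg (by linarith)]
    exact H.upp s t hst
  · rw [abs_of_nonneg (by linarith [H.low t s hst]), abs_of_nonneg (by linarith)]
    exact H.upp t s hst

/-- Change of variables inequality along a parametrisation. -/
lemma InvU.integral_comp_le (hU : InvU x y ω u) {h : ℝ → ℝ} (H : InvH u h) {f : ℝ → ℝ}
    (hf : Continuous f) (h0 : ∀ z, 0 ≤ f z) :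
    ∫ t in h 0..h 0 + 2 * π, f (u t) ≤ 10 / 9 * ∫ z in (0 : ℝ)..2 * π, f z := by
  have hp := Real.pi_pos
  have hmap : (volume.map u : Measure ℝ) ≤ ENNReal.ofReal (10 / 9) • (volume : Measure ℝ) := by
    refine Measure.le_iff.2 fun A hA => ?_
    rw [Measure.map_apply hU.continuous.measurable hA, Measure.smul_apply, smul_eq_mul]
    have e : u ⁻¹' A = h '' A := by
      ext t; constructor
      · intro ht; exact ⟨u t, ht, H.hu t⟩
      · rintro ⟨z, hz, rfl⟩; simpa [H.uh] using hz
    have := H.lipschitz.hausdorffMeasure_image_le (d := 1) zero_le_one A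
    rw [e, ← hausdorffMeasure_real]
    refine this.trans (le_of_eq ?_)
    rw [ENNReal.rpow_one]
    congr 1
    rw [ENNReal.ofReal, Real.toNNReal_of_nonneg (by norm_num)]
    congr 1
  have hs : Set.Ioc (h 0) (h 0 + 2 * π) = u ⁻¹' Set.Ioc 0 (2 * π) := by
    have hh : h 0 + 2 * π = h (2 * π) := by rw [← H.per, zero_add]
    rw [hh]
    ext t
    simp only [Set.mem_Ioc, Set.mem_preimage]
    rw [← hU.strictMono.lt_iff_lt, ← hU.strictMono.le_iff_le (b := h (2 * π)), H.uh, H.uh]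
  rw [intervalIntegral.integral_of_le (by linarith), intervalIntegral.integral_of_le (by linarith), hs,
    ← MeasureTheory.setIntegral_map (g := u) (f := f) measurableSet_Ioc hf.aestronglyMeasurable
      hU.continuous.aemeasurable]
  calc ∫ z in Set.Ioc 0 (2 * π), f z ∂(volume.map u)
      ≤ ∫ z in Set.Ioc 0 (2 * π), f z ∂(ENNReal.ofReal (10 / 9) • (volume : Measure ℝ)) := by
        refine integral_mono_measure (Measure.restrict_mono le_rfl hmap)
          (Eventually.of_forall h0) ?_
        rw [Measure.restrict_smul]
        refine Integrable.smul_measure ?_ ENNReal.ofReal_ne_top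
        exact (hf.integrableOn_Icc (a := 0) (b := 2 * π)).mono_set Set.Ioc_subset_Icc_self
    _ = _ := by
        rw [Measure.restrict_smul, integral_smul_measure, ENNReal.toReal_ofReal (by norm_num)]
        rfl
end
end DualBilliard

namespace DualBilliard
open Filter Topology

section
variable {x y : ℕ → ℝ → ℝ} {δ : ℝ}

lemma RBd.rG_inj (hB : RBd x y δ) {s t t' : ℝ} (h1 : s + δ / 2 ≤ t) (h2 : t ≤ s + 4 * δ)
    (h1' : s + δ / 2 ≤ t') (h2' : t' ≤ s + 4 * δ) (e : rG x y s t = rG x y s t') : t = t' := by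
  rcases le_total t t' with h | h
  · have := abs_le.1 (hB.lip s t t' h1 h h2'); linarith
  · have := abs_le.1 (hB.lip s t' t h1' h h2); linarith

section
variable {ω : ℝ} {u : ℝ → ℝ}

lemma InvU.step_low (h : InvU x y ω u) (hδ : 0 < δ) (hω : ω ∈ Set.Icc δ (2 * δ)) (t : ℝ) :
    u t + δ / 2 ≤ u (t + ω) := by
  have := h.low t (t + ω) (by linarith [hω.1]); linarith [hω.1]

lemma InvU.step_upp (h : InvU x y ω u) (hδ : 0 < δ) (hω : ω ∈ Set.Icc δ (2 * δ)) (t : ℝ) :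
    u (t + ω) ≤ u t + 4 * δ := by
  have := h.upp t (t + ω) (by linarith [hω.1]); linarith [hω.2]
end

variable {ω₁ ω₂ : ℝ} {u₁ u₂ h₁ h₂ : ℝ → ℝ} (hB : RBd x y δ) (hδ : 0 < δ)
  (hω₁ : ω₁ ∈ Set.Icc δ (2 * δ)) (hω₂ : ω₂ ∈ Set.Icc δ (2 * δ))
  (U₁ : InvU x y ω₁ u₁) (U₂ : InvU x y ω₂ u₂)
include hB hδ hω₁ hω₂ U₁ U₂

lemma rotation_eq_of_meet {t₁ t₂ : ℝ} (h0 : u₁ t₁ = u₂ t₂) (h1 : u₁ (t₁ + ω₁) = u₂ (t₂ + ω₂)) :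
    ω₁ = ω₂ := by
  have key : ∀ n : ℕ, u₁ (t₁ + n * ω₁) = u₂ (t₂ + n * ω₂) ∧
      u₁ (t₁ + (n + 1) * ω₁) = u₂ (t₂ + (n + 1) * ω₂) := by
    intro n
    induction n with
    | zero => simp [h0, h1]
    | succ n ih =>
      push_cast
      refine ⟨ih.2, ?_⟩
      have e1 := U₁.eq (t₁ + (n + 1) * ω₁)
      have e2 := U₂.eq (t₂ + (n + 1) * ω₂)
      rw [show t₁ + ((n : ℝ) + 1) * ω₁ - ω₁ = t₁ + n * ω₁ by ring,
        show t₁ + ((n : ℝ) + 1) * ω₁ + ω₁ = t₁ + (n + 1 + 1) * ω₁ by ring] at e1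
      rw [show t₂ + ((n : ℝ) + 1) * ω₂ - ω₂ = t₂ + n * ω₂ by ring,
        show t₂ + ((n : ℝ) + 1) * ω₂ + ω₂ = t₂ + (n + 1 + 1) * ω₂ by ring, ← ih.1, ← ih.2] at e2
      have a1 := U₁.step_low hδ hω₁ (t₁ + (n + 1) * ω₁)
      have a2 := U₁.step_upp hδ hω₁ (t₁ + (n + 1) * ω₁)
      have b1 := U₂.step_low hδ hω₂ (t₂ + (n + 1) * ω₂)
      have b2 := U₂.step_upp hδ hω₂ (t₂ + (n + 1) * ω₂)
      rw [show t₁ + ((n : ℝ) + 1) * ω₁ + ω₁ = t₁ + (n + 1 + 1) * ω₁ by ring] at a1 a2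
      rw [show t₂ + ((n : ℝ) + 1) * ω₂ + ω₂ = t₂ + (n + 1 + 1) * ω₂ by ring, ← ih.2] at b1 b2
      exact hB.rG_inj a1 a2 b1 b2 (by linarith)
  by_contra hne
  have hpos : 0 < |ω₁ - ω₂| := abs_pos.2 (sub_ne_zero.2 hne)
  obtain ⟨n, hn⟩ := exists_nat_gt ((|u₁ 0| + |u₂ 0| + |t₁| + |t₂| + 2) / |ω₁ - ω₂|)
  rw [div_lt_iff₀ hpos] at hn
  have e := (key n).1
  have a := abs_le.1 (U₁.abs_sub_self_le (t₁ + n * ω₁))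
  have b := abs_le.1 (U₂.abs_sub_self_le (t₂ + n * ω₂))
  have : (n : ℝ) * |ω₁ - ω₂| = |n * ω₁ - n * ω₂| := by
    rw [← mul_sub, abs_mul, Nat.abs_cast]
  rw [this] at hn
  have c1 := abs_le.1 (le_refl |u₁ 0|)
  have c2 := abs_le.1 (le_refl |u₂ 0|)
  have c3 := abs_le.1 (le_refl |t₁|)
  have c4 := abs_le.1 (le_refl |t₂|)
  rcases le_total 0 (n * ω₁ - n * ω₂) with h | h
  · rw [abs_of_nonneg h] at hn; linarith
  · rw [abs_of_nonpos h] at hn; linarith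

variable (H₁ : InvH u₁ h₁) (H₂ : InvH u₂ h₂)
include H₁ H₂

omit hB hδ hω₁ hω₂ U₁ H₂ in
lemma integral_gap : ∫ t in (0 : ℝ)..2 * π, (h₁ (u₂ (t + ω₂)) - h₁ (u₂ t) - ω₁) = 2 * π * (ω₂ - ω₁) := by
  have hc : Continuous fun t => h₁ (u₂ t) - t :=
    (H₁.lipschitz.continuous.comp U₂.continuous).sub continuous_id
  have hper : Function.Periodic (fun t => h₁ (u₂ t) - t) (2 * π) := fun t => by
    simp only [U₂.per, H₁.per]; ring
  have e : ∀ t, h₁ (u₂ (t + ω₂)) - h₁ (u₂ t) - ω₁ =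
      (fun t => h₁ (u₂ t) - t) (t + ω₂) - (fun t => h₁ (u₂ t) - t) t + (ω₂ - ω₁) := fun t => by
    simp only; ring
  simp_rw [e]
  rw [intervalIntegral.integral_add, intervalIntegral.integral_sub,
    intervalIntegral.integral_comp_add_right (fun t => h₁ (u₂ t) - t),
    intervalIntegral.integral_const]
  · have := hper.intervalIntegral_add_eq (0 + ω₂) 0
    rw [zero_add, add_comm ω₂, zero_add] at this
    rw [zero_add, this, smul_eq_mul]; ring
  · exact (hc.comp (continuous_id.add continuous_const)).intervalIntegrable _ _
  · exact hc.intervalIntegrable _ _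
  · exact ((hc.comp (continuous_id.add continuous_const)).sub hc).intervalIntegrable _ _
  · exact continuous_const.intervalIntegrable _ _

lemma next_lt (hlt : ω₁ < ω₂) (z : ℝ) : u₁ (h₁ z + ω₁) < u₂ (h₂ z + ω₂) := by
  have hp := Real.pi_pos
  have hne : ∀ z, u₂ (h₂ z + ω₂) - u₁ (h₁ z + ω₁) ≠ 0 := fun z h => by
    refine hlt.ne (rotation_eq_of_meet hB hδ hω₁ hω₂ U₁ U₂ (t₁ := h₁ z) (t₂ := h₂ z) ?_ ?_)
    · rw [H₁.uh, H₂.uh]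
    · linarith
  have hcont : Continuous fun z => u₂ (h₂ z + ω₂) - u₁ (h₁ z + ω₁) :=
    (U₂.continuous.comp (H₂.lipschitz.continuous.add continuous_const)).sub
      (U₁.continuous.comp (H₁.lipschitz.continuous.add continuous_const))
  by_contra hz
  have hneg : ∀ z, u₂ (h₂ z + ω₂) - u₁ (h₁ z + ω₁) < 0 := by
    intro z'
    by_contra hz'
    obtain ⟨w, -, hw⟩ := isPreconnected_univ.intermediate_value₂ (Set.mem_univ z) (Set.mem_univ z')
      hcont.continuousOn (g := fun _ => (0 : ℝ)) continuousOn_const (by linarith) (by linarith)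
    exact hne w hw
  have h := integral_gap (ω₁ := ω₁) U₂ H₁
  have : ∫ t in (0 : ℝ)..2 * π, (h₁ (u₂ (t + ω₂)) - h₁ (u₂ t) - ω₁) ≤ ∫ t in (0 : ℝ)..2 * π, (0 : ℝ) := by
    refine intervalIntegral.integral_mono_on (by linarith) ?_ (by simp) fun t _ => ?_
    · refine Continuous.intervalIntegrable ?_ _ _
      have := H₁.lipschitz.continuous
      have := U₂.continuous
      fun_prop
    · have := hneg (u₂ t)
      rw [H₂.hu] at this
      have := H₁.low (u₂ (t + ω₂)) (u₁ (h₁ (u₂ t) + ω₁)) (by linarith)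
      rw [H₁.hu] at this
      linarith
  rw [h] at this
  simp only [intervalIntegral.integral_zero] at this
  nlinarith

lemma gap_le (hlt : ω₁ < ω₂) (t : ℝ) :
    9 / 10 * (h₁ (u₂ (t + ω₂)) - h₁ (u₂ t) - ω₁) ≤ u₂ (t + ω₂) - u₁ (h₁ (u₂ t) + ω₁) ∧
    u₂ (t + ω₂) - u₁ (h₁ (u₂ t) + ω₁) ≤ 11 / 10 * (h₁ (u₂ (t + ω₂)) - h₁ (u₂ t) - ω₁) ∧
    0 ≤ h₁ (u₂ (t + ω₂)) - h₁ (u₂ t) - ω₁ := by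
  have := next_lt hB hδ hω₁ hω₂ U₁ U₂ H₁ H₂ hlt (u₂ t)
  rw [H₂.hu] at this
  have a := H₁.low _ _ this.le
  have b := H₁.upp _ _ this.le
  rw [H₁.hu] at a b
  have e : h₁ (u₂ t) + ω₁ ≤ h₁ (u₂ (t + ω₂)) := by linarith
  have c := U₁.low _ _ e
  have d := U₁.upp _ _ e
  rw [H₁.uh] at c d
  refine ⟨by linarith, by linarith, by linarith⟩

lemma le_integral_gap (hlt : ω₁ < ω₂) :
    1 / 2 * (ω₂ - ω₁) ≤ ∫ z in (0 : ℝ)..2 * π, (u₂ (h₂ z + ω₂) - u₁ (h₁ z + ω₁)) := by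
  have hp := Real.pi_gt_three
  have c1 := H₁.lipschitz.continuous
  have c2 := H₂.lipschitz.continuous
  have c3 := U₁.continuous
  have c4 := U₂.continuous
  have h := U₂.integral_comp_le H₂ (f := fun z => u₂ (h₂ z + ω₂) - u₁ (h₁ z + ω₁)) (by fun_prop)
    fun z => by linarith [next_lt hB hδ hω₁ hω₂ U₁ U₂ H₁ H₂ hlt z]
  simp only [H₂.hu] at h
  have hper : Function.Periodic (fun t => h₁ (u₂ (t + ω₂)) - h₁ (u₂ t) - ω₁) (2 * π) := fun t => by
    simp only [U₂.per, H₁.per, show t + 2 * π + ω₂ = t + ω₂ + 2 * π by ring]; ring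
  have e := hper.intervalIntegral_add_eq (h₂ 0) 0
  rw [zero_add, integral_gap U₂ H₁] at e
  have m : ∫ t in h₂ 0..h₂ 0 + 2 * π, 9 / 10 * (h₁ (u₂ (t + ω₂)) - h₁ (u₂ t) - ω₁) ≤
      ∫ t in h₂ 0..h₂ 0 + 2 * π, (u₂ (t + ω₂) - u₁ (h₁ (u₂ t) + ω₁)) := by
    refine intervalIntegral.integral_mono_on (by linarith)
      (Continuous.intervalIntegrable (by fun_prop) _ _) (Continuous.intervalIntegrable (by fun_prop) _ _)
      fun t _ => (gap_le hB hδ hω₁ hω₂ U₁ U₂ H₁ H₂ hlt t).1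
  rw [intervalIntegral.integral_const_mul, e] at m
  nlinarith

/-- The gap between two invariant curves tends to zero with the difference of rotation numbers. -/
lemma gap_lt {η : ℝ} (hη : 0 < η) (hη1 : η ≤ 1) (hlt : ω₁ < ω₂) (hd : ω₂ - ω₁ < η ^ 2 / 400) (z : ℝ) :
    u₂ (h₂ z + ω₂) - u₁ (h₁ z + ω₁) < 2 * η := by
  have hp := Real.pi_gt_three
  have hp' := Real.pi_lt_four
  have c1 := H₁.lipschitz.continuous
  have c4 := U₂.continuous
  set g := fun t => h₁ (u₂ (t + ω₂)) - h₁ (u₂ t) - ω₁ with hg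
  have hgc : Continuous g := by simp only [hg]; fun_prop
  have hgap := gap_le hB hδ hω₁ hω₂ U₁ U₂ H₁ H₂ hlt
  have lip : ∀ s t, s ≤ t → g s - 5 / 2 * (t - s) ≤ g t := by
    intro s t hst
    have a1 := U₂.upp s t hst
    have a2 := U₂.low s t hst
    have a3 := U₂.low (s + ω₂) (t + ω₂) (by linarith)
    have b1 := H₁.upp (u₂ s) (u₂ t) (by linarith)
    have b3 := H₁.low (u₂ (s + ω₂)) (u₂ (t + ω₂)) (by linarith)
    simp only [hg]; linarith
  have hper : Function.Periodic g (2 * π) := fun t => by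
    simp only [hg, U₂.per, H₁.per, show t + 2 * π + ω₂ = t + ω₂ + 2 * π by ring]; ring
  set s := h₂ z
  have hs : u₂ s = z := H₂.uh z
  have hgs := hgap s
  rw [hs] at hgs
  by_contra hcon
  have hbig : η ≤ g s := by simp only [hg, hs]; linarith
  have e := hper.intervalIntegral_add_eq s 0
  rw [zero_add, integral_gap U₂ H₁, ← intervalIntegral.integral_add_adjacent_intervals (b := s + η / 5)
    (hgc.intervalIntegrable _ _) (hgc.intervalIntegrable _ _)] at e
  have i1 : ∫ t in s..s + η / 5, η / 2 ≤ ∫ t in s..s + η / 5, g t :=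
    intervalIntegral.integral_mono_on (by linarith) (by simp) (hgc.intervalIntegrable _ _)
      fun t ht => by have := lip s t ht.1; linarith [ht.2]
  have i2 : 0 ≤ ∫ t in s + η / 5..s + 2 * π, g t :=
    intervalIntegral.integral_nonneg (by linarith) fun t _ => (hgap t).2.2
  rw [intervalIntegral.integral_const, smul_eq_mul] at i1
  nlinarith
end
end DualBilliard

namespace DualBilliard
open Filter Topology

/-- The tangency and length parameters of all points on invariant circles have positive area. -/
theorem volume_circles_pos {x y : ℕ → ℝ → ℝ} {δ : ℝ} (hB : RBd x y δ) (hδ : 0 < δ)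
    (hx0 : Continuous (x 0)) (hx1 : Continuous (x 1)) (hy0 : Continuous (y 0)) (hy1 : Continuous (y 1))
    {D : Set ℝ} (hDc : IsCompact D) (hDs : D ⊆ Set.Icc δ (2 * δ)) (hD : 0 < volume D)
    (hU : ∀ ω ∈ D, ∃ u, InvU x y ω u) :
    0 < volume {p : ℝ × ℝ | p.1 ∈ Set.Icc 0 (2 * π) ∧ ∃ ω ∈ D, ∃ u, InvU x y ω u ∧
      ∃ t, u t = p.1 ∧ p.2 = rG x y (u t) (u (t + ω))} := by
  have hp := Real.pi_pos
  have hU' : ∀ ω, ∃ u : ℝ → ℝ, ω ∈ D → InvU x y ω u := fun ω => by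
    by_cases h : ω ∈ D
    · obtain ⟨u, hu⟩ := hU ω h; exact ⟨u, fun _ => hu⟩
    · exact ⟨id, fun h' => absurd h' h⟩
  choose u hu using hU'
  have hH' : ∀ ω, ∃ h : ℝ → ℝ, ω ∈ D → InvH (u ω) h := fun ω => by
    by_cases h : ω ∈ D
    · obtain ⟨h', hh⟩ := (hu ω h).exists_invH; exact ⟨h', fun _ => hh⟩
    · exact ⟨id, fun h' => absurd h' h⟩
  choose h hh using hH'
  have low : ∀ ω ∈ D, ∀ z, z + δ / 2 ≤ u ω (h ω z + ω) := fun ω hω z => by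
    have := (hu ω hω).step_low hδ (hDs hω) (h ω z); rwa [(hh ω hω).uh] at this
  have upp : ∀ ω ∈ D, ∀ z, u ω (h ω z + ω) ≤ z + 4 * δ := fun ω hω z => by
    have := (hu ω hω).step_upp hδ (hDs hω) (h ω z); rwa [(hh ω hω).uh] at this
  have lt : ∀ ω₁ ∈ D, ∀ ω₂ ∈ D, ω₁ < ω₂ → ∀ z, u ω₁ (h ω₁ z + ω₁) < u ω₂ (h ω₂ z + ω₂) :=
    fun ω₁ h₁ ω₂ h₂ hlt z =>
      next_lt hB hδ (hDs h₁) (hDs h₂) (hu _ h₁) (hu _ h₂) (hh _ h₁) (hh _ h₂) hlt z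
  have cF : ∀ ω ∈ D, Continuous fun z => u ω (h ω z + ω) := fun ω hω =>
    (hu ω hω).continuous.comp ((hh ω hω).lipschitz.continuous.add continuous_const)
  have cG : ∀ ω ∈ D, Continuous fun z => rG x y z (u ω (h ω z + ω)) := fun ω hω => by
    have c := cF ω hω
    refine Continuous.div
      ((((hx0.comp c).sub hx0).mul (hy1.comp c)).sub (((hy0.comp c).sub hy0).mul (hx1.comp c)))
      ((hx1.mul (hy1.comp c)).sub (hy1.mul (hx1.comp c))) fun z => hB.D _ _ ?_ ?_
    · rw [abs_of_nonneg] <;> linarith [low ω hω z]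
    · rw [abs_of_nonneg] <;> linarith [low ω hω z, upp ω hω z]
  have bG : ∀ ω₁ ∈ D, ∀ ω₂ ∈ D, ω₁ < ω₂ → ∀ z,
      1 / 4 * (u ω₂ (h ω₂ z + ω₂) - u ω₁ (h ω₁ z + ω₁)) ≤
        rG x y z (u ω₂ (h ω₂ z + ω₂)) - rG x y z (u ω₁ (h ω₁ z + ω₁)) ∧
      rG x y z (u ω₂ (h ω₂ z + ω₂)) - rG x y z (u ω₁ (h ω₁ z + ω₁)) ≤
        u ω₂ (h ω₂ z + ω₂) - u ω₁ (h ω₁ z + ω₁) := fun ω₁ h₁ ω₂ h₂ hlt z => by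
    have a := (lt ω₁ h₁ ω₂ h₂ hlt z).le
    have := abs_le.1 (hB.lip z _ _ (low ω₁ h₁ z) a (upp ω₂ h₂ z))
    constructor <;> linarith
  refine (volume_graphs_pos hDc hD (A := 0) (B := 2 * π) (c := 1 / 8) (by positivity) (by norm_num)
    (F := fun ω z => rG x y z (u ω (h ω z + ω))) cG ?_ ?_ ?_).trans_le (measure_mono ?_)
  · intro ω₁ h₁ ω₂ h₂ hlt z
    linarith [lt ω₁ h₁ ω₂ h₂ hlt z, (bG ω₁ h₁ ω₂ h₂ hlt z).1]
  · intro ω₁ h₁ ω₂ h₂ hlt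
    have a := le_integral_gap hB hδ (hDs h₁) (hDs h₂) (hu _ h₁) (hu _ h₂) (hh _ h₁) (hh _ h₂) hlt
    have b := intervalIntegral.integral_mono_on (a := 0) (b := 2 * π) (μ := volume) (by linarith)
      ((((cF ω₂ h₂).sub (cF ω₁ h₁)).const_mul (1 / 4)).intervalIntegrable _ _)
      (((cG ω₂ h₂).sub (cG ω₁ h₁)).intervalIntegrable _ _) (fun z _ => (bG ω₁ h₁ ω₂ h₂ hlt z).1)
    rw [intervalIntegral.integral_const_mul] at b
    simp only [Pi.sub_apply] at b
    linarith
  · intro ε hε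
    set η := min 1 (ε / 2)
    have hη : 0 < η := lt_min one_pos (by linarith)
    have key : ∀ ω₁ ∈ D, ∀ ω₂ ∈ D, ω₁ < ω₂ → ω₂ - ω₁ < η ^ 2 / 400 → ∀ z,
        |rG x y z (u ω₂ (h ω₂ z + ω₂)) - rG x y z (u ω₁ (h ω₁ z + ω₁))| < ε := by
      intro ω₁ h₁ ω₂ h₂ hlt hd z
      have a := bG ω₁ h₁ ω₂ h₂ hlt z
      have b := gap_lt hB hδ (hDs h₁) (hDs h₂) (hu _ h₁) (hu _ h₂) (hh _ h₁) (hh _ h₂) hη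
        (min_le_left _ _) hlt hd z
      rw [abs_of_nonneg (by linarith [lt ω₁ h₁ ω₂ h₂ hlt z])]
      linarith [min_le_right 1 (ε / 2)]
    refine ⟨η ^ 2 / 400, by positivity, fun ω₁ h₁ ω₂ h₂ hd z _ => ?_⟩
    rcases lt_trichotomy ω₁ ω₂ with hlt | rfl | hlt
    · exact key ω₁ h₁ ω₂ h₂ hlt (lt_of_le_of_lt (le_abs_self _) hd) z
    · simpa using hε
    · rw [abs_sub_comm] at hd ⊢
      exact key ω₂ h₂ ω₁ h₁ hlt (lt_of_le_of_lt (le_abs_self _) hd) z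
  · rintro ⟨s, l⟩ ⟨hs, ω, hω, hl⟩
    refine ⟨hs, ω, hω, u ω, hu ω hω, h ω s, (hh ω hω).uh s, ?_⟩
    simp only at hl ⊢
    rw [hl, (hh ω hω).uh]

/-- Points with tangency parameter `s` at tangential distance proportional to `l`. -/
def tangentMap (x y : ℕ → ℝ → ℝ) (p : ℝ × ℝ) : ℝ × ℝ :=
  (x 0 p.1 - p.2 * x 1 p.1, y 0 p.1 - p.2 * y 1 p.1)

/-- Images of sets of positive area under the tangent map have positive area. -/
theorem volume_image_tangentMap_pos {x y : ℕ → ℝ → ℝ} {c : ℝ} (hc : 0 < c)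
    (hdx : ∀ m < 2, ∀ t, HasDerivAt (x m) (x (m + 1) t) t)
    (hdy : ∀ m < 2, ∀ t, HasDerivAt (y m) (y (m + 1) t) t)
    (hk : ∀ t, x 1 t * y 2 t - y 1 t * x 2 t = c)
    (hinj : Set.InjOn (tangentMap x y) (Set.Ioo 0 (2 * π) ×ˢ Set.Ioi 0))
    {S : Set (ℝ × ℝ)} (hS : S ⊆ Set.Icc 0 (2 * π) ×ˢ Set.Ioi 0) (hv : 0 < volume S) {Z : Set (ℝ × ℝ)}
    (hZ : Set.MapsTo (tangentMap x y) S Z) : 0 < volume Z := by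
  rw [pos_iff_ne_zero]
  intro h0
  have hcont : Continuous (tangentMap x y) := by
    have a : ∀ m < 2, Continuous (x m) := fun m hm => continuous_iff_continuousAt.2 fun t => (hdx m hm t).continuousAt
    have b : ∀ m < 2, Continuous (y m) := fun m hm => continuous_iff_continuousAt.2 fun t => (hdy m hm t).continuousAt
    have := a 0 (by norm_num); have := a 1 (by norm_num)
    have := b 0 (by norm_num); have := b 1 (by norm_num)
    unfold tangentMap; fun_prop
  set T := (Set.Ioo 0 (2 * π) ×ˢ Set.Ioi 0) ∩ tangentMap x y ⁻¹' (toMeasurable volume Z) with hT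
  have hTm : MeasurableSet T := (measurableSet_Ioo.prod measurableSet_Ioi).inter
    (hcont.measurable (measurableSet_toMeasurable _ _))
  set L : ℝ × ℝ → (ℝ × ℝ →L[ℝ] ℝ × ℝ) := fun p =>
    ((x 1 p.1 - p.2 * x 2 p.1) • ContinuousLinearMap.fst ℝ ℝ ℝ - x 1 p.1 • ContinuousLinearMap.snd ℝ ℝ ℝ).prod
    ((y 1 p.1 - p.2 * y 2 p.1) • ContinuousLinearMap.fst ℝ ℝ ℝ - y 1 p.1 • ContinuousLinearMap.snd ℝ ℝ ℝ) with hL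
  have hd : ∀ (f : ℕ → ℝ → ℝ), (∀ m < 2, ∀ t, HasDerivAt (f m) (f (m + 1) t) t) → ∀ p : ℝ × ℝ,
      HasFDerivAt (fun p : ℝ × ℝ => f 0 p.1 - p.2 * f 1 p.1)
        ((f 1 p.1 - p.2 * f 2 p.1) • ContinuousLinearMap.fst ℝ ℝ ℝ - f 1 p.1 • ContinuousLinearMap.snd ℝ ℝ ℝ) p := by
    intro f hf p
    have q : HasFDerivAt (fun p : ℝ × ℝ => p.1) (ContinuousLinearMap.fst ℝ ℝ ℝ) p := hasFDerivAt_fst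
    have a := (hf 0 (by norm_num) p.1).comp_hasFDerivAt p q
    have b := (hf 1 (by norm_num) p.1).comp_hasFDerivAt p q
    have := a.sub ((hasFDerivAt_snd (𝕜 := ℝ) (p := p)).mul b)
    refine this.congr_fderiv ?_
    ext <;> simp
  have hder : ∀ p ∈ T, HasFDerivWithinAt (tangentMap x y) (L p) T p := fun p _ =>
    ((hd x hdx p).prodMk (hd y hdy p)).hasFDerivWithinAt
  have hdet : ∀ p, (L p).det = -(p.2 * c) := by
    intro p
    have : (L p).det = LinearMap.det ((L p) : ℝ × ℝ →ₗ[ℝ] ℝ × ℝ) := rfl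
    rw [this, ← LinearMap.det_toMatrix (Module.Basis.finTwoProd ℝ), Matrix.det_fin_two]
    simp [LinearMap.toMatrix_apply, hL, ← hk p.1]
    ring
  have hint := lintegral_abs_det_fderiv_eq_addHaar_image volume hTm hder (hinj.mono Set.inter_subset_left)
  have himg : volume (tangentMap x y '' T) = 0 := by
    refine measure_mono_null (t := toMeasurable volume Z) ?_ (by rw [measure_toMeasurable, h0])
    rintro _ ⟨p, hp, rfl⟩; exact hp.2
  rw [himg] at hint
  have hTv : volume T = 0 := by
    have hm : Measurable fun p : ℝ × ℝ => ENNReal.ofReal |(L p).det| := by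
      simp_rw [hdet]; fun_prop
    have := (lintegral_eq_zero_iff hm).1 hint
    have h2 := (ae_restrict_iff' hTm).1 this
    rw [← nonpos_iff_eq_zero]
    have h3 : ∀ᵐ p ∂(volume : Measure (ℝ × ℝ)), p ∉ T := by
      filter_upwards [h2] with p hp hpT
      have := hp hpT
      rw [hdet] at this
      simp only [Pi.zero_apply, ENNReal.ofReal_eq_zero, abs_nonpos_iff, neg_eq_zero] at this
      have h4 : 0 < p.2 := hpT.1.2
      have : 0 < p.2 * c := by positivity
      linarith
    rw [ae_iff] at h3
    simpa using h3.le
  have hline : ∀ s : ℝ, volume ({s} ×ˢ Set.univ : Set (ℝ × ℝ)) = 0 := fun s => by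
    rw [Measure.volume_eq_prod, Measure.prod_prod]; simp
  refine hv.ne' (measure_mono_null (t := T ∪ ({0} ×ˢ Set.univ ∪ {2 * π} ×ˢ Set.univ)) ?_ ?_)
  · rintro ⟨s, l⟩ hp
    have h1 := hS hp
    by_cases e0 : s = 0
    · right; left; simp [e0]
    by_cases e1 : s = 2 * π
    · right; right; simp [e1]
    exact Or.inl ⟨⟨⟨lt_of_le_of_ne h1.1.1 (Ne.symm e0), lt_of_le_of_ne h1.1.2 e1⟩, h1.2⟩,
      subset_toMeasurable _ _ (hZ hp)⟩
  · exact measure_union_null hTv (measure_union_null (hline _) (hline _))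
end DualBilliard

namespace DualBilliard
open Filter Topology

/-- Fourier coefficients of a real function. -/
noncomputable def rfc (u : ℝ → ℝ) (k : ℤ) : ℂ := fc (fun z => (u z.re : ℂ)) k

lemma rfc_eq (u : ℝ → ℝ) (k : ℤ) : rfc u k =
    (1 / (2 * π)) * ∫ x in (0:ℝ)..(2 * π), (u x : ℂ) * Complex.exp (-(k * x * Complex.I)) := by
  simp [rfc, fc]

lemma rfc_neg (u : ℝ → ℝ) (k : ℤ) : rfc u (-k) = (starRingEnd ℂ) (rfc u k) := by
  rw [rfc_eq, rfc_eq, map_mul, ← intervalIntegral.intervalIntegral_conj]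
  congr 1
  · simp [Complex.conj_ofReal, Complex.conj_ofNat]
  · refine intervalIntegral.integral_congr fun x _ => ?_
    simp [← Complex.exp_conj, Complex.conj_ofReal]

lemma rfc_deriv {u u' : ℝ → ℝ} (hd : ∀ t, HasDerivAt u (u' t) t) (hc : Continuous u')
    (hp : u (2 * π) = u 0) (k : ℤ) : rfc u' k = k * Complex.I * rfc u k := by
  have hu : Continuous u := continuous_iff_continuousAt.2 fun t => (hd t).continuousAt
  have he : ∀ t : ℝ, HasDerivAt (fun t : ℝ => Complex.exp (-(k * t * Complex.I)))
      (Complex.exp (-(k * t * Complex.I)) * (-(k * Complex.I))) t := fun t => by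
    have h1 : HasDerivAt (fun t : ℝ => (t : ℂ)) 1 t := by
      simpa using (hasDerivAt_id t).ofReal_comp
    have := ((h1.const_mul (k : ℂ)).mul_const Complex.I).neg.cexp
    simpa using this
  have h0 := intervalIntegral.integral_eq_sub_of_hasDerivAt (a := 0) (b := 2 * π)
    (fun t _ => (hd t).ofReal_comp.mul (he t))
    (Continuous.intervalIntegrable (by fun_prop) _ _)
  have e1 : Complex.exp (-(k * ((2 * π : ℝ) : ℂ) * Complex.I)) = 1 := by
    rw [Complex.exp_eq_one_iff]; exact ⟨-k, by push_cast; ring⟩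
  simp only [Pi.mul_apply] at h0
  rw [e1, hp, intervalIntegral.integral_add (Continuous.intervalIntegrable (by fun_prop) _ _)
    (Continuous.intervalIntegrable (by fun_prop) _ _)] at h0
  have e2 : ∀ t : ℝ, (u t : ℂ) * (Complex.exp (-(k * t * Complex.I)) * (-(k * Complex.I))) =
      -(k * Complex.I) * ((u t : ℂ) * Complex.exp (-(k * t * Complex.I))) := fun t => by ring
  simp_rw [e2] at h0
  rw [intervalIntegral.integral_const_mul] at h0
  rw [rfc_eq, rfc_eq]
  simp only [Complex.ofReal_zero, mul_zero, zero_mul, neg_zero, Complex.exp_zero, sub_self] at h0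
  linear_combination (1 / (2 * π) : ℂ) * h0

lemma periodic_deriv {u u' : ℝ → ℝ} (hd : ∀ t, HasDerivAt u (u' t) t)
    (hp : ∀ t, u (t + 2 * π) = u t) (t : ℝ) : u' (t + 2 * π) = u' t := by
  have := (hd (t + 2 * π)).comp_add_const t (2 * π)
  simp_rw [hp] at this
  exact this.unique (hd t)

lemma exists_bound_of_periodic {u : ℝ → ℝ} (hc : Continuous u) (hp : ∀ t, u (t + 2 * π) = u t) :
    ∃ B, 0 ≤ B ∧ ∀ t, |u t| ≤ B := by
  obtain ⟨B, hB⟩ := isCompact_Icc.exists_bound_of_continuousOn (s := Set.Icc 0 (2 * π)) hc.continuousOn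
  refine ⟨B, (norm_nonneg _).trans (hB 0 ⟨le_rfl, by positivity⟩), fun t => ?_⟩
  obtain ⟨s, hs, e⟩ := Function.Periodic.exists_mem_Ico₀ (f := u) hp (by positivity) t
  rw [e]; exact hB s ⟨hs.1, hs.2.le⟩

/-- A periodic function of class `C⁷` satisfies the Fourier decay used by the iteration. -/
theorem exists_cf {g : ℕ → ℝ → ℝ} (hd : ∀ m < 7, ∀ t, HasDerivAt (g m) (g (m + 1) t) t)
    (hc : Continuous (g 7)) (hp : ∀ t, g 0 (t + 2 * π) = g 0 t) :
    ∃ M a, ∀ M', M ≤ M' → Cf M' a g := by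
  have hcm : ∀ m ≤ 7, Continuous (g m) := fun m hm => by
    rcases hm.lt_or_eq with h | rfl
    · exact continuous_iff_continuousAt.2 fun t => (hd m h t).continuousAt
    · exact hc
  have hpm : ∀ m ≤ 7, ∀ t, g m (t + 2 * π) = g m t := fun m => by
    induction m with
    | zero => exact fun _ => hp
    | succ m ih => exact fun hm => periodic_deriv (hd m (by omega)) (ih (by omega))
  have hk : ∀ m ≤ 7, ∀ k : ℤ, rfc (g m) k = (k * Complex.I) ^ m * rfc (g 0) k := fun m => by
    induction m with
    | zero => simp
    | succ m ih =>
      intro hm k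
      rw [rfc_deriv (hd m (by omega)) (hcm _ hm) (by simpa using hpm m (by omega) 0), ih (by omega),
        pow_succ']
      ring
  obtain ⟨B₀, hB₀, hb₀⟩ := exists_bound_of_periodic (hcm 0 (by norm_num)) (hpm 0 (by norm_num))
  obtain ⟨B₇, hB₇, hb₇⟩ := exists_bound_of_periodic hc (hpm 7 le_rfl)
  have n0 : ∀ k, ‖rfc (g 0) k‖ ≤ B₀ := norm_fc_le fun x => by simpa using hb₀ x
  have n7 : ∀ k, ‖rfc (g 7) k‖ ≤ B₇ := norm_fc_le fun x => by simpa using hb₇ x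
  have nk : ∀ k : ℤ, |(k : ℝ)| ^ 7 * ‖rfc (g 0) k‖ ≤ B₇ := fun k => by
    have := n7 k
    rw [hk 7 le_rfl, norm_mul, norm_pow, norm_mul, Complex.norm_I, mul_one] at this
    simpa using this
  have nk' : ∀ k : ℤ, ‖rfc (g 0) k‖ ≤ 2 ^ 7 * (B₀ + B₇) / (1 + |(k : ℝ)|) ^ 7 := fun k => by
    rw [le_div_iff₀ (by positivity)]
    rcases eq_or_ne k 0 with rfl | h
    · have := n0 0; simp; linarith
    · have h1 : (1 : ℝ) ≤ |(k : ℝ)| := by exact_mod_cast Int.one_le_abs h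
      calc ‖rfc (g 0) k‖ * (1 + |(k : ℝ)|) ^ 7 ≤ ‖rfc (g 0) k‖ * (2 * |(k : ℝ)|) ^ 7 := by
            gcongr; linarith
        _ = 2 ^ 7 * (|(k : ℝ)| ^ 7 * ‖rfc (g 0) k‖) := by ring
        _ ≤ _ := by have := nk k; gcongr; linarith
  set a : ℕ → ℂ := fun n => if n = 0 then rfc (g 0) 0 / 2 else rfc (g 0) n with ha
  have hadd : ∀ m ≤ 5, ∀ t : ℝ, HasSum (tm a m t) (g m t : ℂ) := by
    intro m hm t
    have hs : Summable (rfc (g m)) := by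
      have s1 : Summable fun k : ℤ => (2 * B₇) * ((|(k : ℝ)| ^ 2)⁻¹) + (if k = 0 then ‖rfc (g m) 0‖ else 0) := by
        refine Summable.add (Summable.mul_left _ ?_) (summable_of_ne_finset_zero (s := {0}) fun k hk => ?_)
        · simpa using Real.summable_one_div_int_pow.2 (one_lt_two)
        · simp at hk; simp [hk]
      refine Summable.of_norm_bounded s1 fun k => ?_
      rcases eq_or_ne k 0 with rfl | h
      · simp
      · have h1 : (1 : ℝ) ≤ |(k : ℝ)| := by exact_mod_cast Int.one_le_abs h
        rw [hk m (by omega), norm_mul, norm_pow, norm_mul, Complex.norm_I, mul_one, if_neg h, add_zero,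
          ← div_eq_mul_inv, le_div_iff₀ (by positivity)]
        have e : ‖(k : ℂ)‖ = |(k : ℝ)| := by simp
        rw [e]
        calc |(k : ℝ)| ^ m * ‖rfc (g 0) k‖ * |(k : ℝ)| ^ 2 = |(k : ℝ)| ^ (m + 2) * ‖rfc (g 0) k‖ := by ring
          _ ≤ |(k : ℝ)| ^ 7 * ‖rfc (g 0) k‖ := by
            gcongr ?_ * _
            exact pow_le_pow_right₀ h1 (by omega)
          _ ≤ B₇ := nk k
          _ ≤ _ := by linarith
    have := hasSum_fourier_of_continuous (f := fun z => (g m z.re : ℂ))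
      (Complex.continuous_ofReal.comp (hcm m (by omega))) (fun z => by
        have := hpm m (by omega) z.re
        simp [this]) hs t
    have h2 := this.nat_add_neg
    simp only [Complex.ofReal_re] at h2
    have h3 := h2.sub (hasSum_ite_eq 0 (fc (fun z => (g m z.re : ℂ)) (0 : ℤ)))
    simp only [Int.cast_zero, zero_mul, Complex.exp_zero, mul_one, add_sub_cancel_right] at h3
    have hc' : ∀ k, fc (fun z => (g m z.re : ℂ)) k = (k * Complex.I) ^ m * rfc (g 0) k := hk m (by omega)
    suffices h : tm a m t = _ by rw [h]; exact h3
    funext n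
    rcases Nat.eq_zero_or_pos n with rfl | hn
    · have r0 : (starRingEnd ℂ) (rfc (g 0) 0) = rfc (g 0) 0 := by simpa using (rfc_neg (g 0) 0).symm
      simp only [hc', tm, ha]
      rcases Nat.eq_zero_or_pos m with rfl | h
      · simp [r0, Complex.conj_ofNat]
      · simp [h.ne']
    · simp only [hc', tm, ha, hn.ne', if_false, rfc_neg, sub_zero]
      push_cast
      congr 2
      · ring
      · ring_nf
  refine ⟨2 ^ 7 * (B₀ + B₇), a, fun M' hM' => ⟨fun n => ?_, hadd, fun m hm => hd m (by omega)⟩⟩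
  have h1 : ‖a n‖ ≤ ‖rfc (g 0) n‖ := by
    by_cases h : n = 0
    · subst h; simp [ha]
    · simp [ha, h]
  have h2 := nk' n
  simp only [Int.cast_natCast, Nat.abs_cast] at h2
  exact h1.trans (h2.trans (by gcongr))
end DualBilliard

namespace DualBilliard
open Filter Topology

/-- The contact point of the supporting line with outer normal angle `θ`. -/
noncomputable def cpt (p : ℝ → ℝ) (θ : ℝ) : ℝ × ℝ :=
  (p θ * cos θ - deriv p θ * sin θ, p θ * sin θ + deriv p θ * cos θ)

section
variable {K : Set (ℝ × ℝ)} {p : ℝ → ℝ} (hK : IsCompact K) (hI : (interior K).Nonempty)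
  (hp : ∀ θ, p θ = suppFn K θ) (hd : Differentiable ℝ p)

include hp in
lemma supp_le (hK : IsCompact K) {a : ℝ × ℝ} (ha : a ∈ K) (θ : ℝ) : a.1 * cos θ + a.2 * sin θ ≤ p θ := by
  rw [hp, suppFn]
  refine le_csSup (hK.image (by fun_prop)).bddAbove ⟨a, ha, rfl⟩

include hp in
lemma exists_supp (hK : IsCompact K) (hI : (interior K).Nonempty) (θ : ℝ) :
    ∃ a ∈ K, a.1 * cos θ + a.2 * sin θ = p θ := by
  have := (hK.image (f := fun z : ℝ × ℝ => z.1 * Real.cos θ + z.2 * Real.sin θ) (by fun_prop)).sSup_mem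
    ((hI.mono interior_subset).image _)
  rw [hp, suppFn]
  exact this

include hK hp hd in
lemma eq_cpt {a : ℝ × ℝ} (ha : a ∈ K) {θ : ℝ} (h : a.1 * cos θ + a.2 * sin θ = p θ) : a = cpt p θ := by
  have hder : HasDerivAt (fun φ => p φ - (a.1 * cos φ + a.2 * sin φ))
      (deriv p θ - (a.1 * (-sin θ) + a.2 * cos θ)) θ :=
    (hd θ).hasDerivAt.sub (((hasDerivAt_cos θ).const_mul _).add ((hasDerivAt_sin θ).const_mul _))
  have hmin : IsLocalMin (fun φ => p φ - (a.1 * cos φ + a.2 * sin φ)) θ :=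
    Eventually.of_forall fun φ => by
      simp only [h, sub_self]; linarith [supp_le hp hK ha φ]
  have e := hmin.hasDerivAt_eq_zero hder
  have c := sin_sq_add_cos_sq θ
  have e' : deriv p θ = a.1 * (-sin θ) + a.2 * cos θ := by linarith
  apply Prod.ext
  · simp only [cpt, ← h, e']; linear_combination -a.1 * c
  · simp only [cpt, ← h, e']; linear_combination -a.2 * c

include hK hI hp hd in
lemma cpt_mem (θ : ℝ) : cpt p θ ∈ K ∧ (cpt p θ).1 * cos θ + (cpt p θ).2 * sin θ = p θ := by
  obtain ⟨a, ha, h⟩ := exists_supp hp hK hI θ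
  rw [← eq_cpt hK hp hd ha h]
  exact ⟨ha, h⟩

include hp in
lemma interior_lt (hK : IsCompact K) {a : ℝ × ℝ} (ha : a ∈ interior K) (θ : ℝ) :
    a.1 * cos θ + a.2 * sin θ < p θ := by
  have hc : Tendsto (fun t : ℝ => (a.1 + t * cos θ, a.2 + t * sin θ)) (𝓝[>] 0) (𝓝 a) := by
    have : Continuous fun t : ℝ => (a.1 + t * cos θ, a.2 + t * sin θ) := by fun_prop
    simpa using (this.tendsto 0).mono_left (nhdsWithin_le_nhds (s := Set.Ioi 0))
  obtain ⟨t, ht, ht0⟩ := ((hc.eventually (isOpen_interior.mem_nhds ha)).and self_mem_nhdsWithin).exists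
  have h1 := supp_le hp hK (interior_subset ht) θ
  have c := sin_sq_add_cos_sq θ
  have h2 : (0 : ℝ) < t := ht0
  have : (a.1 + t * cos θ) * cos θ + (a.2 + t * sin θ) * sin θ = a.1 * cos θ + a.2 * sin θ + t := by
    linear_combination t * c
  simp only at h1
  linarith

include hK hI hp hd in
lemma frontier_eq_range (hC : Convex ℝ K) : frontier K = Set.range (cpt p) := by
  ext a
  constructor
  · intro ha
    have haK : a ∈ K := hK.isClosed.frontier_subset ha
    have hni : a ∉ interior K := ha.2
    obtain ⟨f, hf⟩ := geometric_hahn_banach_open_point hC.interior isOpen_interior hni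
    have hle : ∀ b ∈ K, f b ≤ f a := by
      have : K ⊆ closure (interior K) := by
        rw [hC.closure_interior_eq_closure_of_nonempty_interior hI]; exact subset_closure
      intro b hb
      exact closure_minimal (fun c hc => (hf c hc).le) (isClosed_le f.continuous continuous_const) (this hb)
    have hfe : ∀ b : ℝ × ℝ, f b = b.1 * f (1, 0) + b.2 * f (0, 1) := fun b => by
      have : b = b.1 • ((1 : ℝ), (0 : ℝ)) + b.2 • ((0 : ℝ), (1 : ℝ)) := by ext <;> simp
      conv_lhs => rw [this, map_add, map_smul, map_smul, smul_eq_mul, smul_eq_mul]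
    set w : ℂ := ⟨f (1, 0), f (0, 1)⟩ with hw
    have hw0 : 0 < ‖w‖ := by
      rw [norm_pos_iff]
      intro h0
      obtain ⟨o, ho⟩ := hI
      have h1 : f (1, 0) = 0 := by have := congrArg Complex.re h0; simpa [hw] using this
      have h2 : f (0, 1) = 0 := by have := congrArg Complex.im h0; simpa [hw] using this
      have := hf o ho
      rw [hfe o, hfe a, h1, h2] at this
      simp at this
    have hr : f (1, 0) = ‖w‖ * cos w.arg := by rw [Complex.norm_mul_cos_arg]
    have hi : f (0, 1) = ‖w‖ * sin w.arg := by rw [Complex.norm_mul_sin_arg]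
    have hfb : ∀ b : ℝ × ℝ, f b = ‖w‖ * (b.1 * cos w.arg + b.2 * sin w.arg) := fun b => by
      rw [hfe b, hr, hi]; ring
    refine ⟨w.arg, (eq_cpt hK hp hd haK (le_antisymm (supp_le hp hK haK _) ?_)).symm⟩
    obtain ⟨b, hb, he⟩ := exists_supp hp hK hI w.arg
    have := hle b hb
    rw [hfb, hfb, he] at this
    exact le_of_mul_le_mul_left this hw0
  · rintro ⟨θ, rfl⟩
    obtain ⟨h1, h2⟩ := cpt_mem hK hI hp hd θ
    exact ⟨subset_closure h1, fun h => (interior_lt hp hK h θ).ne h2⟩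

/-- The backward tangent point at distance `l`. -/
noncomputable def tpt (p : ℝ → ℝ) (θ l : ℝ) : ℝ × ℝ :=
  ((cpt p θ).1 + l * sin θ, (cpt p θ).2 - l * cos θ)

lemma tpt_normal (θ l : ℝ) : (tpt p θ l).1 * cos θ + (tpt p θ l).2 * sin θ = p θ := by
  have c := sin_sq_add_cos_sq θ
  simp only [tpt, cpt]; linear_combination p θ * c

include hK hp hd in
lemma tpt_notMem {θ l : ℝ} (hl : 0 < l) : tpt p θ l ∉ K := fun h => by
  have e := eq_cpt hK hp hd h (tpt_normal θ l)
  have c := sin_sq_add_cos_sq θ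
  have e1 := congrArg Prod.fst e
  have e2 := congrArg Prod.snd e
  simp only [tpt] at e1 e2
  have : l * (sin θ ^ 2 + cos θ ^ 2) = 0 := by linear_combination sin θ * e1 - cos θ * e2
  rw [c] at this; linarith

include hK hI hp hd in
lemma sin_nonpos_of_tpt_eq {θ φ l m : ℝ} (hl : 0 < l) (e : tpt p θ l = tpt p φ m) : sin (φ - θ) ≤ 0 := by
  have h1 := supp_le hp hK (cpt_mem hK hI hp hd θ).1 φ
  have h2 := tpt_normal (p := p) φ m
  rw [← e] at h2
  simp only [tpt] at h2
  rw [sin_sub]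
  by_contra h
  have : 0 < l * (sin φ * cos θ - cos φ * sin θ) := mul_pos hl (by linarith)
  nlinarith

include hK hI hp hd in
/-- A point outside lies on exactly one backward tangent ray. -/
lemma tpt_inj {θ φ l m : ℝ} (hl : 0 < l) (hm : 0 < m) (e : tpt p θ l = tpt p φ m) :
    cos φ = cos θ ∧ sin φ = sin θ ∧ l = m ∧ cpt p θ = cpt p φ := by
  have s1 := sin_nonpos_of_tpt_eq hK hI hp hd hl e
  have s2 := sin_nonpos_of_tpt_eq hK hI hp hd hm e.symm
  rw [← neg_sub, sin_neg] at s2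
  have s0 : sin (φ - θ) = 0 := by linarith
  have hc : cos φ = cos θ * cos (φ - θ) := by
    conv_lhs => rw [show φ = θ + (φ - θ) by ring, cos_add, s0]
    ring
  have hs : sin φ = sin θ * cos (φ - θ) := by
    conv_lhs => rw [show φ = θ + (φ - θ) by ring, sin_add, s0]
    ring
  have c := sin_sq_add_cos_sq θ
  rcases sin_eq_zero_iff_cos_eq.1 s0 with h | h
  · rw [h, mul_one] at hc hs
    have hcp : cpt p θ = cpt p φ := by
      obtain ⟨a1, a2⟩ := cpt_mem hK hI hp hd φ
      have : p φ = p θ := by rw [hp, hp, suppFn, suppFn, hc, hs]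
      rw [hc, hs, this] at a2
      exact (eq_cpt hK hp hd a1 a2).symm
    refine ⟨hc, hs, ?_, hcp⟩
    have e1 := congrArg Prod.fst e
    have e2 := congrArg Prod.snd e
    simp only [tpt, hcp, hc, hs] at e1 e2
    linear_combination sin θ * e1 - cos θ * e2 - (l - m) * c
  · exfalso
    obtain ⟨o, ho⟩ := hI
    have i1 := interior_lt hp hK ho θ
    have i2 := interior_lt hp hK ho φ
    have n1 := tpt_normal (p := p) θ l
    have n2 := tpt_normal (p := p) φ m
    rw [← e] at n2
    rw [h] at hc hs
    rw [hc, hs] at i2 n2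
    linarith
end
end DualBilliard

namespace DualBilliard
open Filter Topology

lemma contDiff_add_two {p : ℝ → ℝ} {n : ℕ} (h2 : ContDiff ℝ 2 p) (h : ContDiff ℝ n (deriv (deriv p))) :
    ContDiff ℝ (n + 2 : ℕ) p := by
  have h1 : ContDiff ℝ 1 (deriv p) := (contDiff_succ_iff_deriv.1 (show ContDiff ℝ (1 + 1) p from by
    rw [one_add_one_eq_two]; exact h2)).2.2
  have e : ContDiff ℝ (n + 1) (deriv p) :=
    contDiff_succ_iff_deriv.2 ⟨h1.differentiable one_ne_zero, by simp, h⟩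
  have : ContDiff ℝ ((n + 1 : ℕ) + 1) p :=
    contDiff_succ_iff_deriv.2 ⟨h2.differentiable two_ne_zero, by simp, by exact_mod_cast e⟩
  exact_mod_cast this

lemma contDiff_supp {p : ℝ → ℝ} (h2 : ContDiff ℝ 2 p)
    (hρ : ContDiff ℝ (6 : ℕ) (fun θ => p θ + deriv (deriv p) θ)) : ContDiff ℝ (8 : ℕ) p := by
  have step : ∀ n : ℕ, n ≤ 6 → ContDiff ℝ n p → ContDiff ℝ (n + 2 : ℕ) p := fun n hn h => by
    refine contDiff_add_two h2 ?_
    have := (hρ.of_le (m := (n : WithTop ℕ∞)) (by exact_mod_cast hn)).sub h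
    simpa using this
  exact step 6 le_rfl (step 4 (by norm_num) (step 2 (by norm_num) (by exact_mod_cast h2)))

lemma hasDerivAt_iteratedDeriv {f : ℝ → ℝ} {n m : ℕ} (hf : ContDiff ℝ n f) (hm : m < n) (t : ℝ) :
    HasDerivAt (iteratedDeriv m f) (iteratedDeriv (m + 1) f t) t := by
  rw [iteratedDeriv_succ]
  exact (hf.differentiable_iteratedDeriv m (by exact_mod_cast hm) t).hasDerivAt

/-- The equiaffine type parametrisation of a strictly convex curve. -/
theorem exists_param {p : ℝ → ℝ} (hper : ∀ θ, p (θ + 2 * π) = p θ) (hp8 : ContDiff ℝ (8 : ℕ) p)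
    (hpos : ∀ θ, 0 < p θ + deriv (deriv p) θ) :
    ∃ (x y : ℕ → ℝ → ℝ) (M : ℝ) (a b : ℕ → ℂ) (c : ℝ) (Θ w : ℝ → ℝ), Cf M a x ∧ Cf M b y ∧
      (∀ t, x 1 t * y 2 t - y 1 t * x 2 t = c) ∧ 0 < c ∧ StrictMono Θ ∧ Continuous Θ ∧
      (∀ t, Θ (t + 2 * π) = Θ t + 2 * π) ∧ (∀ t, 0 < w t) ∧ (∀ t, (x 0 t, y 0 t) = cpt p (Θ t)) ∧
      (∀ t, x 1 t = -(w t * sin (Θ t))) ∧ ∀ t, y 1 t = w t * cos (Θ t) := by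
  have hπ := Real.pi_pos
  have hp7 : ContDiff ℝ (7 : ℕ) (deriv p) := by
    have h : ContDiff ℝ ((7 : ℕ) + 1) p := by exact_mod_cast hp8
    exact (contDiff_succ_iff_deriv.1 h).2.2
  have hp6 : ContDiff ℝ (6 : ℕ) (deriv (deriv p)) := by
    have h : ContDiff ℝ ((6 : ℕ) + 1) (deriv p) := by exact_mod_cast hp7
    exact (contDiff_succ_iff_deriv.1 h).2.2
  have d0 : ∀ θ, HasDerivAt p (deriv p θ) θ := fun θ => (hp8.differentiable (by simp) θ).hasDerivAt
  have d1 : ∀ θ, HasDerivAt (deriv p) (deriv (deriv p) θ) θ := fun θ =>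
    (hp7.differentiable (by simp) θ).hasDerivAt
  have per1 := periodic_deriv d0 hper
  have per2 := periodic_deriv d1 per1
  set ρ : ℝ → ℝ := fun θ => p θ + deriv (deriv p) θ with hρ
  have hρpos : ∀ θ, 0 < ρ θ := hpos
  have hρ6 : ContDiff ℝ (6 : ℕ) ρ := (hp8.of_le (by norm_num)).add hp6
  have hρper : ∀ θ, ρ (θ + 2 * π) = ρ θ := fun θ => by simp only [hρ, hper, per2]
  set q : ℝ → ℝ := fun θ => ρ θ ^ (2 / 3 : ℝ) with hq
  have hq6 : ContDiff ℝ (6 : ℕ) q := hρ6.rpow_const_of_ne fun θ => (hpos θ).ne'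
  have hqpos : ∀ θ, 0 < q θ := fun θ => rpow_pos_of_pos (hpos θ) _
  have hqper : Function.Periodic q (2 * π) := fun θ => by simp only [hq, hρper]
  have hqc := hq6.continuous
  set I := ∫ θ in (0 : ℝ)..2 * π, q θ with hI
  have hIpos : 0 < I := intervalIntegral.intervalIntegral_pos_of_pos_on (hqc.intervalIntegrable _ _)
    (fun θ _ => hqpos θ) (by positivity)
  set L := 2 * π / I with hL
  have hLpos : 0 < L := by positivity
  set X : ℝ → ℝ := fun θ => L * ∫ s in (0 : ℝ)..θ, q s with hX
  have dX : ∀ θ, HasDerivAt X (L * q θ) θ := fun θ =>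
    (intervalIntegral.integral_hasDerivAt_right (hqc.intervalIntegrable _ _)
      (hqc.stronglyMeasurableAtFilter _ _) hqc.continuousAt).const_mul L
  have hX7 : ContDiff ℝ (7 : ℕ) X := by
    have h : ContDiff ℝ ((6 : ℕ) + 1) X := contDiff_succ_iff_deriv.2
      ⟨fun θ => (dX θ).differentiableAt, by simp, by
        rw [show deriv X = fun θ => L * q θ from funext fun θ => (dX θ).deriv]
        exact contDiff_const.mul hq6⟩
    exact_mod_cast h
  have hXper : ∀ θ, X (θ + 2 * π) = X θ + 2 * π := fun θ => by
    simp only [hX]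
    rw [← intervalIntegral.integral_add_adjacent_intervals (b := θ) (hqc.intervalIntegrable _ _)
      (hqc.intervalIntegrable _ _), hqper.intervalIntegral_add_eq θ 0, zero_add, ← hI, mul_add, hL,
      div_mul_cancel₀ _ hIpos.ne']
  have hXmono : StrictMono X := strictMono_of_deriv_pos fun θ => by
    rw [(dX θ).deriv]; exact mul_pos hLpos (hqpos θ)
  have hXs : Function.Surjective X := by
    obtain ⟨B, hB, hb⟩ := exists_bound_of_periodic (u := fun θ => X θ - θ)
      (hX7.continuous.sub continuous_id) fun θ => by rw [hXper]; ring
    intro z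
    have h1 := abs_le.1 (hb (z - B))
    have h2 := abs_le.1 (hb (z + B))
    obtain ⟨t, -, ht⟩ := intermediate_value_Icc (by linarith) hX7.continuous.continuousOn
      (show z ∈ Set.Icc (X (z - B)) (X (z + B)) from ⟨by linarith, by linarith⟩)
    exact ⟨t, ht⟩
  set e := (hXmono.orderIsoOfSurjective X hXs).toHomeomorph with he
  have heX : ∀ θ, e θ = X θ := fun θ => rfl
  set Θ : ℝ → ℝ := fun t => e.symm t with hΘ
  have hXΘ : ∀ t, X (Θ t) = t := fun t => e.apply_symm_apply t
  have hΘX : ∀ θ, Θ (X θ) = θ := fun t => e.symm_apply_apply t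
  have hΘ7 : ContDiff ℝ (7 : ℕ) Θ := e.contDiff_symm_deriv (f' := fun θ => L * q θ)
    (fun θ => (mul_pos hLpos (hqpos θ)).ne') dX hX7
  have dΘ : ∀ t, HasDerivAt Θ (L * q (Θ t))⁻¹ t := fun t =>
    (dX (Θ t)).of_local_left_inverse hΘ7.continuous.continuousAt
      (mul_pos hLpos (hqpos _)).ne' (Eventually.of_forall hXΘ)
  have hΘmono : StrictMono Θ := fun s t hst => by
    rw [← hXmono.lt_iff_lt, hXΘ, hXΘ]; exact hst
  have hΘper : ∀ t, Θ (t + 2 * π) = Θ t + 2 * π := fun t => by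
    apply hXmono.injective; rw [hXper, hXΘ, hXΘ]
  have hp8' : ContDiff ℝ (7 : ℕ) p := hp8.of_le (by norm_num)
  set f : ℝ → ℝ := fun t => (cpt p (Θ t)).1 with hf
  set g : ℝ → ℝ := fun t => (cpt p (Θ t)).2 with hg
  have hf7 : ContDiff ℝ (7 : ℕ) f := by
    have : ContDiff ℝ (7 : ℕ) fun θ => (cpt p θ).1 :=
      (hp8'.mul (contDiff_cos)).sub (hp7.mul contDiff_sin)
    exact this.comp hΘ7
  have hg7 : ContDiff ℝ (7 : ℕ) g := by
    have : ContDiff ℝ (7 : ℕ) fun θ => (cpt p θ).2 :=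
      (hp8'.mul (contDiff_sin)).add (hp7.mul contDiff_cos)
    exact this.comp hΘ7
  have cper : ∀ θ, cpt p (θ + 2 * π) = cpt p θ := fun θ => by
    simp only [cpt, hper, per1, cos_add_two_pi, sin_add_two_pi]
  set v : ℝ → ℝ := fun θ => ρ θ ^ (1 / 3 : ℝ) / L with hv
  have hv6 : ContDiff ℝ (6 : ℕ) v := (hρ6.rpow_const_of_ne fun θ => (hpos θ).ne').div_const _
  have hvq : ∀ θ, ρ θ * (L * q θ)⁻¹ = v θ := fun θ => by
    have h0 := rpow_pos_of_pos (hρpos θ) (1 / 3)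
    have h1 : q θ = (ρ θ ^ (1 / 3 : ℝ)) ^ 2 := by
      simp only [hq]
      rw [← rpow_natCast, ← rpow_mul (hρpos θ).le]; norm_num
    have h2 : ρ θ = (ρ θ ^ (1 / 3 : ℝ)) ^ 3 := by
      rw [← rpow_natCast, ← rpow_mul (hρpos θ).le]; norm_num
    rw [h1]
    simp only [hv]
    generalize ρ θ ^ (1 / 3 : ℝ) = s at *
    rw [h2]
    field_simp
  have hvv : ∀ θ, v θ ^ 2 * (L * q θ)⁻¹ = (L ^ 3)⁻¹ := fun θ => by
    have h0 := rpow_pos_of_pos (hρpos θ) (1 / 3)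
    have h1 : q θ = (ρ θ ^ (1 / 3 : ℝ)) ^ 2 := by
      simp only [hq]
      rw [← rpow_natCast, ← rpow_mul (hρpos θ).le]; norm_num
    rw [h1]
    simp only [hv]
    generalize ρ θ ^ (1 / 3 : ℝ) = s at *
    field_simp
  have df : ∀ t, HasDerivAt f (-(v (Θ t) * sin (Θ t))) t := fun t => by
    have h1 : HasDerivAt (fun θ => (cpt p θ).1) (-(ρ (Θ t) * sin (Θ t))) (Θ t) := by
      refine (((d0 _).mul (hasDerivAt_cos _)).sub ((d1 _).mul (hasDerivAt_sin _))).congr_deriv ?_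
      simp only [hρ]; ring
    refine (h1.comp t (dΘ t)).congr_deriv ?_
    rw [← hvq]; ring
  have dg : ∀ t, HasDerivAt g (v (Θ t) * cos (Θ t)) t := fun t => by
    have h1 : HasDerivAt (fun θ => (cpt p θ).2) (ρ (Θ t) * cos (Θ t)) (Θ t) := by
      refine (((d0 _).mul (hasDerivAt_sin _)).add ((d1 _).mul (hasDerivAt_cos _))).congr_deriv ?_
      simp only [hρ]; ring
    refine (h1.comp t (dΘ t)).congr_deriv ?_
    rw [← hvq]; ring
  have f1 : iteratedDeriv 1 f = fun t => -(v (Θ t) * sin (Θ t)) := by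
    rw [iteratedDeriv_one]; exact funext fun t => (df t).deriv
  have g1 : iteratedDeriv 1 g = fun t => v (Θ t) * cos (Θ t) := by
    rw [iteratedDeriv_one]; exact funext fun t => (dg t).deriv
  obtain ⟨M₁, a, ha⟩ := exists_cf (g := fun m => iteratedDeriv m f)
    (fun m hm t => hasDerivAt_iteratedDeriv hf7 hm t) (hf7.continuous_iteratedDeriv 7 (by simp))
    fun t => by simp only [iteratedDeriv_zero, hf, hΘper, cper]
  obtain ⟨M₂, b, hb⟩ := exists_cf (g := fun m => iteratedDeriv m g)
    (fun m hm t => hasDerivAt_iteratedDeriv hg7 hm t) (hg7.continuous_iteratedDeriv 7 (by simp))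
    fun t => by simp only [iteratedDeriv_zero, hg, hΘper, cper]
  refine ⟨_, _, max M₁ M₂, a, b, (L ^ 3)⁻¹, Θ, fun t => v (Θ t), ha _ (le_max_left _ _),
    hb _ (le_max_right _ _), fun t => ?_, by positivity, hΘmono, hΘ7.continuous, hΘper,
    fun t => div_pos (rpow_pos_of_pos (hpos _) _) hLpos, fun t => by simp [hf, hg],
    fun t => congrFun f1 t, fun t => congrFun g1 t⟩
  have dv : HasDerivAt (fun t => v (Θ t)) (deriv v (Θ t) * (L * q (Θ t))⁻¹) t :=
    (hv6.differentiable (by simp) (Θ t)).hasDerivAt.comp t (dΘ t)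
  have f2 := ((dv.mul ((hasDerivAt_sin _).comp t (dΘ t))).neg).unique
    (f1 ▸ hasDerivAt_iteratedDeriv hf7 (m := 1) (by norm_num) t)
  have g2 := (dv.mul ((hasDerivAt_cos _).comp t (dΘ t))).unique
    (g1 ▸ hasDerivAt_iteratedDeriv hg7 (m := 1) (by norm_num) t)
  simp only [Function.comp_apply] at f2 g2
  rw [← f2, ← g2, f1, g1, ← hvv (Θ t)]
  have c := sin_sq_add_cos_sq (Θ t)
  linear_combination v (Θ t) ^ 2 * (L * q (Θ t))⁻¹ * c
end DualBilliard

namespace DualBilliard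
open Filter Topology

/-- `(x 0, y 0)` parametrizes `∂K` by the normal angle `Θ t`, with speed `w t`. -/
structure Curve (K : Set (ℝ × ℝ)) (p : ℝ → ℝ) (x y : ℕ → ℝ → ℝ) (Θ w : ℝ → ℝ) : Prop where
  hK : IsCompact K
  hI : (interior K).Nonempty
  hp : ∀ θ, p θ = suppFn K θ
  hd : Differentiable ℝ p
  pper : ∀ θ, p (θ + 2 * π) = p θ
  derx : ∀ m < 2, ∀ t, HasDerivAt (x m) (x (m + 1) t) t
  dery : ∀ m < 2, ∀ t, HasDerivAt (y m) (y (m + 1) t) t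
  mono : StrictMono Θ
  cont : Continuous Θ
  per : ∀ t, Θ (t + 2 * π) = Θ t + 2 * π
  wpos : ∀ t, 0 < w t
  c0 : ∀ t, (x 0 t, y 0 t) = cpt p (Θ t)
  x1 : ∀ t, x 1 t = -(w t * sin (Θ t))
  y1 : ∀ t, y 1 t = w t * cos (Θ t)

namespace Curve
variable {K : Set (ℝ × ℝ)} {p : ℝ → ℝ} {x y : ℕ → ℝ → ℝ} {Θ w : ℝ → ℝ} (C : Curve K p x y Θ w)
include C

lemma tangentMap_eq (s l : ℝ) : tangentMap x y (s, l) = tpt p (Θ s) (l * w s) := by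
  have h := C.c0 s
  rw [Prod.ext_iff] at h
  simp only at h
  simp only [tangentMap, tpt, C.x1, C.y1, ← h.1, ← h.2]
  ext <;> simp only <;> ring

lemma per_int (t : ℝ) (k : ℤ) : Θ (t + k * (2 * π)) = Θ t + k * (2 * π) := by
  have h : ∀ (n : ℕ) t, Θ (t + n * (2 * π)) = Θ t + n * (2 * π) := by
    intro n
    induction n with
    | zero => simp
    | succ n ih =>
      intro t
      rw [show t + ((n + 1 : ℕ) : ℝ) * (2 * π) = t + n * (2 * π) + 2 * π by push_cast; ring, C.per, ih]
      push_cast; ring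
  obtain ⟨n, rfl | rfl⟩ := k.eq_nat_or_neg
  · exact_mod_cast h n t
  · have := h n (t + ((-n : ℤ) : ℝ) * (2 * π))
    push_cast at this ⊢
    rw [neg_mul, neg_add_cancel_right] at this
    rw [neg_mul]; linarith

lemma eq_of_tangentMap_eq {s l s' l' : ℝ} (hl : 0 < l) (hl' : 0 < l')
    (e : tangentMap x y (s, l) = tangentMap x y (s', l')) :
    ∃ k : ℤ, s' = s + k * (2 * π) ∧ l * w s = l' * w s' := by
  rw [C.tangentMap_eq, C.tangentMap_eq] at e
  obtain ⟨h1, h2, h3, -⟩ := tpt_inj C.hK C.hI C.hp C.hd (mul_pos hl (C.wpos s)) (mul_pos hl' (C.wpos s')) e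
  have : ((Θ s' : ℝ) : Real.Angle) = (Θ s : ℝ) := Real.Angle.cos_sin_inj h1 h2
  obtain ⟨k, hk⟩ := Real.Angle.angle_eq_iff_two_pi_dvd_sub.1 this
  refine ⟨k, C.mono.injective ?_, h3⟩
  rw [C.per_int]; linarith

lemma injOn_tangentMap : Set.InjOn (tangentMap x y) (Set.Ioo 0 (2 * π) ×ˢ Set.Ioi 0) := by
  rintro ⟨s, l⟩ ⟨hs, hl⟩ ⟨s', l'⟩ ⟨hs', hl'⟩ e
  simp only [Set.mem_Ioo, Set.mem_Ioi] at hs hl hs' hl'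
  obtain ⟨k, hk, hw⟩ := C.eq_of_tangentMap_eq hl hl' e
  have hp := Real.pi_pos
  have k1 : (k : ℝ) < 1 := by by_contra h; nlinarith
  have k2 : (-1 : ℝ) < k := by by_contra h; nlinarith
  have k0 : k = 0 := by
    have : k < 1 := by exact_mod_cast k1
    have : -1 < k := by exact_mod_cast k2
    omega
  subst k0
  simp only [Int.cast_zero, zero_mul, add_zero] at hk
  subst hk
  rw [mul_right_cancel₀ (C.wpos _).ne' hw]

lemma cpt_per (θ : ℝ) : cpt p (θ + 2 * π) = cpt p θ := by
  simp only [cpt, C.pper, cos_add_two_pi, sin_add_two_pi,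
    periodic_deriv (fun t => (C.hd t).hasDerivAt) C.pper]

lemma periodic {m : ℕ} (hm : m < 2) (t : ℝ) : x m (t + 2 * π) = x m t ∧ y m (t + 2 * π) = y m t := by
  have h0 : ∀ t, x 0 (t + 2 * π) = x 0 t ∧ y 0 (t + 2 * π) = y 0 t := fun t => by
    rw [← Prod.mk_inj, C.c0, C.c0, C.per, C.cpt_per]
  interval_cases m
  · exact h0 t
  · exact ⟨periodic_deriv (C.derx 0 (by norm_num)) (fun t => (h0 t).1) t,
      periodic_deriv (C.dery 0 (by norm_num)) (fun t => (h0 t).2) t⟩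

lemma continuous_x {m : ℕ} (hm : m < 2) : Continuous (x m) :=
  continuous_iff_continuousAt.2 fun t => (C.derx m hm t).continuousAt

lemma continuous_y {m : ℕ} (hm : m < 2) : Continuous (y m) :=
  continuous_iff_continuousAt.2 fun t => (C.dery m hm t).continuousAt

lemma rG_add_two_pi (s t : ℝ) : rG x y (s + 2 * π) (t + 2 * π) = rG x y s t := by
  simp only [rG, rD, (C.periodic (m := 0) (by norm_num) _).1, (C.periodic (m := 0) (by norm_num) _).2,
    (C.periodic (m := 1) (by norm_num) _).1, (C.periodic (m := 1) (by norm_num) _).2]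

lemma surjective : Function.Surjective Θ := by
  refine C.cont.surjective ?_ ?_
  · refine tendsto_atTop_mono' (f₁ := fun t => t - 2 * π + Θ 0) atTop ?_ ?_
    · filter_upwards with t
      have hp := Real.pi_pos
      have := C.per_int 0 ⌊t / (2 * π)⌋
      rw [zero_add] at this
      have h1 : (⌊t / (2 * π)⌋ : ℝ) * (2 * π) ≤ t := by
        rw [← le_div_iff₀ (by positivity)]; exact Int.floor_le _
      have h2 : t < (⌊t / (2 * π)⌋ + 1 : ℝ) * (2 * π) := by
        rw [← div_lt_iff₀ (by positivity)]; exact Int.lt_floor_add_one _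
      have := C.mono.monotone h1
      linarith
    · exact tendsto_atTop_add_const_right _ _ (tendsto_atTop_add_const_right _ _ tendsto_id)
  · refine tendsto_atBot_mono' (f₁ := fun t => t + 2 * π + Θ 0) atBot ?_ ?_
    · filter_upwards with t
      have hp := Real.pi_pos
      have := C.per_int 0 (⌊t / (2 * π)⌋ + 1)
      rw [zero_add] at this
      push_cast at this
      have h1 : (⌊t / (2 * π)⌋ : ℝ) * (2 * π) ≤ t := by
        rw [← le_div_iff₀ (by positivity)]; exact Int.floor_le _
      have h2 : t < (⌊t / (2 * π)⌋ + 1 : ℝ) * (2 * π) := by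
        rw [← div_lt_iff₀ (by positivity)]; exact Int.lt_floor_add_one _
      have := C.mono.monotone h2.le
      linarith
    · exact tendsto_atBot_add_const_right _ _ (tendsto_atBot_add_const_right _ _ tendsto_id)

lemma dualMap_tpt {Φ : ℝ × ℝ → ℝ × ℝ} (hΦ : ∀ z : ℝ × ℝ, z ∉ K → ∃ θ l : ℝ, ∃ a : ℝ × ℝ, 0 < l ∧ a ∈ K ∧
      a.1 * Real.cos θ + a.2 * Real.sin θ = p θ ∧
      z = a - l • ((-Real.sin θ, Real.cos θ) : ℝ × ℝ) ∧ Φ z = (2 : ℝ) • a - z)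
    {θ m : ℝ} (hm : 0 < m) : Φ (tpt p θ m) = (2 : ℝ) • cpt p θ - tpt p θ m := by
  obtain ⟨φ, l, a, hl, ha, hs, hz, hΦz⟩ := hΦ _ (tpt_notMem C.hK C.hp C.hd (θ := θ) hm)
  have hac := eq_cpt C.hK C.hp C.hd ha hs
  have hz' : tpt p θ m = tpt p φ l := by
    rw [hz, hac]; ext <;> simp [tpt]
  rw [hΦz, hac, (tpt_inj C.hK C.hI C.hp C.hd hm hl hz').2.2.2]

end Curve
end DualBilliard

namespace DualBilliard
open Filter Topology

/-- The point of the invariant curve with parameter `t`. -/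
noncomputable def circ (x y : ℕ → ℝ → ℝ) (ω : ℝ) (u : ℝ → ℝ) (t : ℝ) : ℝ × ℝ :=
  tangentMap x y (u t, rG x y (u t) (u (t + ω)))

section
variable {x y : ℕ → ℝ → ℝ} {δ ω : ℝ} {u : ℝ → ℝ} (hB : RBd x y δ) (hδ : 0 < δ)
  (hω : ω ∈ Set.Icc δ (2 * δ)) (U : InvU x y ω u)
include hB hδ hω U

omit hB in
lemma InvU.abs_step (t : ℝ) : δ / 2 ≤ |u (t + ω) - u t| ∧ |u (t + ω) - u t| ≤ 4 * δ := by
  have h1 := U.step_low hδ hω t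
  have h2 := U.step_upp hδ hω t
  rw [abs_of_nonneg (by linarith)]
  constructor <;> linarith

lemma rG_step_pos (t : ℝ) : 0 < rG x y (u t) (u (t + ω)) := by
  obtain ⟨h1, h2⟩ := U.abs_step hδ hω t
  have := abs_le.1 (hB.G _ _ h1 h2)
  have h3 := U.step_low hδ hω t
  rw [abs_of_nonneg (by linarith)] at this
  linarith

lemma rG_step_le (t : ℝ) : rG x y (u t) (u (t + ω)) ≤ 3 * δ := by
  obtain ⟨h1, h2⟩ := U.abs_step hδ hω t
  have := abs_le.1 (hB.G _ _ h1 h2)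
  have h3 := U.step_low hδ hω t
  rw [abs_of_nonneg (by linarith)] at this h2
  linarith

lemma sub_eq_rG (t : ℝ) {f : ℕ → ℝ → ℝ} (hf : f = x ∨ f = y) : f 0 (u (t + ω)) - f 0 (u t) =
    rG x y (u t) (u (t + ω)) * f 1 (u t) - rG x y (u (t + ω)) (u t) * f 1 (u (t + ω)) := by
  obtain ⟨h1, h2⟩ := U.abs_step hδ hω t
  have hD := hB.D _ _ h1 h2
  have e : rD x y (u (t + ω)) (u t) = -rD x y (u t) (u (t + ω)) := by simp only [rD]; ring
  simp only [rG, e]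
  field_simp
  rcases hf with rfl | rfl <;> simp only [rD] <;> ring

variable {K : Set (ℝ × ℝ)} {p : ℝ → ℝ} {Θ w : ℝ → ℝ} (C : Curve K p x y Θ w)
include C

lemma Curve.continuous_circ : Continuous (circ x y ω u) := by
  have := C.continuous_x (m := 0) (by norm_num)
  have := C.continuous_x (m := 1) (by norm_num)
  have := C.continuous_y (m := 0) (by norm_num)
  have := C.continuous_y (m := 1) (by norm_num)
  have := U.continuous
  have hG : Continuous fun t => rG x y (u t) (u (t + ω)) := by
    simp only [rG]
    refine Continuous.div (by fun_prop) (by simp only [rD]; fun_prop) fun t => ?_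
    obtain ⟨h1, h2⟩ := U.abs_step hδ hω t
    exact hB.D _ _ h1 h2
  change Continuous fun t => (x 0 (u t) - rG x y (u t) (u (t + ω)) * x 1 (u t),
    y 0 (u t) - rG x y (u t) (u (t + ω)) * y 1 (u t))
  fun_prop

omit hB hδ hω in
lemma Curve.circ_per (t : ℝ) : circ x y ω u (t + 2 * π) = circ x y ω u t := by
  simp only [circ, tangentMap, U.per, show t + 2 * π + ω = t + ω + 2 * π by ring, C.rG_add_two_pi,
    (C.periodic (m := 0) (by norm_num) _).1, (C.periodic (m := 0) (by norm_num) _).2,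
    (C.periodic (m := 1) (by norm_num) _).1, (C.periodic (m := 1) (by norm_num) _).2]

lemma Curve.circ_notMem (t : ℝ) : circ x y ω u t ∉ K := by
  rw [circ, C.tangentMap_eq]
  exact tpt_notMem C.hK C.hp C.hd (mul_pos (rG_step_pos hB hδ hω U t) (C.wpos _))

lemma Curve.circ_inj {t t' : ℝ} (e : circ x y ω u t = circ x y ω u t') : ∃ k : ℤ, t' = t + k * (2 * π) := by
  obtain ⟨k, hk, -⟩ := C.eq_of_tangentMap_eq (rG_step_pos hB hδ hω U t) (rG_step_pos hB hδ hω U t') e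
  rw [← U.per_int] at hk
  exact ⟨k, U.strictMono.injective hk⟩

lemma Curve.dualMap_circ {Φ : ℝ × ℝ → ℝ × ℝ} (hΦ : ∀ z : ℝ × ℝ, z ∉ K → ∃ θ l : ℝ, ∃ a : ℝ × ℝ, 0 < l ∧ a ∈ K ∧
      a.1 * Real.cos θ + a.2 * Real.sin θ = p θ ∧
      z = a - l • ((-Real.sin θ, Real.cos θ) : ℝ × ℝ) ∧ Φ z = (2 : ℝ) • a - z) (t : ℝ) :
    Φ (circ x y ω u t) = circ x y ω u (t + ω) := by
  have h1 := C.dualMap_tpt hΦ (θ := Θ (u t)) (mul_pos (rG_step_pos hB hδ hω U t) (C.wpos (u t)))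
  rw [← C.tangentMap_eq, ← C.c0] at h1
  have e := U.eq (t + ω)
  rw [add_sub_cancel_right] at e
  have e' := eq_neg_of_add_eq_zero_left e
  rw [circ, h1, circ, e']
  have a := sub_eq_rG hB hδ hω U t (f := x) (Or.inl rfl)
  have b := sub_eq_rG hB hδ hω U t (f := y) (Or.inr rfl)
  ext
  · simp [tangentMap]; linarith
  · simp [tangentMap]; linarith

lemma Curve.image_range_circ {Φ : ℝ × ℝ → ℝ × ℝ} (hΦ : ∀ z : ℝ × ℝ, z ∉ K → ∃ θ l : ℝ, ∃ a : ℝ × ℝ, 0 < l ∧ a ∈ K ∧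
      a.1 * Real.cos θ + a.2 * Real.sin θ = p θ ∧
      z = a - l • ((-Real.sin θ, Real.cos θ) : ℝ × ℝ) ∧ Φ z = (2 : ℝ) • a - z) :
    Φ '' Set.range (circ x y ω u) = Set.range (circ x y ω u) := by
  ext z
  constructor
  · rintro ⟨_, ⟨t, rfl⟩, rfl⟩
    exact ⟨t + ω, (C.dualMap_circ hB hδ hω U hΦ t).symm⟩
  · rintro ⟨t, rfl⟩
    refine ⟨_, ⟨t - ω, rfl⟩, ?_⟩
    rw [C.dualMap_circ hB hδ hω U hΦ, sub_add_cancel]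

lemma Curve.hausdorffDist_circ_le (hC : Convex ℝ K) {B : ℝ} (hB0 : 0 ≤ B) (hx : ∀ t, |x 1 t| ≤ B)
    (hy : ∀ t, |y 1 t| ≤ B) :
    Metric.hausdorffDist (Set.range (circ x y ω u)) (frontier K) ≤ 3 * δ * B := by
  have hd : ∀ t, dist (circ x y ω u t) (cpt p (Θ (u t))) ≤ 3 * δ * B := by
    intro t
    have h0 := rG_step_pos hB hδ hω U t
    have h1 := rG_step_le hB hδ hω U t
    rw [← C.c0, Prod.dist_eq, max_le_iff]
    simp only [circ, tangentMap, Real.dist_eq]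
    constructor
    · rw [sub_sub_cancel_left, abs_neg, abs_mul, abs_of_pos h0]
      exact mul_le_mul h1 (hx _) (abs_nonneg _) (by positivity)
    · rw [sub_sub_cancel_left, abs_neg, abs_mul, abs_of_pos h0]
      exact mul_le_mul h1 (hy _) (abs_nonneg _) (by positivity)
  have hf := frontier_eq_range C.hK C.hI C.hp C.hd hC
  refine Metric.hausdorffDist_le_of_mem_dist (by positivity) ?_ ?_
  · rintro _ ⟨t, rfl⟩
    exact ⟨_, hf ▸ ⟨Θ (u t), rfl⟩, hd t⟩
  · intro a ha
    rw [hf] at ha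
    obtain ⟨θ, rfl⟩ := ha
    obtain ⟨s, rfl⟩ := C.surjective θ
    obtain ⟨t, rfl⟩ := U.surjective s
    exact ⟨_, ⟨t, rfl⟩, by rw [dist_comm]; exact hd t⟩

end
end DualBilliard

namespace DualBilliard
open Filter Topology

/-- The direction from `o` to a point of `X`. -/
noncomputable def direction {X : Set (ℝ × ℝ)} {o : ℝ × ℝ} (ho : o ∉ X) : C(X, Circle) where
  toFun z := ⟨(⟨z.1.1 - o.1, z.1.2 - o.2⟩ : ℂ) / ‖(⟨z.1.1 - o.1, z.1.2 - o.2⟩ : ℂ)‖, by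
    have : (⟨z.1.1 - o.1, z.1.2 - o.2⟩ : ℂ) ≠ 0 := fun h => by
      rw [Complex.ext_iff] at h
      have h1 : z.1.1 - o.1 = 0 := h.1
      have h2 : z.1.2 - o.2 = 0 := h.2
      exact ho ((Prod.ext (by linarith) (by linarith) : o = z.1) ▸ z.2)
    refine mem_sphere_zero_iff_norm.2 ?_
    rw [norm_div, Complex.norm_real, norm_norm, div_self (norm_ne_zero_iff.2 this)]⟩
  continuous_toFun := by
    have hc : Continuous fun z : X => (⟨z.1.1 - o.1, z.1.2 - o.2⟩ : ℂ) := by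
      have : (fun z : X => (⟨z.1.1 - o.1, z.1.2 - o.2⟩ : ℂ)) = fun z : X =>
          ((z.1.1 - o.1 : ℝ) : ℂ) + ((z.1.2 - o.2 : ℝ) : ℂ) * Complex.I := by
        ext z; exact Complex.mk_eq_add_mul_I _ _
      rw [this]; fun_prop
    refine Continuous.subtype_mk (hc.div (by fun_prop) fun z h => ?_) _
    have : (⟨z.1.1 - o.1, z.1.2 - o.2⟩ : ℂ) = 0 := by simpa using h
    rw [Complex.ext_iff] at this
    have h1 : z.1.1 - o.1 = 0 := this.1
    have h2 : z.1.2 - o.2 = 0 := this.2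
    exact ho ((Prod.ext (by linarith) (by linarith) : o = z.1) ▸ z.2)

lemma exists_pos_mul_direction {X : Set (ℝ × ℝ)} {o : ℝ × ℝ} (ho : o ∉ X) (z : X) {φ : ℝ}
    (h : Circle.exp φ = direction ho z) :
    ∃ R, 0 ≤ R ∧ z.1.1 - o.1 = R * cos φ ∧ z.1.2 - o.2 = R * sin φ := by
  have h' := congrArg (fun c : Circle => (c : ℂ)) h
  rw [Circle.coe_exp] at h'
  have e : ((direction ho z : Circle) : ℂ) = (⟨z.1.1 - o.1, z.1.2 - o.2⟩ : ℂ) / ‖(⟨z.1.1 - o.1, z.1.2 - o.2⟩ : ℂ)‖ := rfl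
  rw [e] at h'
  set v : ℂ := ⟨z.1.1 - o.1, z.1.2 - o.2⟩ with hv
  have e2 : v = (‖v‖ : ℂ) * Complex.exp (φ * Complex.I) := by
    rcases eq_or_ne v 0 with h0 | h0
    · simp [h0]
    · have : (‖v‖ : ℂ) ≠ 0 := by exact_mod_cast norm_ne_zero_iff.2 h0
      rw [h']; field_simp
  refine ⟨‖v‖, norm_nonneg _, ?_, ?_⟩
  · have := congrArg Complex.re e2
    rw [Complex.re_ofReal_mul, Complex.exp_ofReal_mul_I_re] at this
    exact this
  · have := congrArg Complex.im e2
    rw [Complex.im_ofReal_mul, Complex.exp_ofReal_mul_I_im] at this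
    exact this

/-- A loop whose normal angle turns once around a point is not null-homotopic. -/
lemma not_nullhomotopic {X : Set (ℝ × ℝ)} {o : ℝ × ℝ} (ho : o ∉ X) (ℓ : C(AddCircle (2 * π), X))
    {θ : ℝ → ℝ} (hθ : Continuous θ) (hper : ∀ t, θ (t + 2 * π) = θ t + 2 * π)
    (hpos : ∀ t : ℝ, 0 < ((ℓ t).1.1 - o.1) * cos (θ t) + ((ℓ t).1.2 - o.2) * sin (θ t)) :
    ¬ ContinuousMap.Nullhomotopic ℓ := by
  intro hn
  obtain ⟨c, hc⟩ := hn.comp_right (direction ho)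
  obtain ⟨F⟩ := hc.symm
  obtain ⟨t₀, rfl⟩ := Circle.exp_surjective c
  have H0 : ∀ a, F.toContinuousMap (0, a) = Circle.exp ((ContinuousMap.const (AddCircle (2 * π)) t₀) a) := fun a => by
    simp
  set L := Circle.isCoveringMap_exp.liftHomotopy F.toContinuousMap
    (ContinuousMap.const (AddCircle (2 * π)) t₀) H0 with hL
  have hlift : ∀ a : AddCircle (2 * π), Circle.exp (L (1, a)) = direction ho (ℓ a) := fun a => by
    have := congrFun (Circle.isCoveringMap_exp.liftHomotopy_lifts F.toContinuousMap _ H0) (1, a)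
    exact this.trans (F.apply_one a)
  set ψ : ℝ → ℝ := fun t => L (1, (t : AddCircle (2 * π))) - θ t with hψ
  have hψc : Continuous ψ := by
    have : Continuous fun t : ℝ => (t : AddCircle (2 * π)) := continuous_quotient_mk'
    fun_prop
  have hψpos : ∀ t, 0 < cos (ψ t) := by
    intro t
    obtain ⟨R, hR, h1, h2⟩ := exists_pos_mul_direction ho (ℓ t) (hlift t)
    have := hpos t
    rw [h1, h2] at this
    have e : R * cos (ψ t) = R * cos (L (1, (t : AddCircle (2 * π)))) * cos (θ t) +
        R * sin (L (1, (t : AddCircle (2 * π)))) * sin (θ t) := by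
      rw [hψ, cos_sub]; ring
    rw [← e] at this
    exact pos_of_mul_pos_right this hR
  have hp := Real.pi_pos
  have hend : ψ (2 * π) = ψ 0 - 2 * π := by
    have := hper 0
    rw [zero_add] at this
    simp only [hψ, this, AddCircle.coe_period]
    rw [show ((0 : ℝ) : AddCircle (2 * π)) = 0 from rfl]
    ring
  obtain ⟨t, -, ht⟩ := intermediate_value_Icc' (by positivity : (0 : ℝ) ≤ 2 * π) hψc.continuousOn
    (show ψ 0 - π ∈ Set.Icc (ψ (2 * π)) (ψ 0) by rw [hend]; constructor <;> linarith)
  have h1 := hψpos t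
  have h2 := hψpos 0
  rw [ht, cos_sub_pi] at h1
  linarith

end DualBilliard

namespace DualBilliard
open Filter Topology

section
variable {x y : ℕ → ℝ → ℝ} {δ ω : ℝ} {u : ℝ → ℝ} (hB : RBd x y δ) (hδ : 0 < δ)
  (hω : ω ∈ Set.Icc δ (2 * δ)) (U : InvU x y ω u)
  {K : Set (ℝ × ℝ)} {p : ℝ → ℝ} {Θ w : ℝ → ℝ} (C : Curve K p x y Θ w)
include hB hδ hω U C

lemma Curve.dbInvCircle {Φ : ℝ × ℝ → ℝ × ℝ} (hΦ : ∀ z : ℝ × ℝ, z ∉ K → ∃ θ l : ℝ, ∃ a : ℝ × ℝ, 0 < l ∧ a ∈ K ∧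
      a.1 * Real.cos θ + a.2 * Real.sin θ = p θ ∧
      z = a - l • ((-Real.sin θ, Real.cos θ) : ℝ × ℝ) ∧ Φ z = (2 : ℝ) • a - z) :
    DBInvCircle K Φ (Set.range (circ x y ω u)) := by
  have hper : Function.Periodic (fun t => (⟨circ x y ω u t, C.circ_notMem hB hδ hω U t⟩ : (Kᶜ : Set (ℝ × ℝ))))
      (2 * π) := fun t => Subtype.ext (C.circ_per U t)
  set ℓ : C(AddCircle (2 * π), (Kᶜ : Set (ℝ × ℝ))) :=
    ⟨hper.lift, continuous_coinduced_dom.2 ((C.continuous_circ hB hδ hω U).subtype_mk _)⟩ with hℓ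
  have happ : ∀ t : ℝ, (ℓ t).1 = circ x y ω u t := fun t => rfl
  have hrange : Set.range (circ x y ω u) = Subtype.val '' Set.range ℓ := by
    rw [← Set.range_comp]
    ext z
    constructor
    · rintro ⟨t, rfl⟩; exact ⟨t, rfl⟩
    · rintro ⟨a, rfl⟩
      obtain ⟨t, rfl⟩ := QuotientAddGroup.mk_surjective a
      exact ⟨t, rfl⟩
  have : Fact (0 < 2 * π) := ⟨by positivity⟩
  refine ⟨?_, ?_, C.image_range_circ hB hδ hω U hΦ, ℓ, ?_, ?_, hrange⟩
  · rintro _ ⟨t, rfl⟩; exact C.circ_notMem hB hδ hω U t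
  · rw [hrange, ← Set.range_comp]
    exact isCompact_range (by fun_prop)
  · intro a b hab
    obtain ⟨t, rfl⟩ := QuotientAddGroup.mk_surjective a
    obtain ⟨t', rfl⟩ := QuotientAddGroup.mk_surjective b
    obtain ⟨k, rfl⟩ := C.circ_inj hB hδ hω U (t := t) (t' := t') (congrArg Subtype.val hab)
    refine QuotientAddGroup.eq.2 (AddSubgroup.mem_zmultiples_iff.2 ⟨k, ?_⟩)
    rw [zsmul_eq_mul]; ring
  · obtain ⟨o, ho⟩ := C.hI
    refine not_nullhomotopic (o := o) (X := Kᶜ) (fun h => h (interior_subset ho)) ℓ (θ := fun t => Θ (u t))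
      (C.cont.comp U.continuous) (fun t => by simp only [U.per, C.per]) fun t => ?_
    have h1 := interior_lt C.hp C.hK ho (Θ (u t))
    have h2 := tpt_normal (p := p) (Θ (u t)) (rG x y (u t) (u (t + ω)) * w (u t))
    rw [← C.tangentMap_eq] at h2
    change (circ x y ω u t).1 * _ + (circ x y ω u t).2 * _ = _ at h2
    rw [happ]
    linarith
end

lemma supp_periodic {K : Set (ℝ × ℝ)} {p : ℝ → ℝ} (hp : ∀ θ, p θ = suppFn K θ) (θ : ℝ) :
    p (θ + 2 * π) = p θ := by
  simp only [hp, suppFn, cos_add_two_pi, sin_add_two_pi]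

theorem volume_sUnion_dbInvCircle_pos {K : Set (ℝ × ℝ)} (hK : IsCompact K) (hC : Convex ℝ K)
    (hI : (interior K).Nonempty) {p : ℝ → ℝ} (hp : ∀ θ, p θ = suppFn K θ) (hpC2 : ContDiff ℝ 2 p)
    (hρ : ContDiff ℝ (6 : ℕ) (fun θ => p θ + deriv (deriv p) θ))
    (hρpos : ∀ θ, 0 < p θ + deriv (deriv p) θ) {Φ : ℝ × ℝ → ℝ × ℝ}
    (hΦ : ∀ z : ℝ × ℝ, z ∉ K → ∃ θ l : ℝ, ∃ a : ℝ × ℝ, 0 < l ∧ a ∈ K ∧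
      a.1 * Real.cos θ + a.2 * Real.sin θ = p θ ∧
      z = a - l • ((-Real.sin θ, Real.cos θ) : ℝ × ℝ) ∧ Φ z = (2 : ℝ) • a - z)
    {ε : ℝ} (hε : 0 < ε) :
    0 < volume (⋃₀ {Ω : Set (ℝ × ℝ) | DBInvCircle K Φ Ω ∧ Metric.hausdorffDist Ω (frontier K) < ε}) := by
  have hper := supp_periodic hp
  obtain ⟨x, y, M, a, b, c, Θ, w, hx, hy, hk, hc, hm, hcont, hΘ, hw, h0, h1, h2⟩ :=
    exists_param hper (contDiff_supp hpC2 hρ) hρpos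
  have C : Curve K p x y Θ w := ⟨hK, hI, hp, hpC2.differentiable (by norm_num), hper,
    fun m hm => hx.der m (by omega), fun m hm => hy.der m (by omega), hm, hcont, hΘ, hw, h0, h1, h2⟩
  obtain ⟨B₁, hB₁, hbx⟩ := exists_bound_of_periodic (C.continuous_x (m := 1) (by norm_num))
    fun t => (C.periodic (by norm_num) t).1
  obtain ⟨B₂, hB₂, hby⟩ := exists_bound_of_periodic (C.continuous_y (m := 1) (by norm_num))
    fun t => (C.periodic (by norm_num) t).2
  obtain ⟨δ, hδ, hδε, hB, D, hDc, hDs, hD, hU⟩ := kam hx hy hk hc (ε := ε / (4 * (B₁ + B₂ + 1))) (by positivity)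
  rw [lt_div_iff₀ (by positivity)] at hδε
  refine volume_image_tangentMap_pos hc C.derx C.dery hk C.injOn_tangentMap ?_
    (volume_circles_pos hB hδ (C.continuous_x (by norm_num)) (C.continuous_x (by norm_num))
      (C.continuous_y (by norm_num)) (C.continuous_y (by norm_num)) hDc hDs hD hU) ?_
  · rintro ⟨s, l⟩ ⟨hs, ω, hω, u, U, t, rfl, rfl⟩
    exact ⟨hs, rG_step_pos hB hδ (hDs hω) U t⟩
  · rintro ⟨s, l⟩ ⟨-, ω, hω, u, U, t, rfl, rfl⟩
    refine ⟨_, ⟨C.dbInvCircle hB hδ (hDs hω) U hΦ, ?_⟩, t, rfl⟩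
    refine (C.hausdorffDist_circ_le hB hδ (hDs hω) U hC (B := B₁ + B₂) (by positivity)
      (fun t => by linarith [hbx t]) (fun t => by linarith [hby t])).trans_lt ?_
    nlinarith [mul_nonneg hδ.le (add_nonneg hB₁ hB₂)]

end DualBilliard

theorem stmt13
    (K : Set (ℝ × ℝ))
    (hKcomp : IsCompact K) (hKconv : Convex ℝ K) (hKstrict : StrictConvex ℝ K)
    (hKint : (interior K).Nonempty)
    (p : ℝ → ℝ) (hp : ∀ θ : ℝ, p θ = suppFn K θ)
    (hpC2 : ContDiff ℝ 2 p)
    (r : ℕ) (hr : 5 < r)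
    (hρCr : ContDiff ℝ r (fun θ => p θ + deriv (deriv p) θ))
    (hρpos : ∀ θ : ℝ, 0 < p θ + deriv (deriv p) θ)
    (Φ : ℝ × ℝ → ℝ × ℝ)
    (hΦ : ∀ z : ℝ × ℝ, z ∉ K → ∃ θ l : ℝ, ∃ a : ℝ × ℝ, 0 < l ∧ a ∈ K ∧
      a.1 * Real.cos θ + a.2 * Real.sin θ = p θ ∧
      z = a - l • ((-Real.sin θ, Real.cos θ) : ℝ × ℝ) ∧
      Φ z = (2 : ℝ) • a - z)
    :
    ∀ ε : ℝ, 0 < ε →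
      0 < volume (⋃₀ {Ω : Set (ℝ × ℝ) | DBInvCircle K Φ Ω ∧
        Metric.hausdorffDist Ω (frontier K) < ε}) := by
  exact fun ε hε => DualBilliard.volume_sUnion_dbInvCircle_pos hKcomp hKconv hKint hp hpC2
    (hρCr.of_le (by exact_mod_cast hr)) hρpos hΦ hε
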